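/- Let Ω ⊂ ℝⁿ be a bounded domain, K ⊂ Ω a compact set, Ω' an open set with closure contained in Ω, T > 0, τ ∈ (0,T), A > 0 and ε > 0. Then there exists δ > 0, depending only on Ω, Ω', K, T, A, τ and ε, with the following property: for every measurable a : Ω×(0,T) → ℝⁿ with |a| ≤ A almost everywhere and every bounded solution u of u_t + a·∇u − Δu = 0 in Ω×(0,T) with sup_{Ω×(0,T)} |u| = M and sup_{x∈K} u(x,T) ≥ M(1−δ), one has u(x,t) ≥ M(1−ε) for all (x,t) ∈ Ω'×(τ,T). -/

import Mathlib

open MeasureTheory Real Filter Topology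

noncomputable section

/-- Euclidean space ℝⁿ. -/
abbrev Euc (n : ℕ) := EuclideanSpace ℝ (Fin n)

/-- The heat kernel Γ(x,t) = (4πt)^{-n/2} exp(-|x|²/(4t)). -/
noncomputable def heatKer (n : ℕ) (x : Euc n) (t : ℝ) : ℝ :=
  (4 * π * t) ^ (-(n : ℝ) / 2) * Real.exp (-‖x‖ ^ 2 / (4 * t))

/-- The fundamental solution G of the Laplacian on ℝⁿ (n ≥ 2). -/
noncomputable def lapFund (n : ℕ) (x : Euc n) : ℝ :=
  if n = 2 then (2 * π)⁻¹ * Real.log ‖x‖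
  else -((((n : ℝ) - 2) * (2 * π ^ ((n : ℝ) / 2) / Real.Gamma ((n : ℝ) / 2)))⁻¹) *
      ‖x‖ ^ (2 - (n : ℝ))

/-- The generating function Φ(x,t) = ∫_{ℝⁿ} G(y) Γ(x-y,t) dy. -/
noncomputable def genPhi (n : ℕ) (x : Euc n) (t : ℝ) : ℝ :=
  ∫ y : Euc n, lapFund n y * heatKer n (x - y) t

/-- Spatial partial derivative ∂f/∂x_i of a scalar function on ℝⁿ. -/
noncomputable def pd (n : ℕ) (i : Fin n) (f : Euc n → ℝ) (x : Euc n) : ℝ :=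
  fderiv ℝ f x (EuclideanSpace.single i 1)

/-- The Laplacian of a scalar function on ℝⁿ. -/
noncomputable def lap (n : ℕ) (f : Euc n → ℝ) (x : Euc n) : ℝ :=
  ∑ i : Fin n, pd n i (pd n i f) x

/-- The Oseen kernel K_{ij} = (-δ_{ij}Δ + ∂²/∂x_i∂x_j)Φ. -/
noncomputable def Kmat (n : ℕ) (i j : Fin n) (x : Euc n) (t : ℝ) : ℝ :=
  (if i = j then -(lap n (fun y => genPhi n y t) x) else 0)
    + pd n i (pd n j (fun y => genPhi n y t)) x

/-- The kernel K_{ijk} = ∂K_{ij}/∂x_k. -/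
noncomputable def Kten (n : ℕ) (i j k : Fin n) (x : Euc n) (t : ℝ) : ℝ :=
  pd n k (fun y => Kmat n i j y t) x

/-- Mild solution of the Navier–Stokes equations on ℝⁿ × (t₀,t₁) with initial datum u₀:
u_i(x,t) = ∫ Γ(x-y,t-t₀) u₀ᵢ(y) dy - ∫_{t₀}^t ∫ K_{ijk}(x-y,t-s) u_k u_j dy ds. -/
def IsMildNS (n : ℕ) (t₀ t₁ : ℝ) (u₀ : Euc n → Euc n) (u : Euc n → ℝ → Euc n) : Prop :=
  ∀ x : Euc n, ∀ t : ℝ, t ∈ Set.Ioo t₀ t₁ → ∀ i : Fin n,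
    u x t i = (∫ y : Euc n, heatKer n (x - y) (t - t₀) * u₀ y i)
      - ∫ s in Set.Ioo t₀ t, ∫ y : Euc n,
          ∑ j : Fin n, ∑ k : Fin n, Kten n i j k (x - y) (t - s) * u y s k * u y s j

/-- Spatial partial derivative for functions on space-time ℝⁿ × ℝ. -/
noncomputable def pdx (n : ℕ) (i : Fin n) (g : Euc n × ℝ → ℝ) (p : Euc n × ℝ) : ℝ :=
  fderiv ℝ g p (EuclideanSpace.single i 1, 0)

/-- Time derivative for functions on space-time ℝⁿ × ℝ. -/
noncomputable def pdt (n : ℕ) (g : Euc n × ℝ → ℝ) (p : Euc n × ℝ) : ℝ :=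
  fderiv ℝ g p (0, 1)

/-- Spatial Laplacian for functions on space-time ℝⁿ × ℝ. -/
noncomputable def lapx (n : ℕ) (g : Euc n × ℝ → ℝ) (p : Euc n × ℝ) : ℝ :=
  ∑ i : Fin n, pdx n i (pdx n i g) p

instance isAddHaarMeasure_volume_spaceTime (n : ℕ) :
    (volume : Measure (Euc n × ℝ)).IsAddHaarMeasure :=
  Measure.prod.instIsAddHaarMeasure _ _

/-- Mollification of a function on space-time by a normalised bump function. -/
def mol {n : ℕ} {F : Type*} [NormedAddCommGroup F] [NormedSpace ℝ F]
    (φ : ContDiffBump (0 : Euc n × ℝ)) (f : Euc n × ℝ → F) (p : Euc n × ℝ) : F :=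
  ∫ q, φ.normed volume (p - q) • f q

lemma mol_eq_convolution {n : ℕ} {F : Type*} [NormedAddCommGroup F] [NormedSpace ℝ F]
    (φ : ContDiffBump (0 : Euc n × ℝ)) (f : Euc n × ℝ → F) :
    mol φ f = convolution (φ.normed volume) f (ContinuousLinearMap.lsmul ℝ ℝ) volume := by
  ext p
  rw [mol, convolution_lsmul_swap]

lemma integrable_smul_comp_sub {n : ℕ} {F : Type*} [NormedAddCommGroup F] [NormedSpace ℝ F]
    {χ : Euc n × ℝ → ℝ} (hχ : Continuous χ) (hc : HasCompactSupport χ)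
    {f : Euc n × ℝ → F} (hf : LocallyIntegrable f) (p : Euc n × ℝ) :
    Integrable (fun q => χ (p - q) • f q) := by
  have h1 : HasCompactSupport (fun q => χ (p - q)) :=
    hc.comp_homeomorph (Homeomorph.subLeft p)
  exact hf.integrable_smul_left_of_hasCompactSupport
    (hχ.comp (continuous_const.sub continuous_id)) h1

lemma hasFDerivAt_conv {n : ℕ} {χ : Euc n × ℝ → ℝ} (hχ : ContDiff ℝ (⊤ : ℕ∞) χ)
    (hc : HasCompactSupport χ) {f : Euc n × ℝ → ℝ} (hf : LocallyIntegrable f) :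
    ContDiff ℝ (⊤ : ℕ∞) (fun p => ∫ q, χ (p - q) * f q) ∧
    ∀ p v, fderiv ℝ (fun p => ∫ q, χ (p - q) * f q) p v = ∫ q, fderiv ℝ χ (p - q) v * f q := by
  have e : (fun p => ∫ q, χ (p - q) * f q)
      = convolution χ f (ContinuousLinearMap.lsmul ℝ ℝ) volume := by
    ext p
    rw [convolution_lsmul_swap]
    simp only [smul_eq_mul]
  rw [e]
  refine ⟨hc.contDiff_convolution_left _ hχ hf, fun p v => ?_⟩
  have h1 : ContDiff ℝ 1 χ := hχ.of_le (by exact_mod_cast le_top)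
  rw [(hc.hasFDerivAt_convolution_left (ContinuousLinearMap.lsmul ℝ ℝ) h1 hf p).fderiv,
    convolution_eq_swap, ContinuousLinearMap.integral_apply]
  · rfl
  · have hd : Continuous (fderiv ℝ χ) := h1.continuous_fderiv one_ne_zero
    have := (hc.fderiv ℝ).convolutionExists_left
      ((ContinuousLinearMap.lsmul ℝ ℝ : ℝ →L[ℝ] ℝ →L[ℝ] ℝ).precompL (Euc n × ℝ)) hd hf p
    rw [convolutionExistsAt_iff_integrable_swap] at this
    exact this

lemma contDiff_pdx {n : ℕ} {χ : Euc n × ℝ → ℝ} (hχ : ContDiff ℝ (⊤ : ℕ∞) χ) (i : Fin n) :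
    ContDiff ℝ (⊤ : ℕ∞) (pdx n i χ) :=
  (hχ.fderiv_right (m := (⊤ : ℕ∞)) (by simp)).clm_apply contDiff_const

lemma contDiff_pdt {n : ℕ} {χ : Euc n × ℝ → ℝ} (hχ : ContDiff ℝ (⊤ : ℕ∞) χ) :
    ContDiff ℝ (⊤ : ℕ∞) (pdt n χ) :=
  (hχ.fderiv_right (m := (⊤ : ℕ∞)) (by simp)).clm_apply contDiff_const

lemma contDiff_lapx {n : ℕ} {χ : Euc n × ℝ → ℝ} (hχ : ContDiff ℝ (⊤ : ℕ∞) χ) :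
    ContDiff ℝ (⊤ : ℕ∞) (lapx n χ) :=
  ContDiff.sum fun i _ => contDiff_pdx (contDiff_pdx hχ i) i

lemma tsupport_pdx_subset {n : ℕ} (χ : Euc n × ℝ → ℝ) (i : Fin n) :
    tsupport (pdx n i χ) ⊆ tsupport χ :=
  tsupport_fderiv_apply_subset ℝ _

lemma tsupport_pdt_subset {n : ℕ} (χ : Euc n × ℝ → ℝ) : tsupport (pdt n χ) ⊆ tsupport χ :=
  tsupport_fderiv_apply_subset ℝ _

lemma tsupport_lapx_subset {n : ℕ} (χ : Euc n × ℝ → ℝ) : tsupport (lapx n χ) ⊆ tsupport χ := by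
  refine closure_minimal (fun p hp => ?_) (isClosed_tsupport _)
  by_contra h
  refine hp (Finset.sum_eq_zero fun i _ => ?_)
  by_contra h2
  exact h ((tsupport_pdx_subset _ i).trans (tsupport_pdx_subset _ i) (subset_tsupport _ h2))

lemma hasCompactSupport_pdx {n : ℕ} {χ : Euc n × ℝ → ℝ} (hc : HasCompactSupport χ) (i : Fin n) :
    HasCompactSupport (pdx n i χ) :=
  hc.of_isClosed_subset (isClosed_tsupport _) (tsupport_pdx_subset _ i)

lemma hasCompactSupport_pdt {n : ℕ} {χ : Euc n × ℝ → ℝ} (hc : HasCompactSupport χ) :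
    HasCompactSupport (pdt n χ) :=
  hc.of_isClosed_subset (isClosed_tsupport _) (tsupport_pdt_subset _)

lemma hasCompactSupport_lapx {n : ℕ} {χ : Euc n × ℝ → ℝ} (hc : HasCompactSupport χ) :
    HasCompactSupport (lapx n χ) :=
  hc.of_isClosed_subset (isClosed_tsupport _) (tsupport_lapx_subset _)

lemma fderiv_comp_const_sub_apply {E : Type*} [NormedAddCommGroup E] [NormedSpace ℝ E]
    (χ : E → ℝ) (p q v : E) : fderiv ℝ (fun q => χ (p - q)) q v = - fderiv ℝ χ (p - q) v := by
  have h1 : (fun q => χ (p - q)) = fun q => (fun r => χ (p + r)) (-q) := by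
    ext q; simp [sub_eq_add_neg]
  have h2 := fderiv_comp_smul (𝕜 := ℝ) (c := (-1 : ℝ)) (f := fun r => χ (p + r)) (x := q)
  simp only [neg_smul, one_smul] at h2
  rw [h1, h2, fderiv_comp_add_left, ← sub_eq_add_neg]
  simp

lemma pdx_comp_sub {n : ℕ} (χ : Euc n × ℝ → ℝ) (i : Fin n) (p q : Euc n × ℝ) :
    pdx n i (fun q => χ (p - q)) q = - pdx n i χ (p - q) := by
  exact fderiv_comp_const_sub_apply χ p q _

lemma pdt_comp_sub {n : ℕ} (χ : Euc n × ℝ → ℝ) (p q : Euc n × ℝ) :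
    pdt n (fun q => χ (p - q)) q = - pdt n χ (p - q) := by
  exact fderiv_comp_const_sub_apply χ p q _

lemma lapx_comp_sub {n : ℕ} (χ : Euc n × ℝ → ℝ) (p q : Euc n × ℝ) :
    lapx n (fun q => χ (p - q)) q = lapx n χ (p - q) := by
  simp only [lapx]
  refine Finset.sum_congr rfl fun i _ => ?_
  have : pdx n i (fun q => χ (p - q)) = fun q => (fun r => - pdx n i χ r) (p - q) := by
    ext q; exact pdx_comp_sub χ i p q
  rw [this, pdx_comp_sub (fun r => - pdx n i χ r)]
  have h : (fun r => - pdx n i χ r) = -(pdx n i χ) := rfl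
  rw [pdx, h, fderiv_neg, pdx]
  simp

lemma mol_contDiff {n : ℕ} (φ : ContDiffBump (0 : Euc n × ℝ)) {f : Euc n × ℝ → ℝ}
    (hf : LocallyIntegrable f) : ContDiff ℝ (⊤ : ℕ∞) (mol φ f) :=
  (hasFDerivAt_conv φ.contDiff_normed φ.hasCompactSupport_normed hf).1

lemma pdx_mol {n : ℕ} (φ : ContDiffBump (0 : Euc n × ℝ)) {f : Euc n × ℝ → ℝ}
    (hf : LocallyIntegrable f) (i : Fin n) :
    pdx n i (mol φ f) = fun p => ∫ q, pdx n i (φ.normed volume) (p - q) * f q := by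
  ext p
  exact (hasFDerivAt_conv φ.contDiff_normed φ.hasCompactSupport_normed hf).2 p _

lemma pdt_mol {n : ℕ} (φ : ContDiffBump (0 : Euc n × ℝ)) {f : Euc n × ℝ → ℝ}
    (hf : LocallyIntegrable f) :
    pdt n (mol φ f) = fun p => ∫ q, pdt n (φ.normed volume) (p - q) * f q := by
  ext p
  exact (hasFDerivAt_conv φ.contDiff_normed φ.hasCompactSupport_normed hf).2 p _

lemma lapx_mol {n : ℕ} (φ : ContDiffBump (0 : Euc n × ℝ)) {f : Euc n × ℝ → ℝ}
    (hf : LocallyIntegrable f) :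
    lapx n (mol φ f) = fun p => ∫ q, lapx n (φ.normed volume) (p - q) * f q := by
  ext p
  have h0 : ContDiff ℝ (⊤ : ℕ∞) (φ.normed volume) := φ.contDiff_normed
  simp only [lapx, Finset.sum_mul]
  rw [integral_finsetSum]
  · refine Finset.sum_congr rfl fun i _ => ?_
    rw [pdx_mol φ hf]
    exact (hasFDerivAt_conv (contDiff_pdx h0 i)
      (hasCompactSupport_pdx φ.hasCompactSupport_normed i) hf).2 p _
  · intro i _
    exact integrable_smul_comp_sub (contDiff_pdx (contDiff_pdx h0 i) i).continuous
      (hasCompactSupport_pdx (hasCompactSupport_pdx φ.hasCompactSupport_normed i) i) hf p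

lemma integrable_mol_integrand {n : ℕ} {F : Type*} [NormedAddCommGroup F] [NormedSpace ℝ F]
    (φ : ContDiffBump (0 : Euc n × ℝ)) {f : Euc n × ℝ → F} (hf : LocallyIntegrable f)
    (p : Euc n × ℝ) : Integrable (fun q => φ.normed volume (p - q) • f q) :=
  integrable_smul_comp_sub φ.continuous_normed φ.hasCompactSupport_normed hf p

/-- The mollification of a norm dominates the norm of the mollification, with a defect that
vanishes in `L¹` as the scale of the mollifier tends to `0`. -/
lemma tendsto_integral_mol_defect {n : ℕ} {F : Type*} [NormedAddCommGroup F] [NormedSpace ℝ F]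
    [CompleteSpace F]
    {G : Euc n × ℝ → F} (hG : Integrable G) {ψ : Euc n × ℝ → ℝ} (hψ : Continuous ψ)
    (hψc : HasCompactSupport ψ) (hψ0 : ∀ p, 0 ≤ ψ p) {φ : ℕ → ContDiffBump (0 : Euc n × ℝ)}
    (hφ : Tendsto (fun k => (φ k).rOut) atTop (𝓝 0)) :
    Tendsto (fun k => ∫ p, ψ p * (mol (φ k) (fun q => ‖G q‖) p - ‖mol (φ k) G p‖))
      atTop (𝓝 0) := by
  have hI : ∀ k {H : Euc n × ℝ → ℝ}, Integrable H → Integrable (mol (φ k) H) := fun k H hH => by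
    rw [mol_eq_convolution]
    exact (φ k).integrable_normed.integrable_convolution _ hH
  have hnn : ∀ k p, 0 ≤ mol (φ k) (fun q => ‖G q‖) p - ‖mol (φ k) G p‖ := fun k p => by
    rw [sub_nonneg, mol, mol]
    refine (norm_integral_le_integral_norm _).trans_eq (integral_congr_ae (.of_forall fun q => ?_))
    simp [norm_smul, abs_of_nonneg ((φ k).nonneg_normed _)]
  obtain ⟨B, hB⟩ := hψ.bounded_above_of_compact_support hψc
  have hB0 : 0 ≤ B := (norm_nonneg _).trans (hB 0)
  have hψi : Integrable ψ := hψ.integrable_of_hasCompactSupport hψc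
  have hψI : 0 ≤ ∫ p, ψ p := integral_nonneg hψ0
  rw [Metric.tendsto_atTop]
  intro ε hε
  obtain ⟨H, hHc, hH1, hHcont, hHi⟩ := hG.exists_hasCompactSupport_integral_sub_le
    (ε := ε / (4 * (B + 1))) (by positivity)
  have hD : Integrable (fun q => ‖G q - H q‖) := (hG.sub hHi).norm
  have huc := hHc.uniformContinuous_of_continuous hHcont
  rw [Metric.uniformContinuous_iff] at huc
  set e := ε / (8 * ((∫ p, ψ p) + 1)) with he
  have he0 : 0 < e := by positivity
  obtain ⟨r, hr, hr2⟩ := huc e he0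
  obtain ⟨N, hN⟩ := (Metric.tendsto_atTop.1 hφ) r hr
  refine ⟨N, fun k hk => ?_⟩
  have hrk : (φ k).rOut < r := by
    have := hN k hk
    rwa [Real.dist_eq, sub_zero, abs_of_pos (φ k).rOut_pos] at this
  have key : ∀ p, mol (φ k) (fun q => ‖G q‖) p - ‖mol (φ k) G p‖
      ≤ 2 * mol (φ k) (fun q => ‖G q - H q‖) p + 2 * e := by
    intro p
    have h1 : mol (φ k) (fun q => ‖G q‖) p ≤ mol (φ k) (fun q => ‖G q - H q‖) p
        + mol (φ k) (fun q => ‖H q‖) p := by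
      rw [mol, mol, mol, ← integral_add (integrable_mol_integrand (φ k) hD.locallyIntegrable p)
        (integrable_mol_integrand (φ k) hHi.norm.locallyIntegrable p)]
      refine integral_mono (integrable_mol_integrand (φ k) hG.norm.locallyIntegrable p)
        ((integrable_mol_integrand (φ k) hD.locallyIntegrable p).add
          (integrable_mol_integrand (φ k) hHi.norm.locallyIntegrable p)) ?_
      intro q
      simp only [smul_eq_mul, ← mul_add]
      refine mul_le_mul_of_nonneg_left ?_ ((φ k).nonneg_normed _)
      simpa using norm_add_le (G q - H q) (H q)
    have h2 : ‖mol (φ k) H p‖ - ‖mol (φ k) G p‖ ≤ mol (φ k) (fun q => ‖G q - H q‖) p := by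
      refine (norm_sub_norm_le _ _).trans ?_
      rw [mol, mol, mol, ← integral_sub (integrable_mol_integrand (φ k) hHi.locallyIntegrable p)
        (integrable_mol_integrand (φ k) hG.locallyIntegrable p)]
      refine (norm_integral_le_integral_norm _).trans_eq (integral_congr_ae (.of_forall fun q => ?_))
      simp only [← smul_sub, norm_smul, smul_eq_mul, Real.norm_eq_abs,
        abs_of_nonneg ((φ k).nonneg_normed _), norm_sub_rev (G q)]
    have hH : ∀ q ∈ Metric.ball p (φ k).rOut, dist (H q) (H p) ≤ e := fun q hq =>
      (hr2 ((Metric.mem_ball.1 hq).trans hrk)).le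
    have h3 : dist (mol (φ k) H p) (H p) ≤ e := by
      rw [mol_eq_convolution]
      exact ContDiffBump.dist_normed_convolution_le hHcont.aestronglyMeasurable hH
    have h4 : dist (mol (φ k) (fun q => ‖H q‖) p) ‖H p‖ ≤ e := by
      rw [mol_eq_convolution]
      exact ContDiffBump.dist_normed_convolution_le hHcont.norm.aestronglyMeasurable
        fun q hq => (dist_norm_norm_le _ _).trans ((dist_eq_norm _ _).symm.le.trans (hH q hq))
    rw [Real.dist_eq, abs_le] at h4
    rw [dist_eq_norm, norm_sub_rev] at h3
    have h5 := norm_sub_norm_le (H p) (mol (φ k) H p)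
    linarith
  have hfin : ∫ p, ψ p * (mol (φ k) (fun q => ‖G q‖) p - ‖mol (φ k) G p‖)
      ≤ ∫ p, (2 * B * mol (φ k) (fun q => ‖G q - H q‖) p + 2 * e * ψ p) := by
    refine integral_mono_of_nonneg (.of_forall fun p => mul_nonneg (hψ0 p) (hnn k p))
      (((hI k hD).const_mul _).add (hψi.const_mul _)) (.of_forall fun p => ?_)
    have hm : 0 ≤ mol (φ k) (fun q => ‖G q - H q‖) p := integral_nonneg fun q =>
      smul_nonneg ((φ k).nonneg_normed _) (norm_nonneg _)
    have hb : ψ p ≤ B := (le_abs_self _).trans (hB p)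
    calc _ ≤ ψ p * (2 * mol (φ k) (fun q => ‖G q - H q‖) p + 2 * e) :=
          mul_le_mul_of_nonneg_left (key p) (hψ0 p)
      _ ≤ _ := by nlinarith [mul_le_mul_of_nonneg_right hb hm]
  have hm : ∫ p, mol (φ k) (fun q => ‖G q - H q‖) p = ∫ p, ‖G p - H p‖ := by
    rw [mol_eq_convolution, integral_convolution _ (φ k).integrable_normed hD,
      (φ k).integral_normed]
    simp
  rw [integral_add ((hI k hD).const_mul _) (hψi.const_mul _),
    integral_const_mul, integral_const_mul, hm] at hfin
  rw [Real.dist_eq, sub_zero, abs_of_nonneg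
    (integral_nonneg fun p => mul_nonneg (hψ0 p) (hnn k p))]
  have e1 : 2 * B * ∫ p, ‖G p - H p‖ ≤ ε / 2 := by
    calc 2 * B * ∫ p, ‖G p - H p‖ ≤ 2 * B * (ε / (4 * (B + 1))) := by gcongr
      _ = ε / 2 * (B / (B + 1)) := by field_simp; ring
      _ ≤ ε / 2 * 1 := by gcongr; exact (div_le_one (by linarith)).2 (by linarith)
      _ = ε / 2 := mul_one _
  have e2 : 2 * e * ∫ p, ψ p ≤ ε / 4 := by
    calc 2 * e * ∫ p, ψ p = ε / 4 * ((∫ p, ψ p) / ((∫ p, ψ p) + 1)) := by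
          rw [he]; field_simp; ring
      _ ≤ ε / 4 * 1 := by gcongr; exact (div_le_one (by linarith)).2 (by linarith)
      _ = ε / 4 := mul_one _
  linarith

/-- The formal adjoint of the heat operator. -/
def adjHeat (n : ℕ) (ψ : Euc n × ℝ → ℝ) (p : Euc n × ℝ) : ℝ := -pdt n ψ p - lapx n ψ p

lemma contDiff_adjHeat {n : ℕ} {χ : Euc n × ℝ → ℝ} (hχ : ContDiff ℝ (⊤ : ℕ∞) χ) :
    ContDiff ℝ (⊤ : ℕ∞) (adjHeat n χ) :=
  (contDiff_pdt hχ).neg.sub (contDiff_lapx hχ)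

lemma adjHeat_eq_zero_of_notMem_tsupport {n : ℕ} {χ : Euc n × ℝ → ℝ} {p : Euc n × ℝ}
    (hp : p ∉ tsupport χ) : adjHeat n χ p = 0 := by
  rw [adjHeat, image_eq_zero_of_notMem_tsupport fun h => hp (tsupport_pdt_subset χ h),
    image_eq_zero_of_notMem_tsupport fun h => hp (tsupport_lapx_subset χ h)]
  simp

lemma hasCompactSupport_adjHeat {n : ℕ} {χ : Euc n × ℝ → ℝ} (hc : HasCompactSupport χ) :
    HasCompactSupport (adjHeat n χ) :=
  HasCompactSupport.intro hc fun _ hp => adjHeat_eq_zero_of_notMem_tsupport hp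

lemma integral_mul_fderiv_swap {n : ℕ} {w ψ : Euc n × ℝ → ℝ} (hw : ContDiff ℝ (⊤ : ℕ∞) w)
    (hψ : ContDiff ℝ (⊤ : ℕ∞) ψ) (hψc : HasCompactSupport ψ) (v : Euc n × ℝ) :
    ∫ p, w p * fderiv ℝ ψ p v = - ∫ p, fderiv ℝ w p v * ψ p := by
  have cw : Continuous fun p => fderiv ℝ w p v :=
    (hw.continuous_fderiv (by simp)).clm_apply continuous_const
  have cψ : Continuous fun p => fderiv ℝ ψ p v :=
    (hψ.continuous_fderiv (by simp)).clm_apply continuous_const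
  apply integral_mul_fderiv_eq_neg_fderiv_mul_of_integrable
  · exact (cw.mul hψ.continuous).integrable_of_hasCompactSupport hψc.mul_left
  · exact (hw.continuous.mul cψ).integrable_of_hasCompactSupport
      ((hψc.fderiv_apply ℝ v).mul_left)
  · exact (hw.continuous.mul hψ.continuous).integrable_of_hasCompactSupport hψc.mul_left
  · exact fun p _ => hw.differentiable (by simp) p
  · exact fun p _ => hψ.differentiable (by simp) p

lemma integral_mul_adjHeat {n : ℕ} {w ψ : Euc n × ℝ → ℝ} (hw : ContDiff ℝ (⊤ : ℕ∞) w)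
    (hψ : ContDiff ℝ (⊤ : ℕ∞) ψ) (hψc : HasCompactSupport ψ) :
    ∫ p, w p * adjHeat n ψ p = ∫ p, (pdt n w p - lapx n w p) * ψ p := by
  have i1 : Integrable fun p => w p * pdt n ψ p :=
    (hw.continuous.mul (contDiff_pdt hψ).continuous).integrable_of_hasCompactSupport
      (hasCompactSupport_pdt hψc).mul_left
  have i1n : Integrable fun p => -(w p * pdt n ψ p) := i1.neg
  have i2 : ∀ i, Integrable fun p => w p * pdx n i (pdx n i ψ) p := fun i =>
    (hw.continuous.mul
      (contDiff_pdx (contDiff_pdx hψ i) i).continuous).integrable_of_hasCompactSupport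
      (hasCompactSupport_pdx (hasCompactSupport_pdx hψc i) i).mul_left
  have i3 : Integrable fun p => pdt n w p * ψ p :=
    ((contDiff_pdt hw).continuous.mul hψ.continuous).integrable_of_hasCompactSupport hψc.mul_left
  have i4 : ∀ i, Integrable fun p => pdx n i (pdx n i w) p * ψ p := fun i =>
    ((contDiff_pdx (contDiff_pdx hw i) i).continuous.mul
      hψ.continuous).integrable_of_hasCompactSupport hψc.mul_left
  have e1 : ∫ p, w p * pdt n ψ p = - ∫ p, pdt n w p * ψ p :=
    integral_mul_fderiv_swap hw hψ hψc _
  have e2 : ∀ i, ∫ p, w p * pdx n i (pdx n i ψ) p = ∫ p, pdx n i (pdx n i w) p * ψ p := fun i => by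
    have a1 : ∫ p, w p * pdx n i (pdx n i ψ) p = - ∫ p, pdx n i w p * pdx n i ψ p :=
      integral_mul_fderiv_swap hw (contDiff_pdx hψ i) (hasCompactSupport_pdx hψc i) _
    have a2 : ∫ p, pdx n i w p * pdx n i ψ p = - ∫ p, pdx n i (pdx n i w) p * ψ p :=
      integral_mul_fderiv_swap (contDiff_pdx hw i) hψ hψc _
    rw [a1, a2, neg_neg]
  have l1 : ∀ p, w p * adjHeat n ψ p = -(w p * pdt n ψ p) - ∑ i, w p * pdx n i (pdx n i ψ) p := by
    intro p
    rw [adjHeat, lapx, ← Finset.mul_sum]; ring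
  have l2 : ∀ p, (pdt n w p - lapx n w p) * ψ p
      = pdt n w p * ψ p - ∑ i, pdx n i (pdx n i w) p * ψ p := by
    intro p
    rw [lapx, ← Finset.sum_mul]; ring
  simp only [l1, l2]
  rw [integral_sub i1n (integrable_finsetSum _ fun i _ => i2 i),
    integral_sub i3 (integrable_finsetSum _ fun i _ => i4 i), integral_neg,
    integral_finsetSum _ fun i _ => i2 i, integral_finsetSum _ fun i _ => i4 i, e1, neg_neg]
  simp only [e2]

lemma contDiff_comp_of_mem {n : ℕ} {u : Euc n × ℝ → ℝ} {f : ℝ → ℝ} {s : Set ℝ}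
    (hu : ContDiff ℝ (⊤ : ℕ∞) u) (hs : ∀ p, u p ∈ s)
    (hf : ∀ x ∈ s, ContDiffAt ℝ (⊤ : ℕ∞) f x) : ContDiff ℝ (⊤ : ℕ∞) (fun p => f (u p)) :=
  contDiff_iff_contDiffAt.2 fun p => (hf _ (hs p)).comp p hu.contDiffAt

lemma fderiv_comp_of_mem {n : ℕ} {u : Euc n × ℝ → ℝ} {f : ℝ → ℝ} {s : Set ℝ}
    (hu : ContDiff ℝ (⊤ : ℕ∞) u) (hs : ∀ p, u p ∈ s)
    (hf : ∀ x ∈ s, ContDiffAt ℝ (⊤ : ℕ∞) f x) (p v : Euc n × ℝ) :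
    fderiv ℝ (fun p => f (u p)) p v = deriv f (u p) * fderiv ℝ u p v := by
  have h1 : HasDerivAt f (deriv f (u p)) (u p) :=
    ((hf _ (hs p)).differentiableAt (by simp)).hasDerivAt
  have h2 := h1.comp_hasFDerivAt p (hu.differentiable (by simp) p).hasFDerivAt
  have h3 : HasFDerivAt (fun p => f (u p)) (deriv f (u p) • fderiv ℝ u p) p := h2
  rw [h3.fderiv]
  rfl

lemma contDiffAt_deriv {f : ℝ → ℝ} {x : ℝ} (hf : ContDiffAt ℝ (⊤ : ℕ∞) f x) :
    ContDiffAt ℝ (⊤ : ℕ∞) (deriv f) x := by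
  have h : ContDiffAt ℝ (⊤ : ℕ∞) (fun y => fderiv ℝ f y 1) x :=
    (hf.fderiv_right (m := (⊤ : ℕ∞)) (by simp)).clm_apply contDiffAt_const
  exact h

lemma heat_comp_of_mem {n : ℕ} {u : Euc n × ℝ → ℝ} {f : ℝ → ℝ} {s : Set ℝ}
    (hu : ContDiff ℝ (⊤ : ℕ∞) u) (hs : ∀ p, u p ∈ s)
    (hf : ∀ x ∈ s, ContDiffAt ℝ (⊤ : ℕ∞) f x) (p : Euc n × ℝ) :
    pdt n (fun p => f (u p)) p - lapx n (fun p => f (u p)) p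
      = deriv f (u p) * (pdt n u p - lapx n u p)
        - deriv (deriv f) (u p) * ∑ i, pdx n i u p ^ 2 := by
  have h1 : pdt n (fun p => f (u p)) p = deriv f (u p) * pdt n u p :=
    fderiv_comp_of_mem hu hs hf p _
  have h2 : ∀ i, pdx n i (fun p => f (u p)) = fun p => deriv f (u p) * pdx n i u p := fun i => by
    ext p
    exact fderiv_comp_of_mem hu hs hf p _
  have h3 : ∀ i, pdx n i (pdx n i (fun p => f (u p))) p
      = deriv f (u p) * pdx n i (pdx n i u) p + deriv (deriv f) (u p) * pdx n i u p ^ 2 := fun i => by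
    rw [h2, pdx]
    have d1 : DifferentiableAt ℝ (fun p => deriv f (u p)) p :=
      (contDiff_comp_of_mem hu hs fun x hx => contDiffAt_deriv (hf x hx)).differentiable (by simp) p
    have d2 : DifferentiableAt ℝ (pdx n i u) p := (contDiff_pdx hu i).differentiable (by simp) p
    have e := (d1.hasFDerivAt.mul d2.hasFDerivAt).fderiv
    have e' : fderiv ℝ (fun p => deriv f (u p) * pdx n i u p) p
      = deriv f (u p) • fderiv ℝ (pdx n i u) p
        + pdx n i u p • fderiv ℝ (fun p => deriv f (u p)) p := e
    rw [e']
    have e3 := fderiv_comp_of_mem hu hs (fun x hx => contDiffAt_deriv (hf x hx)) p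
      (EuclideanSpace.single i 1, 0)
    simp only [_root_.add_apply, _root_.smul_apply, smul_eq_mul, e3]
    rw [pdx, pdx]; ring
  simp only [lapx]
  rw [h1, Finset.sum_congr rfl fun i _ => h3 i, Finset.sum_add_distrib, ← Finset.mul_sum,
    ← Finset.mul_sum]
  ring

lemma mol_mem_Icc {n : ℕ} (φ : ContDiffBump (0 : Euc n × ℝ)) {u : Euc n × ℝ → ℝ} {M : ℝ}
    (hu : LocallyIntegrable u) (hM : ∀ p, |u p| ≤ M) (p : Euc n × ℝ) :
    mol φ u p ∈ Set.Icc (-M) M := by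
  refine abs_le.1 ?_
  rw [mol, ← Real.norm_eq_abs]
  have e : ∫ q, φ.normed volume (p - q) = 1 := by
    rw [integral_sub_left_eq_self (fun q => φ.normed volume q), φ.integral_normed]
  have i0 : Integrable fun q => φ.normed volume (p - q) := φ.integrable_normed.comp_sub_left p
  refine (norm_integral_le_integral_norm _).trans ?_
  calc ∫ q, ‖φ.normed volume (p - q) • u q‖ ≤ ∫ q, φ.normed volume (p - q) * M := by
        refine integral_mono (integrable_mol_integrand φ hu p).norm (i0.mul_const M) fun q => ?_
        simp only [norm_smul, Real.norm_eq_abs, abs_of_nonneg (φ.nonneg_normed _)]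
        exact mul_le_mul_of_nonneg_left (hM q) (φ.nonneg_normed _)
    _ = M := by rw [integral_mul_const, e, one_mul]

lemma tsupport_normed_comp_sub_subset {n : ℕ} (φ : ContDiffBump (0 : Euc n × ℝ))
    (p : Euc n × ℝ) :
    tsupport (fun q => φ.normed volume (p - q)) ⊆ Metric.closedBall p φ.rOut := by
  refine closure_minimal (fun q hq => ?_) Metric.isClosed_closedBall
  have h : p - q ∈ Function.support (φ.normed volume) := hq
  rw [φ.support_normed_eq, mem_ball_zero_iff] at h
  rw [Metric.mem_closedBall, dist_comm, dist_eq_norm]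
  exact h.le

lemma sum_sq_mol {n : ℕ} (φ : ContDiffBump (0 : Euc n × ℝ)) {G : Euc n × ℝ → Euc n}
    (hG : LocallyIntegrable G) (p : Euc n × ℝ) :
    ∑ i, (∫ q, φ.normed volume (p - q) * G q i) ^ 2 = ‖mol φ G p‖ ^ 2 := by
  rw [EuclideanSpace.norm_sq_eq]
  refine Finset.sum_congr rfl fun i _ => ?_
  rw [Real.norm_eq_abs, sq_abs]
  congr 1
  have h := (EuclideanSpace.proj (𝕜 := ℝ) i).integral_comp_comm (integrable_mol_integrand φ hG p)
  simpa [mol] using h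

/-- Chain rule for bounded weak solutions of `u_t - Δu = -b`, `|b| ≤ A|∇u|`, tested against a
nonnegative function. -/
lemma chain_rule_core {n : ℕ} {u b : Euc n × ℝ → ℝ} {G : Euc n × ℝ → Euc n} {S : Set (Euc n × ℝ)}
    {M A r₀ : ℝ} {ψ : Euc n × ℝ → ℝ} {f F : ℝ → ℝ} (hA : 0 ≤ A)
    (hu : Measurable u) (hM : ∀ p, |u p| ≤ M) (hG : Integrable G) (hb : Integrable b)
    (hbG : ∀ᵐ p, |b p| ≤ A * ‖G p‖)
    (hgrad : ∀ χ : Euc n × ℝ → ℝ, ContDiff ℝ (⊤ : ℕ∞) χ → HasCompactSupport χ → tsupport χ ⊆ S →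
      ∀ i, ∫ p, u p * pdx n i χ p = - ∫ p, G p i * χ p)
    (heq : ∀ χ : Euc n × ℝ → ℝ, ContDiff ℝ (⊤ : ℕ∞) χ → HasCompactSupport χ → tsupport χ ⊆ S →
      ∫ p, u p * adjHeat n χ p = - ∫ p, b p * χ p)
    (hψ : ContDiff ℝ (⊤ : ℕ∞) ψ) (hψc : HasCompactSupport ψ) (hψ0 : ∀ p, 0 ≤ ψ p)
    (hr₀ : 0 < r₀) (hS : ∀ p ∈ tsupport ψ, Metric.closedBall p r₀ ⊆ S)
    (hcont : ∀ p ∈ tsupport ψ, ContinuousAt u p)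
    (hf : ∀ x ∈ Set.Icc (-M) M, ContDiffAt ℝ (⊤ : ℕ∞) f x)
    (hF : ContinuousOn F (Set.Icc (-M) M))
    (hfF : ∀ x ∈ Set.Icc (-M) M, ∀ y, 0 ≤ y →
      A * |deriv f x| * y - deriv (deriv f) x * y ^ 2 ≤ F x) :
    ∫ p, f (u p) * adjHeat n ψ p ≤ ∫ p, F (u p) * ψ p := by
  have hul : LocallyIntegrable u := by
    refine (locallyIntegrable_const M).mono hu.aestronglyMeasurable (.of_forall fun p => ?_)
    exact (hM p).trans (le_abs_self M)
  let φ : ℕ → ContDiffBump (0 : Euc n × ℝ) := fun k =>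
    { rIn := r₀ / (k + 1) / 2
      rOut := r₀ / (k + 1)
      rIn_pos := by positivity
      rIn_lt_rOut := half_lt_self (by positivity) }
  have hφ : Tendsto (fun k => (φ k).rOut) atTop (𝓝 0) := by
    have := (tendsto_one_div_add_atTop_nhds_zero_nat (𝕜 := ℝ)).const_mul r₀
    simpa [φ, div_eq_mul_inv] using this
  have hφr : ∀ k, (φ k).rOut ≤ r₀ := fun k => by
    show r₀ / (k + 1) ≤ r₀
    exact div_le_self hr₀.le (by linarith [Nat.cast_nonneg (α := ℝ) k])
  have hmem : ∀ k p, mol (φ k) u p ∈ Set.Icc (-M) M := fun k p => mol_mem_Icc (φ k) hul hM p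
  have hsm : ∀ k, ContDiff ℝ (⊤ : ℕ∞) (mol (φ k) u) := fun k => mol_contDiff (φ k) hul
  have hfs : ∀ k, ContDiff ℝ (⊤ : ℕ∞) (fun p => f (mol (φ k) u p)) := fun k =>
    contDiff_comp_of_mem (hsm k) (hmem k) hf
  have hGl := hG.locallyIntegrable
  obtain ⟨L, hL⟩ := isCompact_Icc.exists_bound_of_continuousOn
    (f := deriv f) (s := Set.Icc (-M) M)
    fun x hx => (contDiffAt_deriv (hf x hx)).continuousAt.continuousWithinAt
  -- test functions centred at points of the support of `ψ`
  have htest : ∀ k, ∀ p ∈ tsupport ψ,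
      ContDiff ℝ (⊤ : ℕ∞) (fun q => (φ k).normed volume (p - q)) ∧
      HasCompactSupport (fun q => (φ k).normed volume (p - q)) ∧
      tsupport (fun q => (φ k).normed volume (p - q)) ⊆ S := fun k p hp =>
    ⟨(φ k).contDiff_normed.comp (contDiff_const.sub contDiff_id),
      (φ k).hasCompactSupport_normed.comp_homeomorph (Homeomorph.subLeft p),
      (tsupport_normed_comp_sub_subset _ p).trans
        ((Metric.closedBall_subset_closedBall (hφr k)).trans (hS p hp))⟩
  have hpdx : ∀ k, ∀ p ∈ tsupport ψ, ∀ i,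
      pdx n i (mol (φ k) u) p = ∫ q, (φ k).normed volume (p - q) * G q i := by
    intro k p hp i
    obtain ⟨t1, t2, t3⟩ := htest k p hp
    have := hgrad _ t1 t2 t3 i
    simp only [pdx_comp_sub, mul_neg, integral_neg, neg_inj] at this
    rw [pdx_mol (φ k) hul]
    simp only [mul_comm] at this ⊢
    exact this
  have hheat : ∀ k, ∀ p ∈ tsupport ψ,
      |pdt n (mol (φ k) u) p - lapx n (mol (φ k) u) p| ≤ A * mol (φ k) (fun q => ‖G q‖) p := by
    intro k p hp
    obtain ⟨t1, t2, t3⟩ := htest k p hp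
    have h1 := heq _ t1 t2 t3
    have c0 : ContDiff ℝ (⊤ : ℕ∞) ((φ k).normed volume) := (φ k).contDiff_normed
    have h2 : pdt n (mol (φ k) u) p - lapx n (mol (φ k) u) p
        = - ∫ q, b q * (φ k).normed volume (p - q) := by
      have i1 : Integrable fun q => pdt n ((φ k).normed volume) (p - q) * u q :=
        integrable_smul_comp_sub (contDiff_pdt c0).continuous
          (hasCompactSupport_pdt (φ k).hasCompactSupport_normed) hul p
      have i2 : Integrable fun q => lapx n ((φ k).normed volume) (p - q) * u q :=
        integrable_smul_comp_sub (contDiff_lapx c0).continuous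
          (hasCompactSupport_lapx (φ k).hasCompactSupport_normed) hul p
      rw [← h1, pdt_mol (φ k) hul, lapx_mol (φ k) hul, ← integral_sub i1 i2]
      refine integral_congr_ae (.of_forall fun q => ?_)
      simp only [adjHeat, pdt_comp_sub, lapx_comp_sub]
      ring
    rw [h2, abs_neg, mol, ← integral_const_mul, ← Real.norm_eq_abs]
    refine (norm_integral_le_integral_norm _).trans ?_
    have hb' := hb.locallyIntegrable
    refine integral_mono_ae ?_ ?_ ?_
    · have := (integrable_mol_integrand (φ k) hb' p).norm
      simpa only [smul_eq_mul, mul_comm] using this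
    · exact (integrable_mol_integrand (φ k) hG.norm.locallyIntegrable p).const_mul A
    · filter_upwards [hbG] with q hq
      simp only [norm_mul, Real.norm_eq_abs, abs_of_nonneg ((φ k).nonneg_normed _), smul_eq_mul]
      nlinarith [(φ k).nonneg_normed (μ := volume) (p - q)]
  -- the inequality at the level of the mollified functions
  set D : ℕ → Euc n × ℝ → ℝ := fun k p => mol (φ k) (fun q => ‖G q‖) p - ‖mol (φ k) G p‖ with hD
  have hD0 : ∀ k p, 0 ≤ D k p := fun k p => by
    rw [hD, sub_nonneg, mol, mol]
    refine (norm_integral_le_integral_norm _).trans_eq (integral_congr_ae (.of_forall fun q => ?_))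
    simp [norm_smul, abs_of_nonneg ((φ k).nonneg_normed _)]
  have hpt : ∀ k p, (pdt n (fun p => f (mol (φ k) u p)) p - lapx n (fun p => f (mol (φ k) u p)) p)
      * ψ p ≤ F (mol (φ k) u p) * ψ p + A * L * (ψ p * D k p) := by
    intro k p
    by_cases hp : p ∈ tsupport ψ
    swap
    · rw [image_eq_zero_of_notMem_tsupport hp]; simp
    have hx := hmem k p
    have h1 := hfF _ hx ‖mol (φ k) G p‖ (norm_nonneg _)
    have h2 := hheat k p hp
    have h3 : |deriv f (mol (φ k) u p)| ≤ L := hL _ hx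
    rw [heat_comp_of_mem (hsm k) (hmem k) hf, Finset.sum_congr rfl fun i _ => by
      rw [hpdx k p hp i], sum_sq_mol (φ k) hGl]
    have h4 : deriv f (mol (φ k) u p) * (pdt n (mol (φ k) u) p - lapx n (mol (φ k) u) p)
        ≤ |deriv f (mol (φ k) u p)| * (A * mol (φ k) (fun q => ‖G q‖) p) :=
      (le_abs_self _).trans (by rw [abs_mul]; gcongr)
    have h5 : |deriv f (mol (φ k) u p)| * (A * D k p) ≤ L * (A * D k p) :=
      mul_le_mul_of_nonneg_right h3 (mul_nonneg hA (hD0 k p))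
    have h6 : deriv f (mol (φ k) u p) * (pdt n (mol (φ k) u) p - lapx n (mol (φ k) u) p)
        - deriv (deriv f) (mol (φ k) u p) * ‖mol (φ k) G p‖ ^ 2
        ≤ F (mol (φ k) u p) + A * L * D k p := by
      have e : mol (φ k) (fun q => ‖G q‖) p = D k p + ‖mol (φ k) G p‖ := by simp [hD]
      rw [e] at h4
      nlinarith
    nlinarith [mul_le_mul_of_nonneg_right h6 (hψ0 p)]
  have hFc : ∀ k, Continuous fun p => F (mol (φ k) u p) := fun k =>
    hF.comp_continuous (hsm k).continuous (hmem k)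
  have hmolG : ∀ {H : ℕ → Euc n × ℝ → ℝ}, (∀ k, Continuous (H k)) →
      ∀ k, Integrable fun p => H k p * ψ p := fun hH k =>
    ((hH k).mul hψ.continuous).integrable_of_hasCompactSupport hψc.mul_left
  have hDc : ∀ k, Continuous (D k) := fun k => by
    have c1 : Continuous (mol (φ k) fun q => ‖G q‖) :=
      (mol_contDiff (φ k) hG.norm.locallyIntegrable).continuous
    have c2 : Continuous (mol (φ k) G) := by
      rw [mol_eq_convolution]
      exact (φ k).hasCompactSupport_normed.continuous_convolution_left _ (φ k).continuous_normed hGl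
    exact c1.sub c2.norm
  have hint : ∀ k, ∫ p, f (mol (φ k) u p) * adjHeat n ψ p
      ≤ (∫ p, F (mol (φ k) u p) * ψ p) + A * L * ∫ p, ψ p * D k p := by
    intro k
    have i1 : Integrable fun p => ψ p * D k p := by
      simpa only [mul_comm] using hmolG hDc k
    rw [integral_mul_adjHeat (hfs k) hψ hψc, ← integral_const_mul,
      ← integral_add (hmolG hFc k) (i1.const_mul _)]
    refine integral_mono ?_ ((hmolG hFc k).add (i1.const_mul _)) fun p => hpt k p
    exact hmolG (fun k => ((contDiff_pdt (hfs k)).sub (contDiff_lapx (hfs k))).continuous) k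
  -- passage to the limit
  have hlim : ∀ p ∈ tsupport ψ, Tendsto (fun k => mol (φ k) u p) atTop (𝓝 (u p)) := by
    intro p hp
    have hc := hcont p hp
    rw [Metric.continuousAt_iff] at hc
    rw [Metric.tendsto_atTop]
    intro ε hε
    obtain ⟨r, hr, hr2⟩ := hc (ε / 2) (half_pos hε)
    obtain ⟨N, hN⟩ := (Metric.tendsto_atTop.1 hφ) r hr
    refine ⟨N, fun k hk => ?_⟩
    have hrk : (φ k).rOut < r := by
      have := hN k hk
      rwa [Real.dist_eq, sub_zero, abs_of_pos (φ k).rOut_pos] at this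
    rw [mol_eq_convolution]
    refine (ContDiffBump.dist_normed_convolution_le (ε := ε / 2) hu.aestronglyMeasurable
      fun q hq => ?_).trans_lt (half_lt_self hε)
    exact (hr2 ((Metric.mem_ball.1 hq).trans hrk)).le
  have hpass : ∀ {h : ℝ → ℝ} {χ : Euc n × ℝ → ℝ}, ContinuousOn h (Set.Icc (-M) M) →
      Continuous χ → HasCompactSupport χ → (∀ p, p ∉ tsupport ψ → χ p = 0) →
      Tendsto (fun k => ∫ p, h (mol (φ k) u p) * χ p) atTop (𝓝 (∫ p, h (u p) * χ p)) := by
    intro h χ hh hχ hχc hχ0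
    obtain ⟨B, hB⟩ := isCompact_Icc.exists_bound_of_continuousOn hh
    refine tendsto_integral_of_dominated_convergence (fun p => B * ‖χ p‖) (fun k => ?_)
      ((hχ.integrable_of_hasCompactSupport hχc).norm.const_mul B) (fun k => ?_) ?_
    · exact ((hh.comp_continuous (hsm k).continuous (hmem k)).mul hχ).aestronglyMeasurable
    · refine .of_forall fun p => ?_
      rw [norm_mul]
      exact mul_le_mul_of_nonneg_right (hB _ (hmem k p)) (norm_nonneg _)
    · refine .of_forall fun p => ?_
      by_cases hp : p ∈ tsupport ψ
      · refine Tendsto.mul_const _ ?_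
        have hm : u p ∈ Set.Icc (-M) M := abs_le.1 (hM p)
        exact (hh _ hm).tendsto.comp
          (tendsto_nhdsWithin_iff.2 ⟨hlim p hp, .of_forall fun k => hmem k p⟩)
      · simp [hχ0 p hp]
  have l1 := hpass (h := f) (fun x hx => (hf x hx).continuousAt.continuousWithinAt)
    (contDiff_adjHeat hψ).continuous (hasCompactSupport_adjHeat hψc)
    fun p hp => adjHeat_eq_zero_of_notMem_tsupport hp
  have l2 := hpass hF hψ.continuous hψc fun p hp => image_eq_zero_of_notMem_tsupport hp
  have l3 := (tendsto_integral_mol_defect hG hψ.continuous hψc hψ0 hφ).const_mul (A * L)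
  have l4 := l2.add l3
  rw [mul_zero, add_zero] at l4
  exact le_of_tendsto_of_tendsto' l1 l4 hint

lemma integrableOn_of_sq_norm {n : ℕ} {g : Euc n × ℝ → Euc n} (hg : Measurable g)
    {Q S : Set (Euc n × ℝ)} (hS : IsCompact S) (hSQ : S ⊆ Q)
    (h : LocallyIntegrableOn (fun p => ‖g p‖ ^ 2) Q) : IntegrableOn g S := by
  have h1 := h.integrableOn_compact_subset hSQ hS
  have h2 : IntegrableOn (fun _ => (1 : ℝ)) S := integrableOn_const hS.measure_lt_top.ne
  refine (h2.add h1).mono' hg.aestronglyMeasurable (.of_forall fun p => ?_)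
  simp only [Pi.add_apply]
  nlinarith [sq_nonneg (‖g p‖ - 1), norm_nonneg (g p)]

/-- Chain rule for bounded weak solutions of `u_t + a·∇u - Δu = 0` tested against a nonnegative
function. -/
lemma chain_rule {n : ℕ} {u : Euc n × ℝ → ℝ} {a g : Euc n × ℝ → Euc n} {Q : Set (Euc n × ℝ)}
    {M A : ℝ} {f F : ℝ → ℝ} (hA : 0 ≤ A) (hQ : IsOpen Q) (hM0 : 0 ≤ M)
    (hu : Measurable u) (ha : Measurable a) (hg : Measurable g)
    (hM : ∀ p ∈ Q, |u p| ≤ M) (huc : ContinuousOn u Q)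
    (haA : ∀ᵐ p ∂(volume.restrict Q), ‖a p‖ ≤ A)
    (hg2 : LocallyIntegrableOn (fun p => ‖g p‖ ^ 2) Q)
    (hgrad : ∀ χ : Euc n × ℝ → ℝ, ContDiff ℝ (⊤ : ℕ∞) χ → HasCompactSupport χ → tsupport χ ⊆ Q →
      ∀ i, ∫ p in Q, u p * pdx n i χ p = - ∫ p in Q, g p i * χ p)
    (heq : ∀ χ : Euc n × ℝ → ℝ, ContDiff ℝ (⊤ : ℕ∞) χ → HasCompactSupport χ → tsupport χ ⊆ Q →
      ∫ p in Q, (-(u p * pdt n χ p) + (∑ i, a p i * g p i) * χ p + ∑ i, g p i * pdx n i χ p) = 0)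
    (hf : ∀ x ∈ Set.Icc (-M) M, ContDiffAt ℝ (⊤ : ℕ∞) f x)
    (hF : ContinuousOn F (Set.Icc (-M) M))
    (hfF : ∀ x ∈ Set.Icc (-M) M, ∀ y, 0 ≤ y →
      A * |deriv f x| * y - deriv (deriv f) x * y ^ 2 ≤ F x)
    {ψ : Euc n × ℝ → ℝ} (hψ : ContDiff ℝ (⊤ : ℕ∞) ψ) (hψc : HasCompactSupport ψ)
    (hψ0 : ∀ p, 0 ≤ ψ p) (hψQ : tsupport ψ ⊆ Q) :
    ∫ p in Q, f (u p) * adjHeat n ψ p ≤ ∫ p in Q, F (u p) * ψ p := by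
  obtain ⟨r₀, hr₀, hr₀Q⟩ := IsCompact.exists_cthickening_subset_open hψc hQ hψQ
  set S := Metric.cthickening r₀ (tsupport ψ) with hSdef
  have hSc : IsCompact S := IsCompact.cthickening hψc
  have hSm : MeasurableSet S := hSc.measurableSet
  have hQm : MeasurableSet Q := hQ.measurableSet
  have hgS : IntegrableOn g S := integrableOn_of_sq_norm hg hSc hr₀Q hg2
  set U : Euc n × ℝ → ℝ := Q.indicator u with hU
  set G : Euc n × ℝ → Euc n := S.indicator g with hGdef
  set b : Euc n × ℝ → ℝ := S.indicator fun p => ∑ i, a p i * g p i with hbdef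
  have hG : Integrable G := hgS.integrable_indicator hSm
  have hUm : Measurable U := hu.indicator hQm
  have hUM : ∀ p, |U p| ≤ M := fun p => by
    by_cases hp : p ∈ Q
    · simpa [hU, hp] using hM p hp
    · simpa [hU, hp] using hM0
  have hbG : ∀ᵐ p, |b p| ≤ A * ‖G p‖ := by
    rw [ae_restrict_iff' hQm] at haA
    filter_upwards [haA] with p hp
    by_cases hpS : p ∈ S
    · simp only [hbdef, hGdef, hpS, Set.indicator_of_mem]
      have h1 : ∑ i, a p i * g p i = inner ℝ (g p) (a p) := by
        rw [PiLp.inner_apply]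
        rfl
      rw [h1]
      refine (abs_real_inner_le_norm _ _).trans ?_
      rw [mul_comm]
      exact mul_le_mul_of_nonneg_right (hp (hr₀Q hpS)) (norm_nonneg _)
    · simp [hbdef, hGdef, hpS]
  have hbm : Measurable b := by
    refine Measurable.indicator ?_ hSm
    refine Finset.measurable_sum _ fun i _ => ?_
    exact ((EuclideanSpace.proj (𝕜 := ℝ) i).measurable.comp ha).mul
      ((EuclideanSpace.proj (𝕜 := ℝ) i).measurable.comp hg)
  have hb : Integrable b :=
    (hG.norm.const_mul A).mono' hbm.aestronglyMeasurable hbG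
  have hUl : LocallyIntegrable U := by
    refine (locallyIntegrable_const M).mono hUm.aestronglyMeasurable (.of_forall fun p => ?_)
    exact (hUM p).trans (le_abs_self M)
  have eU : ∀ {h : ℝ → ℝ} {χ : Euc n × ℝ → ℝ}, (∀ p, p ∉ Q → χ p = 0) →
      ∫ p, h (U p) * χ p = ∫ p in Q, h (u p) * χ p := by
    intro h χ hχ
    rw [← integral_indicator hQm]
    refine integral_congr_ae (.of_forall fun p => ?_)
    by_cases hp : p ∈ Q
    · simp [hU, hp]
    · simp [hp, hχ p hp]
  have hgrad' : ∀ χ : Euc n × ℝ → ℝ, ContDiff ℝ (⊤ : ℕ∞) χ → HasCompactSupport χ →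
      tsupport χ ⊆ S → ∀ i, ∫ p, U p * pdx n i χ p = - ∫ p, G p i * χ p := by
    intro χ h1 h2 h3 i
    have e1 : ∫ p, U p * pdx n i χ p = ∫ p in Q, u p * pdx n i χ p :=
      eU (h := id) fun p hp => image_eq_zero_of_notMem_tsupport fun h =>
        hp (hr₀Q (h3 (tsupport_pdx_subset χ i h)))
    have e2 : ∫ p, G p i * χ p = ∫ p in Q, g p i * χ p := by
      rw [← integral_indicator hQm]
      refine integral_congr_ae (.of_forall fun p => ?_)
      by_cases hp : p ∈ S
      · simp [hGdef, hp, hr₀Q hp]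
      · have : χ p = 0 := image_eq_zero_of_notMem_tsupport fun h => hp (h3 h)
        simp [Set.indicator, this]
    rw [e1, e2]
    exact hgrad χ h1 h2 (h3.trans hr₀Q) i
  have key := chain_rule_core (S := S) hA hUm hUM hG hb hbG hgrad' ?_ hψ hψc hψ0 hr₀
    (fun p hp => Metric.closedBall_subset_cthickening hp r₀) ?_ hf hF hfF
  · rwa [eU fun p hp => adjHeat_eq_zero_of_notMem_tsupport fun h => hp (hψQ h),
      eU fun p hp => image_eq_zero_of_notMem_tsupport fun h => hp (hψQ h)] at key
  · intro χ h1 h2 h3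
    have h0 : ∫ p, (-(U p * pdt n χ p) + b p * χ p + ∑ i, G p i * pdx n i χ p) = 0 := by
      rw [← heq χ h1 h2 (h3.trans hr₀Q), ← integral_indicator hQm]
      refine integral_congr_ae (.of_forall fun p => ?_)
      by_cases hp : p ∈ S
      · simp [hU, hbdef, hGdef, hp, hr₀Q hp]
      · have t1 : χ p = 0 := image_eq_zero_of_notMem_tsupport fun h => hp (h3 h)
        have t2 : pdt n χ p = 0 := image_eq_zero_of_notMem_tsupport fun h =>
          hp (h3 (tsupport_pdt_subset χ h))
        have t3 : ∀ i, pdx n i χ p = 0 := fun i => image_eq_zero_of_notMem_tsupport fun h =>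
          hp (h3 (tsupport_pdx_subset χ i h))
        simp [Set.indicator, t1, t2, t3]
    have iU : ∀ {η : Euc n × ℝ → ℝ}, ContDiff ℝ (⊤ : ℕ∞) η → HasCompactSupport η →
        Integrable fun p => U p * η p := fun c1 c2 =>
      (hUl.integrable_smul_left_of_hasCompactSupport c1.continuous c2).congr
        (.of_forall fun p => mul_comm _ _)
    have ib : Integrable fun p => b p * χ p :=
      (hb.locallyIntegrable.integrable_smul_left_of_hasCompactSupport h1.continuous h2).congr
        (.of_forall fun p => mul_comm _ _)
    have iG : ∀ i, Integrable fun p => G p i * pdx n i χ p := fun i => by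
      have hGi : Integrable fun p => G p i := (EuclideanSpace.proj (𝕜 := ℝ) i).integrable_comp hG
      exact (hGi.locallyIntegrable.integrable_smul_left_of_hasCompactSupport
        (contDiff_pdx h1 i).continuous (hasCompactSupport_pdx h2 i)).congr
        (.of_forall fun p => mul_comm _ _)
    have it := iU (contDiff_pdt h1) (hasCompactSupport_pdt h2)
    have itn : Integrable fun p => -(U p * pdt n χ p) := it.neg
    have il := fun i => iU (contDiff_pdx (contDiff_pdx h1 i) i)
      (hasCompactSupport_pdx (hasCompactSupport_pdx h2 i) i)
    have itb : Integrable fun p => -(U p * pdt n χ p) + b p * χ p := itn.add ib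
    rw [integral_add itb (integrable_finsetSum _ fun i _ => iG i), integral_add itn ib,
      integral_neg, integral_finsetSum _ fun i _ => iG i] at h0
    have e1 : ∀ p, U p * adjHeat n χ p
        = -(U p * pdt n χ p) - ∑ i, U p * pdx n i (pdx n i χ) p := fun p => by
      rw [adjHeat, lapx, ← Finset.mul_sum]; ring
    simp only [e1]
    rw [integral_sub itn (integrable_finsetSum _ fun i _ => il i), integral_neg,
      integral_finsetSum _ fun i _ => il i, Finset.sum_congr rfl fun i _ =>
        hgrad' _ (contDiff_pdx h1 i) (hasCompactSupport_pdx h2 i)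
          ((tsupport_pdx_subset χ i).trans h3) i, Finset.sum_neg_distrib]
    linarith
  · intro p hp
    have h1 : ContinuousAt u p := huc.continuousAt (hQ.mem_nhds (hψQ hp))
    refine h1.congr ?_
    filter_upwards [hQ.mem_nhds (hψQ hp)] with q hq
    simp [hU, hq]

/-- Weak subsolutions of the heat equation on a space-time set `Q`. -/
def IsSubcal (n : ℕ) (Q : Set (Euc n × ℝ)) (w : Euc n × ℝ → ℝ) : Prop :=
  ∀ ψ : Euc n × ℝ → ℝ, ContDiff ℝ (⊤ : ℕ∞) ψ → HasCompactSupport ψ → (∀ p, 0 ≤ ψ p) →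
    tsupport ψ ⊆ Q → ∫ p in Q, w p * adjHeat n ψ p ≤ 0

/-- `h ∘ u` is a weak subsolution with right-hand side `F ∘ u`. -/
def IsSubsolWith (n : ℕ) (Q : Set (Euc n × ℝ)) (h F : Euc n × ℝ → ℝ) : Prop :=
  ∀ ψ : Euc n × ℝ → ℝ, ContDiff ℝ (⊤ : ℕ∞) ψ → HasCompactSupport ψ → (∀ p, 0 ≤ ψ p) →
    tsupport ψ ⊆ Q → ∫ p in Q, h p * adjHeat n ψ p ≤ ∫ p in Q, F p * ψ p

lemma contDiff_exp_time (n : ℕ) (c : ℝ) :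
    ContDiff ℝ (⊤ : ℕ∞) (fun p : Euc n × ℝ => Real.exp (c * p.2)) :=
  (contDiff_const.mul contDiff_snd).exp

lemma fderiv_exp_time_mul {n : ℕ} (c : ℝ) {ψ : Euc n × ℝ → ℝ} {p : Euc n × ℝ}
    (hψ : DifferentiableAt ℝ ψ p) (v : Euc n × ℝ) :
    fderiv ℝ (fun p : Euc n × ℝ => Real.exp (c * p.2) * ψ p) p v
      = Real.exp (c * p.2) * (fderiv ℝ ψ p v + c * v.2 * ψ p) := by
  have h1 : HasFDerivAt (fun p : Euc n × ℝ => Real.exp (c * p.2))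
      (Real.exp (c * p.2) • (c • ContinuousLinearMap.snd ℝ (Euc n) ℝ)) p :=
    (hasFDerivAt_snd.const_mul c).exp
  have h2 : HasFDerivAt (fun p : Euc n × ℝ => Real.exp (c * p.2) * ψ p)
      (Real.exp (c * p.2) • fderiv ℝ ψ p
        + ψ p • (Real.exp (c * p.2) • (c • ContinuousLinearMap.snd ℝ (Euc n) ℝ))) p :=
    h1.mul hψ.hasFDerivAt
  rw [h2.fderiv]
  change Real.exp (c * p.2) * fderiv ℝ ψ p v + ψ p * (Real.exp (c * p.2) * (c * v.2)) = _
  ring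

lemma adjHeat_exp_time_mul {n : ℕ} (c : ℝ) {ψ : Euc n × ℝ → ℝ} (hψ : ContDiff ℝ (⊤ : ℕ∞) ψ)
    (p : Euc n × ℝ) :
    adjHeat n (fun p => Real.exp (c * p.2) * ψ p) p
      = Real.exp (c * p.2) * (adjHeat n ψ p - c * ψ p) := by
  have hd : ∀ {χ : Euc n × ℝ → ℝ}, ContDiff ℝ (⊤ : ℕ∞) χ → ∀ p, DifferentiableAt ℝ χ p :=
    fun h p => h.differentiable (by simp) p
  have hx : ∀ {χ : Euc n × ℝ → ℝ}, ContDiff ℝ (⊤ : ℕ∞) χ → ∀ i,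
      pdx n i (fun p => Real.exp (c * p.2) * χ p) = fun p => Real.exp (c * p.2) * pdx n i χ p := by
    intro χ h i
    ext p
    rw [pdx, fderiv_exp_time_mul c (hd h p)]
    simp [pdx]
  have ht : pdt n (fun p => Real.exp (c * p.2) * ψ p) p
      = Real.exp (c * p.2) * (pdt n ψ p + c * ψ p) := by
    rw [pdt, fderiv_exp_time_mul c (hd hψ p)]
    simp [pdt]
  rw [adjHeat, ht, lapx, Finset.sum_congr rfl fun i _ => by
    rw [hx hψ i, hx (contDiff_pdx hψ i) i], ← Finset.mul_sum, adjHeat, lapx]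
  ring

lemma integrableOn_mul_of_tsupport_subset {n : ℕ} {w η : Euc n × ℝ → ℝ} {Q : Set (Euc n × ℝ)}
    (hQ : MeasurableSet Q) (hw : ContinuousOn w Q) (hη : Continuous η) (hc : HasCompactSupport η)
    (hηQ : tsupport η ⊆ Q) : IntegrableOn (fun p => w p * η p) Q := by
  have h1 : IntegrableOn (fun p => w p * η p) (tsupport η) :=
    ((hw.mono hηQ).mul hη.continuousOn).integrableOn_compact hc
  refine h1.of_forall_sdiff_eq_zero hQ fun p hp => ?_
  rw [image_eq_zero_of_notMem_tsupport hp.2, mul_zero]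

lemma isSubcal_exp_time_mul {n : ℕ} {Q : Set (Euc n × ℝ)} {h F : Euc n × ℝ → ℝ} {c : ℝ}
    (hQ : MeasurableSet Q) (hh : ContinuousOn h Q) (H : IsSubsolWith n Q h F)
    (hF : ∀ p ∈ Q, F p = - c * h p) :
    IsSubcal n Q fun p => Real.exp (c * p.2) * h p := by
  intro ψ h1 h2 h3 h4
  have ce := contDiff_exp_time n c
  have s1 : tsupport (fun p : Euc n × ℝ => Real.exp (c * p.2) * ψ p) ⊆ tsupport ψ :=
    closure_mono fun p hp => right_ne_zero_of_mul hp
  have k := H (fun p => Real.exp (c * p.2) * ψ p) (ce.mul h1) h2.mul_left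
    (fun p => mul_nonneg (Real.exp_pos _).le (h3 p)) (s1.trans h4)
  simp only [adjHeat_exp_time_mul c h1] at k
  have i1 : IntegrableOn (fun p => Real.exp (c * p.2) * h p * adjHeat n ψ p) Q :=
    integrableOn_mul_of_tsupport_subset hQ (ce.continuous.continuousOn.mul hh)
      (contDiff_adjHeat h1).continuous (hasCompactSupport_adjHeat h2)
      ((closure_minimal (fun p hp => by
        by_contra hn
        exact hp (adjHeat_eq_zero_of_notMem_tsupport hn)) (isClosed_tsupport ψ)).trans h4)
  have i2 : IntegrableOn (fun p => -c * (Real.exp (c * p.2) * h p * ψ p)) Q :=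
    (integrableOn_mul_of_tsupport_subset hQ (ce.continuous.continuousOn.mul hh)
      h1.continuous h2 h4).const_mul _
  have e1 : ∫ p in Q, h p * (Real.exp (c * p.2) * (adjHeat n ψ p - c * ψ p))
      = (∫ p in Q, Real.exp (c * p.2) * h p * adjHeat n ψ p)
        + ∫ p in Q, -c * (Real.exp (c * p.2) * h p * ψ p) := by
    rw [← integral_add i1 i2]
    exact integral_congr_ae (.of_forall fun p => by simp only; ring)
  have e2 : ∫ p in Q, F p * (Real.exp (c * p.2) * ψ p)
      = ∫ p in Q, -c * (Real.exp (c * p.2) * h p * ψ p) :=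
    setIntegral_congr_fun hQ fun p hp => by simp only [hF p hp]; ring
  linarith

section Profiles
variable {δ M x : ℝ}

lemma hasDerivAt_affine : HasDerivAt (fun x => 1 + δ - x / M) (-(1 / M)) x := by
  simpa using ((hasDerivAt_id x).div_const M).const_sub (1 + δ)

lemma affine_pos (hδ : 0 < δ) (hM : 0 < M) (hx : x ≤ M) : 0 < 1 + δ - x / M := by
  have : x / M ≤ 1 := (div_le_one hM).2 hx
  linarith

lemma sqrt_profile_ineq {A : ℝ} (hδ : 0 < δ) (hM : 0 < M) (hx : x ≤ M) {y : ℝ} :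
    A * |deriv (fun x => -√(1 + δ - x / M)) x| * y
      - deriv (deriv fun x => -√(1 + δ - x / M)) x * y ^ 2 ≤ A ^ 2 / 4 * √(1 + δ - x / M) := by
  have hv := affine_pos hδ hM hx
  have d1 : ∀ z, 0 < 1 + δ - z / M →
      deriv (fun x => -√(1 + δ - x / M)) z = (2 * M)⁻¹ * (√(1 + δ - z / M))⁻¹ := fun z hz => by
    have h := ((hasDerivAt_affine (δ := δ) (M := M) (x := z)).sqrt hz.ne').neg
    have h' : HasDerivAt (fun x => -√(1 + δ - x / M)) (-(-(1 / M) / (2 * √(1 + δ - z / M)))) z := h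
    rw [h'.deriv]
    have := (Real.sqrt_pos.2 hz).ne'
    field_simp
  have hs := Real.sqrt_pos.2 hv
  have d2 : deriv (deriv fun x => -√(1 + δ - x / M)) x
      = (4 * M ^ 2)⁻¹ * ((√(1 + δ - x / M)) ^ 3)⁻¹ := by
    have hc : Continuous fun z : ℝ => 1 + δ - z / M := by fun_prop
    have hev : deriv (fun x => -√(1 + δ - x / M)) =ᶠ[𝓝 x]
        fun z => (2 * M)⁻¹ * (√(1 + δ - z / M))⁻¹ := by
      filter_upwards [hc.continuousAt.eventually_const_lt hv] with z hz using d1 z hz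
    rw [hev.deriv_eq]
    have h := (((hasDerivAt_affine (δ := δ) (M := M) (x := x)).sqrt hv.ne').inv hs.ne').const_mul
      (2 * M)⁻¹
    have h' : HasDerivAt (fun z => (2 * M)⁻¹ * (√(1 + δ - z / M))⁻¹) _ x := h
    rw [h'.deriv]
    field_simp
    ring
  rw [d1 x hv, d2, abs_of_pos (by positivity)]
  set s := √(1 + δ - x / M)
  have key : A ^ 2 / 4 * s - (A * ((2 * M)⁻¹ * s⁻¹) * y - (4 * M ^ 2)⁻¹ * (s ^ 3)⁻¹ * y ^ 2)
      = s * (A / 2 - y / (2 * M * s ^ 2)) ^ 2 := by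
    field_simp
    ring
  nlinarith [mul_nonneg hs.le (sq_nonneg (A / 2 - y / (2 * M * s ^ 2)))]

lemma sq_profile_ineq {A : ℝ} (hδ : 0 < δ) (hM : 0 < M) (hx : x ≤ M) {y : ℝ} :
    A * |deriv (fun x => (1 + δ - x / M) ^ 2) x| * y
      - deriv (deriv fun x => (1 + δ - x / M) ^ 2) x * y ^ 2
      ≤ A ^ 2 / 2 * (1 + δ - x / M) ^ 2 := by
  have hv := affine_pos hδ hM hx
  have d1 : deriv (fun x => (1 + δ - x / M) ^ 2) = fun z => -(2 / M) * (1 + δ - z / M) := by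
    ext z
    have h := (hasDerivAt_affine (δ := δ) (M := M) (x := z)).pow 2
    have h' : HasDerivAt (fun x => (1 + δ - x / M) ^ 2) _ z := h
    rw [h'.deriv]
    push_cast
    ring
  have d2 : deriv (fun z => -(2 / M) * (1 + δ - z / M)) x = 2 / M ^ 2 := by
    rw [((hasDerivAt_affine (δ := δ) (M := M) (x := x)).const_mul (-(2 / M))).deriv]
    field_simp
  rw [d1, d2]
  simp only
  rw [abs_mul, abs_neg, abs_of_pos (show 0 < 2 / M by positivity), abs_of_pos hv]
  set v := 1 + δ - x / M
  have key : A ^ 2 / 2 * v ^ 2 - (A * (2 / M * v) * y - 2 / M ^ 2 * y ^ 2)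
      = 2 * (A * v / 2 - y / M) ^ 2 := by
    field_simp
    ring
  nlinarith [sq_nonneg (A * v / 2 - y / M)]

end Profiles
lemma isSubcal_of_solution {n : ℕ} {u : Euc n × ℝ → ℝ} {a g : Euc n × ℝ → Euc n}
    {Q : Set (Euc n × ℝ)} {M A δ : ℝ} (hA : 0 ≤ A) (hQ : IsOpen Q) (hM0 : 0 < M) (hδ : 0 < δ)
    (hu : Measurable u) (ha : Measurable a) (hg : Measurable g)
    (hM : ∀ p ∈ Q, |u p| ≤ M) (huc : ContinuousOn u Q)
    (haA : ∀ᵐ p ∂(volume.restrict Q), ‖a p‖ ≤ A)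
    (hg2 : LocallyIntegrableOn (fun p => ‖g p‖ ^ 2) Q)
    (hgrad : ∀ χ : Euc n × ℝ → ℝ, ContDiff ℝ (⊤ : ℕ∞) χ → HasCompactSupport χ → tsupport χ ⊆ Q →
      ∀ i, ∫ p in Q, u p * pdx n i χ p = - ∫ p in Q, g p i * χ p)
    (heq : ∀ χ : Euc n × ℝ → ℝ, ContDiff ℝ (⊤ : ℕ∞) χ → HasCompactSupport χ → tsupport χ ⊆ Q →
      ∫ p in Q, (-(u p * pdt n χ p) + (∑ i, a p i * g p i) * χ p + ∑ i, g p i * pdx n i χ p) = 0) :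
    IsSubcal n Q (fun p => Real.exp (A ^ 2 / 4 * p.2) * -√(1 + δ - u p / M)) ∧
      IsSubcal n Q (fun p => Real.exp (-(A ^ 2 / 2) * p.2) * (1 + δ - u p / M) ^ 2) := by
  have caff : ContDiff ℝ (⊤ : ℕ∞) fun x : ℝ => 1 + δ - x / M := by fun_prop
  have cv : ContinuousOn (fun p => 1 + δ - u p / M) Q :=
    continuousOn_const.sub (huc.div_const M)
  have H1 : IsSubsolWith n Q (fun p => -√(1 + δ - u p / M))
      (fun p => A ^ 2 / 4 * √(1 + δ - u p / M)) := fun ψ h1 h2 h3 h4 =>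
    chain_rule (f := fun x => -√(1 + δ - x / M)) (F := fun x => A ^ 2 / 4 * √(1 + δ - x / M))
      hA hQ hM0.le hu ha hg hM huc haA hg2 hgrad heq
      (fun x hx => (caff.contDiffAt.sqrt (affine_pos hδ hM0 hx.2).ne').neg)
      (caff.continuous.sqrt.const_mul _).continuousOn
      (fun x hx y _ => sqrt_profile_ineq hδ hM0 hx.2) h1 h2 h3 h4
  have H2 : IsSubsolWith n Q (fun p => (1 + δ - u p / M) ^ 2)
      (fun p => A ^ 2 / 2 * (1 + δ - u p / M) ^ 2) := fun ψ h1 h2 h3 h4 =>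
    chain_rule (f := fun x => (1 + δ - x / M) ^ 2) (F := fun x => A ^ 2 / 2 * (1 + δ - x / M) ^ 2)
      hA hQ hM0.le hu ha hg hM huc haA hg2 hgrad heq
      (fun x _ => (caff.pow 2).contDiffAt)
      ((caff.continuous.pow 2).const_mul _).continuousOn
      (fun x hx y _ => sq_profile_ineq hδ hM0 hx.2) h1 h2 h3 h4
  exact ⟨isSubcal_exp_time_mul hQ.measurableSet cv.sqrt.neg H1 fun p _ => by ring,
    isSubcal_exp_time_mul hQ.measurableSet (cv.pow 2) H2 fun p _ => by ring⟩

/-- A smooth probability density on `ℝ` supported in `[-1, 1]`. -/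
def density (z : ℝ) : ℝ :=
  (⟨1 / 2, 1, by norm_num, by norm_num⟩ : ContDiffBump (0 : ℝ)).normed volume z

lemma contDiff_density : ContDiff ℝ (⊤ : ℕ∞) density := ContDiffBump.contDiff_normed _

lemma continuous_density : Continuous density := contDiff_density.continuous

lemma density_nonneg (z : ℝ) : 0 ≤ density z := ContDiffBump.nonneg_normed _ z

lemma integral_density : ∫ z, density z = 1 := ContDiffBump.integral_normed _

lemma density_eq_zero {z : ℝ} (hz : 1 ≤ |z|) : density z = 0 := by
  rw [← Function.notMem_support]
  unfold density
  rw [ContDiffBump.support_normed_eq]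
  simpa using hz

lemma exists_density_ge : ∃ b > 0, ∀ z, |z| ≤ 1 / 2 → b ≤ density z := by
  let φ : ContDiffBump (0 : ℝ) := ⟨1 / 2, 1, by norm_num, by norm_num⟩
  refine ⟨1 / ∫ x, φ x, one_div_pos.2 φ.integral_pos, fun z hz => ?_⟩
  have h : φ z = 1 := φ.one_of_mem_closedBall
    (by rw [mem_closedBall_zero_iff]; exact hz)
  show 1 / ∫ x, φ x ≤ φ z / ∫ x, φ x
  rw [h]

lemma exists_density_le : ∃ B > 0, ∀ z, density z ≤ B := by
  obtain ⟨B, hB⟩ := continuous_density.bounded_above_of_compact_support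
    (ContDiffBump.hasCompactSupport_normed _)
  exact ⟨max B 1, by positivity, fun z =>
    (le_abs_self _).trans ((hB z).trans (le_max_left _ _))⟩

/-- A smooth step from `0` (left of `-1`) to `1` (right of `1`). -/
def step (z : ℝ) : ℝ := ∫ t in (-2 : ℝ)..z, density t

lemma hasDerivAt_step (z : ℝ) : HasDerivAt step (density z) z :=
  intervalIntegral.integral_hasDerivAt_right (continuous_density.intervalIntegrable _ _)
    (continuous_density.stronglyMeasurableAtFilter _ _) continuous_density.continuousAt

lemma contDiff_step : ContDiff ℝ (⊤ : ℕ∞) step := by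
  rw [contDiff_infty_iff_deriv]
  refine ⟨fun z => (hasDerivAt_step z).differentiableAt, ?_⟩
  rw [show deriv step = density from funext fun z => (hasDerivAt_step z).deriv]
  exact contDiff_density

lemma step_mono : Monotone step :=
  monotone_of_hasDerivAt_nonneg hasDerivAt_step density_nonneg

lemma step_eq_zero {z : ℝ} (hz : z ≤ -1) : step z = 0 := by
  refine intervalIntegral.integral_zero_ae (.of_forall fun t ht => density_eq_zero ?_)
  have : t ≤ -1 := ht.2.trans (max_le (by norm_num) hz)
  rw [abs_of_nonpos (by linarith)]
  linarith

lemma step_eq_one {z : ℝ} (hz : 1 ≤ z) : step z = 1 := by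
  rw [step, intervalIntegral.integral_eq_integral_of_support_subset, integral_density]
  intro t ht
  have : |t| < 1 := by
    by_contra h
    exact ht (density_eq_zero (not_lt.1 h))
  rw [abs_lt] at this
  exact ⟨by linarith, by linarith⟩

/-- A smooth time cut-off rising around `s₁` and decaying around `s₂`. -/
def window (s₁ ρ₁ s₂ ρ₂ s : ℝ) : ℝ := step ((s - s₁) / ρ₁) - step ((s - s₂) / ρ₂)

section Window
variable {s₁ ρ₁ s₂ ρ₂ s : ℝ}

lemma contDiff_window : ContDiff ℝ (⊤ : ℕ∞) (window s₁ ρ₁ s₂ ρ₂) :=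
  (contDiff_step.comp ((contDiff_id.sub contDiff_const).div_const _)).sub
    (contDiff_step.comp ((contDiff_id.sub contDiff_const).div_const _))

lemma hasDerivAt_window : HasDerivAt (window s₁ ρ₁ s₂ ρ₂)
    (density ((s - s₁) / ρ₁) / ρ₁ - density ((s - s₂) / ρ₂) / ρ₂) s := by
  have h : ∀ c r : ℝ, HasDerivAt (fun s => step ((s - c) / r)) (density ((s - c) / r) / r) s := by
    intro c r
    have := (hasDerivAt_step ((s - c) / r)).comp s (((hasDerivAt_id s).sub_const c).div_const r)
    rwa [mul_one_div] at this
  exact (h _ _).sub (h _ _)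

lemma window_eq_zero_of_le (h₁ : 0 < ρ₁) (h₂ : 0 < ρ₂) (h : s₁ + ρ₁ ≤ s₂ - ρ₂)
    (hs : s ≤ s₁ - ρ₁) : window s₁ ρ₁ s₂ ρ₂ s = 0 := by
  rw [window, step_eq_zero, step_eq_zero, sub_zero]
  · rw [div_le_iff₀ h₂]; linarith
  · rw [div_le_iff₀ h₁]; linarith

lemma window_eq_zero_of_ge (h₁ : 0 < ρ₁) (h₂ : 0 < ρ₂) (h : s₁ + ρ₁ ≤ s₂ - ρ₂)
    (hs : s₂ + ρ₂ ≤ s) : window s₁ ρ₁ s₂ ρ₂ s = 0 := by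
  rw [window, step_eq_one, step_eq_one, sub_self]
  · rw [le_div_iff₀ h₂]; linarith
  · rw [le_div_iff₀ h₁]; linarith

lemma step_mem (z : ℝ) : step z ∈ Set.Icc (0 : ℝ) 1 := by
  constructor
  · rw [← step_eq_zero (min_le_right z (-1))]
    exact step_mono (min_le_left _ _)
  · rw [← step_eq_one (le_max_right z 1)]
    exact step_mono (le_max_left _ _)

lemma window_mem (h₁ : 0 < ρ₁) (h₂ : 0 < ρ₂) (h : s₁ + ρ₁ ≤ s₂ - ρ₂) (s : ℝ) :
    window s₁ ρ₁ s₂ ρ₂ s ∈ Set.Icc (0 : ℝ) 1 := by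
  have m1 := step_mem ((s - s₁) / ρ₁)
  have m2 := step_mem ((s - s₂) / ρ₂)
  refine ⟨?_, by rw [window]; linarith [m1.2, m2.1]⟩
  rcases le_total s (s₂ - ρ₂) with hs | hs
  · rw [window, step_eq_zero (z := (s - s₂) / ρ₂) (by rw [div_le_iff₀ h₂]; linarith), sub_zero]
    exact m1.1
  · rw [window, step_eq_one (z := (s - s₁) / ρ₁) (by rw [le_div_iff₀ h₁]; linarith)]
    linarith [m2.2]

end Window

lemma contDiff_normSq_sub {n : ℕ} (x₀ : Euc n) :
    ContDiff ℝ (⊤ : ℕ∞) fun p : Euc n × ℝ => (‖p.1 - x₀‖ ^ 2, p.2) :=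
  ((contDiff_fst.sub contDiff_const).norm_sq ℝ).prodMk contDiff_snd

lemma hasFDerivAt_normSq_sub {n : ℕ} (x₀ : Euc n) (p v : Euc n × ℝ) :
    fderiv ℝ (fun p : Euc n × ℝ => (‖p.1 - x₀‖ ^ 2, p.2)) p v
      = (2 * inner ℝ (p.1 - x₀) v.1, v.2) := by
  have h1 : HasFDerivAt (fun p : Euc n × ℝ => p.1 - x₀) (ContinuousLinearMap.fst ℝ (Euc n) ℝ) p :=
    hasFDerivAt_fst.sub_const x₀
  have h2 := h1.norm_sq.prodMk (hasFDerivAt_snd (𝕜 := ℝ) (p := p))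
  have h3 : HasFDerivAt (fun p : Euc n × ℝ => (‖p.1 - x₀‖ ^ 2, p.2)) _ p := h2
  rw [h3.fderiv]
  simp [inner_sub_left]

lemma fderiv_radial {n : ℕ} (x₀ : Euc n) {κ : ℝ × ℝ → ℝ} (hκ : Differentiable ℝ κ)
    (p v : Euc n × ℝ) :
    fderiv ℝ (fun p : Euc n × ℝ => κ (‖p.1 - x₀‖ ^ 2, p.2)) p v
      = fderiv ℝ κ (‖p.1 - x₀‖ ^ 2, p.2) (2 * inner ℝ (p.1 - x₀) v.1, v.2) := by
  have h := fderiv_comp p (hκ (‖p.1 - x₀‖ ^ 2, p.2))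
    ((contDiff_normSq_sub x₀).differentiable (by simp) p)
  have h' : fderiv ℝ (fun p : Euc n × ℝ => κ (‖p.1 - x₀‖ ^ 2, p.2)) p = _ := h
  rw [h', ContinuousLinearMap.comp_apply, hasFDerivAt_normSq_sub]

lemma fderiv_apply_fst {κ : ℝ × ℝ → ℝ} (hκ : Differentiable ℝ κ) (q s c : ℝ) :
    fderiv ℝ κ (q, s) (c, 0) = c * deriv (fun q => κ (q, s)) q := by
  have h1 : HasDerivAt (fun q : ℝ => (q, s)) ((1 : ℝ), (0 : ℝ)) q :=
    (hasDerivAt_id q).prodMk (hasDerivAt_const q s)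
  have h2 : HasDerivAt (fun q => κ (q, s)) (fderiv ℝ κ (q, s) (1, 0)) q :=
    (hκ (q, s)).hasFDerivAt.comp_hasDerivAt q h1
  rw [h2.deriv, ← smul_eq_mul, ← map_smul]
  simp

lemma fderiv_apply_snd {κ : ℝ × ℝ → ℝ} (hκ : Differentiable ℝ κ) (q s : ℝ) :
    fderiv ℝ κ (q, s) (0, 1) = deriv (fun s => κ (q, s)) s := by
  have h1 : HasDerivAt (fun s : ℝ => (q, s)) ((0 : ℝ), (1 : ℝ)) s :=
    (hasDerivAt_const s q).prodMk (hasDerivAt_id s)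
  have h2 : HasDerivAt (fun s => κ (q, s)) (fderiv ℝ κ (q, s) (0, 1)) s :=
    (hκ (q, s)).hasFDerivAt.comp_hasDerivAt s h1
  rw [h2.deriv]

lemma pdx_radial {n : ℕ} (x₀ : Euc n) {κ : ℝ × ℝ → ℝ} (hκ : Differentiable ℝ κ) (i : Fin n) :
    pdx n i (fun p => κ (‖p.1 - x₀‖ ^ 2, p.2)) = fun p =>
      2 * (p.1 - x₀) i * fderiv ℝ κ (‖p.1 - x₀‖ ^ 2, p.2) (1, 0) := by
  ext p
  rw [pdx, fderiv_radial x₀ hκ]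
  simp only [EuclideanSpace.inner_single_right]
  rw [fderiv_apply_fst hκ, fderiv_apply_fst hκ]
  simp

lemma adjHeat_radial {n : ℕ} (x₀ : Euc n) {κ : ℝ × ℝ → ℝ} (hκ : ContDiff ℝ (⊤ : ℕ∞) κ)
    (p : Euc n × ℝ) :
    adjHeat n (fun p => κ (‖p.1 - x₀‖ ^ 2, p.2)) p
      = -deriv (fun s => κ (‖p.1 - x₀‖ ^ 2, s)) p.2
        - (4 * ‖p.1 - x₀‖ ^ 2 * deriv (deriv fun q => κ (q, p.2)) (‖p.1 - x₀‖ ^ 2)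
          + 2 * n * deriv (fun q => κ (q, p.2)) (‖p.1 - x₀‖ ^ 2)) := by
  have hd : Differentiable ℝ κ := hκ.differentiable (by simp)
  set κ₁ : ℝ × ℝ → ℝ := fun z => fderiv ℝ κ z (1, 0) with hκ₁
  have hκ₁s : ContDiff ℝ (⊤ : ℕ∞) κ₁ :=
    (hκ.fderiv_right (m := (⊤ : ℕ∞)) (by simp)).clm_apply contDiff_const
  have hd₁ : Differentiable ℝ κ₁ := hκ₁s.differentiable (by simp)
  have e1 : ∀ q s, κ₁ (q, s) = deriv (fun q => κ (q, s)) q := fun q s => by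
    rw [← one_mul (deriv _ _), ← fderiv_apply_fst hd]
  have ht : pdt n (fun p => κ (‖p.1 - x₀‖ ^ 2, p.2)) p
      = deriv (fun s => κ (‖p.1 - x₀‖ ^ 2, s)) p.2 := by
    rw [pdt, fderiv_radial x₀ hd, ← fderiv_apply_snd hd]
    simp
  have hxx : ∀ i, pdx n i (pdx n i (fun p => κ (‖p.1 - x₀‖ ^ 2, p.2))) p
      = 2 * κ₁ (‖p.1 - x₀‖ ^ 2, p.2)
        + 4 * (p.1 - x₀) i ^ 2 * fderiv ℝ κ₁ (‖p.1 - x₀‖ ^ 2, p.2) (1, 0) := by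
    intro i
    rw [pdx_radial x₀ hd i, pdx]
    have h1 : HasFDerivAt (fun p : Euc n × ℝ => 2 * (p.1 - x₀) i)
        ((2 : ℝ) • ((EuclideanSpace.proj (𝕜 := ℝ) i).comp (ContinuousLinearMap.fst ℝ (Euc n) ℝ))) p := by
      have : HasFDerivAt (fun p : Euc n × ℝ => p.1 - x₀) (ContinuousLinearMap.fst ℝ (Euc n) ℝ) p :=
        hasFDerivAt_fst.sub_const x₀
      exact ((EuclideanSpace.proj (𝕜 := ℝ) i).hasFDerivAt.comp p this).const_mul 2
    have h2 : DifferentiableAt ℝ (fun p : Euc n × ℝ => κ₁ (‖p.1 - x₀‖ ^ 2, p.2)) p :=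
      (hκ₁s.comp (contDiff_normSq_sub x₀)).differentiable (by simp) p
    have h3 := (h1.mul h2.hasFDerivAt).fderiv
    have h4 : fderiv ℝ (fun p : Euc n × ℝ =>
        2 * (p.1 - x₀) i * fderiv ℝ κ (‖p.1 - x₀‖ ^ 2, p.2) (1, 0)) p = _ := h3
    have h5 := congrFun (pdx_radial x₀ hd₁ i) p
    rw [pdx] at h5
    rw [h4]
    change 2 * (p.1 - x₀) i * fderiv ℝ (fun p : Euc n × ℝ => κ₁ (‖p.1 - x₀‖ ^ 2, p.2)) p
      (EuclideanSpace.single i 1, 0) + κ₁ (‖p.1 - x₀‖ ^ 2, p.2) *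
      (2 * (EuclideanSpace.single i (1 : ℝ) : Euc n) i) = _
    rw [h5]
    simp
    ring
  have e2 : fderiv ℝ κ₁ (‖p.1 - x₀‖ ^ 2, p.2) (1, 0)
      = deriv (deriv fun q => κ (q, p.2)) (‖p.1 - x₀‖ ^ 2) := by
    rw [fderiv_apply_fst hd₁, one_mul]
    congr 1
    ext q
    exact e1 q p.2
  rw [adjHeat, ht, lapx, Finset.sum_congr rfl fun i _ => hxx i, Finset.sum_add_distrib, e2, e1,
    ← Finset.sum_mul, ← Finset.sum_mul, ← Finset.mul_sum]
  have e3 : ∑ i, (p.1 - x₀) i ^ 2 = ‖p.1 - x₀‖ ^ 2 := by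
    rw [EuclideanSpace.norm_sq_eq]
    exact Finset.sum_congr rfl fun i _ => by rw [Real.norm_eq_abs, sq_abs]
  rw [e3]
  simp
  ring

/-- Testing a subsolution against `window(s) k(|y - x₀|², T₁ - s)`. -/
lemma IsSubcal.kernel_test {n : ℕ} {Q : Set (Euc n × ℝ)} {w : Euc n × ℝ → ℝ}
    (hw : IsSubcal n Q w) (hQ : MeasurableSet Q) {x₀ : Euc n} {T₁ s₁ ρ₁ s₂ ρ₂ r : ℝ}
    {k kq kqq kt : ℝ → ℝ → ℝ}
    (hk : ∀ q θ, 0 < θ → ContDiffAt ℝ (⊤ : ℕ∞) (fun z : ℝ × ℝ => k z.1 z.2) (q, θ))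
    (hk0 : ∀ q θ, 0 < θ → 0 ≤ k q θ)
    (hkq : ∀ q θ, 0 < θ → HasDerivAt (fun q => k q θ) (kq q θ) q)
    (hkqq : ∀ q θ, 0 < θ → HasDerivAt (fun q => kq q θ) (kqq q θ) q)
    (hkt : ∀ q θ, 0 < θ → HasDerivAt (fun θ => k q θ) (kt q θ) θ)
    (h₁ : 0 < ρ₁) (h₂ : 0 < ρ₂) (h₁₂ : s₁ + ρ₁ ≤ s₂ - ρ₂) (hT : s₂ + ρ₂ < T₁) (hr : 0 ≤ r)
    (hsub : Metric.closedBall x₀ r ×ˢ Set.Icc (s₁ - ρ₁) (s₂ + ρ₂) ⊆ Q)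
    (hsupp : ∀ q θ, r ^ 2 ≤ q → T₁ - (s₂ + ρ₂) ≤ θ → θ ≤ T₁ - (s₁ - ρ₁) → k q θ = 0) :
    ∫ p in Metric.closedBall x₀ r ×ˢ Set.Icc (s₁ - ρ₁) (s₂ + ρ₂),
      w p * ((density ((p.2 - s₂) / ρ₂) / ρ₂ - density ((p.2 - s₁) / ρ₁) / ρ₁)
          * k (‖p.1 - x₀‖ ^ 2) (T₁ - p.2)
        - window s₁ ρ₁ s₂ ρ₂ p.2 * (4 * ‖p.1 - x₀‖ ^ 2 * kqq (‖p.1 - x₀‖ ^ 2) (T₁ - p.2)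
          + 2 * n * kq (‖p.1 - x₀‖ ^ 2) (T₁ - p.2) - kt (‖p.1 - x₀‖ ^ 2) (T₁ - p.2))) ≤ 0 := by
  set C : Set (Euc n × ℝ) := Metric.closedBall x₀ r ×ˢ Set.Icc (s₁ - ρ₁) (s₂ + ρ₂) with hC
  have hCc : IsCompact C := (isCompact_closedBall _ _).prod isCompact_Icc
  set η := window s₁ ρ₁ s₂ ρ₂ with hη
  set κ : ℝ × ℝ → ℝ := fun z => η z.2 * k z.1 (T₁ - z.2) with hκdef
  have hκ : ContDiff ℝ (⊤ : ℕ∞) κ := by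
    rw [contDiff_iff_contDiffAt]
    rintro ⟨q, s⟩
    rcases lt_or_ge s T₁ with hs | hs
    · have e1 : ContDiffAt ℝ (⊤ : ℕ∞) (fun z : ℝ × ℝ => η z.2) (q, s) :=
        (contDiff_window.comp contDiff_snd).contDiffAt
      have e2 : ContDiffAt ℝ (⊤ : ℕ∞) (fun z : ℝ × ℝ => (z.1, T₁ - z.2)) (q, s) :=
        (contDiff_fst.prodMk (contDiff_const.sub contDiff_snd)).contDiffAt
      have e3 : ContDiffAt ℝ (⊤ : ℕ∞) (fun z : ℝ × ℝ => k z.1 (T₁ - z.2)) (q, s) :=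
        ContDiffAt.comp (g := fun z : ℝ × ℝ => k z.1 z.2) (q, s) (hk q (T₁ - s) (by linarith)) e2
      exact e1.mul e3
    · have : κ =ᶠ[𝓝 (q, s)] fun _ => 0 := by
        have ho : IsOpen {z : ℝ × ℝ | s₂ + ρ₂ < z.2} := isOpen_lt continuous_const continuous_snd
        filter_upwards [ho.mem_nhds (show s₂ + ρ₂ < s by linarith)] with z hz
        have hz' : s₂ + ρ₂ < z.2 := hz
        simp only [hκdef, hη, window_eq_zero_of_ge h₁ h₂ h₁₂ hz'.le, zero_mul]
      exact contDiffAt_const.congr_of_eventuallyEq this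
  set ψ : Euc n × ℝ → ℝ := fun p => κ (‖p.1 - x₀‖ ^ 2, p.2) with hψdef
  have hψ : ContDiff ℝ (⊤ : ℕ∞) ψ := hκ.comp (contDiff_normSq_sub x₀)
  have hψz : ∀ p, p ∉ C → ψ p = 0 := by
    intro p hp
    rcases lt_or_ge p.2 (s₁ - ρ₁) with h | h
    · simp only [hψdef, hκdef, hη, window_eq_zero_of_le h₁ h₂ h₁₂ h.le, zero_mul]
    rcases lt_or_ge (s₂ + ρ₂) p.2 with h' | h'
    · simp only [hψdef, hκdef, hη, window_eq_zero_of_ge h₁ h₂ h₁₂ h'.le, zero_mul]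
    · have hn : r < ‖p.1 - x₀‖ := by
        by_contra hcon
        refine hp ⟨?_, h, h'⟩
        rw [Metric.mem_closedBall, dist_eq_norm]
        exact not_lt.1 hcon
      simp only [hψdef, hκdef]
      rw [hsupp _ _ (by gcongr) (by linarith) (by linarith), mul_zero]
  have hts : tsupport ψ ⊆ C := closure_minimal (fun p hp => by
    by_contra hn
    exact hp (hψz p hn)) hCc.isClosed
  have hψc : HasCompactSupport ψ := HasCompactSupport.intro hCc hψz
  have hψ0 : ∀ p, 0 ≤ ψ p := fun p => by
    rcases lt_or_ge p.2 T₁ with h | h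
    · exact mul_nonneg (window_mem h₁ h₂ h₁₂ _).1 (hk0 _ _ (by linarith))
    · simp only [hψdef, hκdef, hη, window_eq_zero_of_ge h₁ h₂ h₁₂ (hT.le.trans h), zero_mul,
        le_refl]
  have main := hw ψ hψ hψc hψ0 (hts.trans hsub)
  rw [setIntegral_eq_of_subset_of_forall_sdiff_eq_zero hQ hsub fun p hp => by
    rw [adjHeat_eq_zero_of_notMem_tsupport fun h => hp.2 (hts h), mul_zero]] at main
  refine le_of_eq_of_le (setIntegral_congr_fun hCc.measurableSet fun p hp => ?_) main
  have hθ : 0 < T₁ - p.2 := by linarith [hp.2.2]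
  simp only [hψdef]
  rw [adjHeat_radial x₀ hκ]
  have d1 : deriv (fun s => κ (‖p.1 - x₀‖ ^ 2, s)) p.2
      = (density ((p.2 - s₁) / ρ₁) / ρ₁ - density ((p.2 - s₂) / ρ₂) / ρ₂)
          * k (‖p.1 - x₀‖ ^ 2) (T₁ - p.2) - η p.2 * kt (‖p.1 - x₀‖ ^ 2) (T₁ - p.2) := by
    have a1 := (hkt (‖p.1 - x₀‖ ^ 2) _ hθ).comp p.2 ((hasDerivAt_id p.2).const_sub T₁)
    have a2 : HasDerivAt (fun s => κ (‖p.1 - x₀‖ ^ 2, s)) _ p.2 := hasDerivAt_window.mul a1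
    rw [a2.deriv]
    ring
  have d2 : (deriv fun q => κ (q, p.2)) = fun q => η p.2 * kq q (T₁ - p.2) := by
    ext q
    exact ((hkq q _ hθ).const_mul (η p.2)).deriv
  have d3 : deriv (deriv fun q => κ (q, p.2)) (‖p.1 - x₀‖ ^ 2)
      = η p.2 * kqq (‖p.1 - x₀‖ ^ 2) (T₁ - p.2) := by
    rw [d2]
    exact ((hkqq _ _ hθ).const_mul (η p.2)).deriv
  rw [d1, d3, d2]
  ring

/-- The Gaussian kernel without its normalising constant, as a function of `|y|²` and `θ`. -/
def gau (n : ℕ) (q θ : ℝ) : ℝ := Real.exp (-(n / 2) * Real.log θ - q / (4 * θ))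

section Gau
variable {n : ℕ} {q θ : ℝ}

lemma gau_pos : 0 < gau n q θ := Real.exp_pos _

lemma contDiffAt_gau (hθ : 0 < θ) :
    ContDiffAt ℝ (⊤ : ℕ∞) (fun z : ℝ × ℝ => gau n z.1 z.2) (q, θ) := by
  have h1 : ContDiffAt ℝ (⊤ : ℕ∞) (fun z : ℝ × ℝ => z.1) (q, θ) := contDiff_fst.contDiffAt
  have h2 : ContDiffAt ℝ (⊤ : ℕ∞) (fun z : ℝ × ℝ => z.2) (q, θ) := contDiff_snd.contDiffAt
  exact ((contDiffAt_const.mul (h2.log hθ.ne')).sub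
    (h1.div (contDiffAt_const.mul h2) (by positivity))).exp

lemma hasDerivAt_gau_fst : HasDerivAt (fun q => gau n q θ) (-gau n q θ / (4 * θ)) q := by
  have h := (((hasDerivAt_id q).div_const (4 * θ)).const_sub (-(n / 2) * Real.log θ)).exp
  refine h.congr_deriv ?_
  simp only [gau, id]
  ring

lemma hasDerivAt_gau_snd (hθ : 0 < θ) :
    HasDerivAt (fun θ => gau n q θ) (gau n q θ * (q / (4 * θ ^ 2) - n / (2 * θ))) θ := by
  have h1 : HasDerivAt (fun θ : ℝ => q / (4 * θ)) (-(q / (4 * θ ^ 2))) θ := by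
    have := (hasDerivAt_const θ q).div ((hasDerivAt_id θ).const_mul 4) (by simp; exact hθ.ne')
    refine this.congr_deriv ?_
    simp only [id]
    field_simp
    ring
  have h := (((Real.hasDerivAt_log hθ.ne').const_mul (-(n / 2 : ℝ))).sub h1).exp
  refine h.congr_deriv ?_
  simp only [gau, Pi.sub_apply]
  field_simp
  ring

lemma integral_gau (hθ : 0 < θ) (x₀ : Euc n) :
    ∫ y : Euc n, gau n (‖y - x₀‖ ^ 2) θ = (4 * π) ^ (n / 2 : ℝ) := by
  rw [integral_sub_right_eq_self (fun y : Euc n => gau n (‖y‖ ^ 2) θ)]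
  have e : ∀ y : Euc n, gau n (‖y‖ ^ 2) θ
      = Real.exp (-(n / 2) * Real.log θ) * Real.exp (-(1 / (4 * θ)) * ‖y‖ ^ 2) := fun y => by
    rw [gau, ← Real.exp_add]
    congr 1
    ring
  simp only [e]
  rw [integral_const_mul, GaussianFourier.integral_rexp_neg_mul_sq_norm (by positivity)]
  have e2 : π / (1 / (4 * θ)) = (4 * π) * θ := by field_simp
  rw [e2, Real.mul_rpow (by positivity) hθ.le, finrank_euclideanSpace, Fintype.card_fin,
    Real.rpow_def_of_pos hθ, mul_left_comm, ← Real.exp_add]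
  ring_nf
  simp

lemma integrable_gau (hθ : 0 < θ) (x₀ : Euc n) :
    Integrable fun y : Euc n => gau n (‖y - x₀‖ ^ 2) θ := by
  by_contra h
  have := integral_undef h
  rw [integral_gau hθ] at this
  exact (Real.rpow_pos_of_pos (by positivity : 0 < 4 * π) _).ne' this

end Gau

/-- A smooth convex function vanishing on the negative half-line, with `0 ≤ ramp z ≤ z⁺`. -/
def ramp (z : ℝ) : ℝ := ∫ t in (0 : ℝ)..z, Real.smoothTransition t

lemma hasDerivAt_ramp (z : ℝ) : HasDerivAt ramp (Real.smoothTransition z) z :=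
  intervalIntegral.integral_hasDerivAt_right
    (Real.smoothTransition.continuous.intervalIntegrable _ _)
    (Real.smoothTransition.continuous.stronglyMeasurableAtFilter _ _)
    Real.smoothTransition.continuousAt

lemma hasDerivAt_smoothTransition (z : ℝ) :
    HasDerivAt Real.smoothTransition (deriv Real.smoothTransition z) z :=
  ((Real.smoothTransition.contDiff (n := 1)).differentiable (by simp) z).hasDerivAt

lemma continuous_deriv_smoothTransition : Continuous (deriv Real.smoothTransition) :=
  (Real.smoothTransition.contDiff (n := 1)).continuous_deriv le_rfl

lemma contDiff_ramp : ContDiff ℝ (⊤ : ℕ∞) ramp := by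
  rw [contDiff_infty_iff_deriv]
  refine ⟨fun z => (hasDerivAt_ramp z).differentiableAt, ?_⟩
  rw [show deriv ramp = Real.smoothTransition from funext fun z => (hasDerivAt_ramp z).deriv]
  exact Real.smoothTransition.contDiff

lemma ramp_mono : Monotone ramp :=
  monotone_of_hasDerivAt_nonneg hasDerivAt_ramp Real.smoothTransition.nonneg

lemma ramp_eq_zero {z : ℝ} (hz : z ≤ 0) : ramp z = 0 := by
  refine intervalIntegral.integral_zero_ae (.of_forall fun t ht => ?_)
  exact Real.smoothTransition.zero_of_nonpos (ht.2.trans (max_le le_rfl hz))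

lemma ramp_nonneg (z : ℝ) : 0 ≤ ramp z := by
  rw [← ramp_eq_zero (min_le_right z 0)]
  exact ramp_mono (min_le_left _ _)

lemma ramp_le {z : ℝ} (hz : 0 ≤ z) : ramp z ≤ z := by
  have h : ramp z ≤ ∫ _ in (0 : ℝ)..z, (1 : ℝ) :=
    intervalIntegral.integral_mono_on hz
      (Real.smoothTransition.continuous.intervalIntegrable _ _) (by simp)
      fun _ _ => Real.smoothTransition.le_one _
  simpa using h

lemma ramp_pos {z : ℝ} (hz : 0 < z) : 0 < ramp z :=
  intervalIntegral.intervalIntegral_pos_of_pos_on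
    (Real.smoothTransition.continuous.intervalIntegrable _ _)
    (fun _ ht => Real.smoothTransition.pos_of_pos ht.1) hz

section Gau
variable {n : ℕ} {q θ : ℝ}

lemma gau_anti (hθ : 0 < θ) : Antitone fun q => gau n q θ := fun p q h => by
  simp only [gau]
  gcongr

lemma continuousOn_gau : ContinuousOn (fun z : ℝ × ℝ => gau n z.1 z.2) {z | 0 < z.2} :=
  fun _ hz => (contDiffAt_gau hz).continuousAt.continuousWithinAt

/-- Constant in the Gaussian bound away from the pole. -/
def gauBound (n : ℕ) (q : ℝ) : ℝ := Real.exp (-(n / 2) * Real.log (q / (4 * (n + 1))))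

lemma gauBound_pos : 0 < gauBound n q := Real.exp_pos _

lemma gau_le (hq : 0 < q) (hθ : 0 < θ) :
    gau n q θ ≤ gauBound n q * Real.exp (-(q / (8 * θ))) := by
  rw [gau, gauBound, ← Real.exp_add, Real.exp_le_exp]
  set α := q / (4 * (n + 1 : ℝ)) with hα
  have hα0 : 0 < α := by positivity
  have h1 := Real.log_le_sub_one_of_pos (div_pos hα0 hθ)
  rw [Real.log_div hα0.ne' hθ.ne'] at h1
  have h2 : (n / 2 : ℝ) * (α / θ) ≤ q / (8 * θ) := by
    rw [hα]
    have : (n / 2 : ℝ) * (q / (4 * (n + 1)) / θ) = (n / (n + 1)) * (q / (8 * θ)) := by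
      field_simp
      ring
    rw [this]
    have h3 : (n : ℝ) / (n + 1) ≤ 1 := by
      rw [div_le_one (by positivity)]
      linarith
    have h4 : 0 ≤ q / (8 * θ) := by positivity
    nlinarith
  have h3 : (n / 2 : ℝ) * (Real.log α - Real.log θ) ≤ (n / 2) * (α / θ) := by
    gcongr
    linarith
  have h4 : q / (4 * θ) = 2 * (q / (8 * θ)) := by
    field_simp
    norm_num
  rw [h4]
  linarith

lemma gau_le_gauBound (hq : 0 < q) (hθ : 0 < θ) : gau n q θ ≤ gauBound n q := by
  refine (gau_le hq hθ).trans ?_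
  have : Real.exp (-(q / (8 * θ))) ≤ 1 := Real.exp_le_one_iff.2 (by
    have : 0 ≤ q / (8 * θ) := by positivity
    linarith)
  nlinarith [gauBound_pos (n := n) (q := q)]

lemma gau_div (hθ : 0 < θ) : gau n q θ / θ = gau (n + 2) q θ := by
  rw [gau, gau]
  rw [div_eq_mul_inv, ← Real.exp_log (inv_pos.2 hθ), Real.log_inv, ← Real.exp_add]
  congr 1
  push_cast
  ring

lemma exists_gau_le_of_small (hq : 0 < q) {c : ℝ} (hc : 0 < c) :
    ∃ σ₀ > 0, ∀ θ, 0 < θ → θ ≤ σ₀ → gau n q θ ≤ c := by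
  set L := Real.log (gauBound n q / c) with hL
  have hB := gauBound_pos (n := n) (q := q)
  refine ⟨q / (8 * (|L| + 1)), by positivity, fun θ hθ hle => (gau_le hq hθ).trans ?_⟩
  rw [le_div_iff₀ (by positivity)] at hle
  have h1 : L ≤ q / (8 * θ) := by
    rw [le_div_iff₀ (by positivity)]
    nlinarith [le_abs_self L, abs_nonneg L]
  have h2 : gauBound n q / c ≤ Real.exp (q / (8 * θ)) := by
    rw [← Real.exp_log (div_pos hB hc)]
    exact Real.exp_le_exp.2 h1
  rw [div_le_iff₀ hc] at h2
  rw [Real.exp_neg, ← div_eq_mul_inv, div_le_iff₀ (Real.exp_pos _)]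
  linarith

/-- For small time lags the Gaussian near its centre dominates the Gaussian at distance `r`. -/
lemma exists_lag {r : ℝ} (hr : 0 < r) : ∃ Δ₀ > 0, ∀ Δ, 0 < Δ → Δ ≤ Δ₀ → ∃ c > 0, ∃ h > 0,
    (∀ q θ, r ^ 2 ≤ q → 0 < θ → θ ≤ 2 * Δ → gau n q θ ≤ c) ∧
    ∀ q θ, q ≤ r ^ 2 / 16 → Δ / 2 ≤ θ → θ ≤ 2 * Δ → c + h ≤ gau n q θ := by
  set L := Real.log (gauBound n (r ^ 2)) with hL
  have hB := gauBound_pos (n := n) (q := r ^ 2)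
  have hr2 : 0 < r ^ 2 := by positivity
  refine ⟨min (1 / 2) (r ^ 2 / (32 * (|L| + 1))), by positivity, fun Δ hΔ hle => ?_⟩
  have hΔ1 : Δ ≤ 1 / 2 := hle.trans (min_le_left _ _)
  have hΔ2 : Δ ≤ r ^ 2 / (32 * (|L| + 1)) := hle.trans (min_le_right _ _)
  rw [le_div_iff₀ (by positivity)] at hΔ2
  have hlt : gauBound n (r ^ 2) * Real.exp (-(r ^ 2 / (16 * Δ)))
      < Real.exp (-(r ^ 2 / (32 * Δ))) := by
    rw [← Real.exp_log hB, ← Real.exp_add, Real.exp_lt_exp, ← hL]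
    have h1 : r ^ 2 / (16 * Δ) = 2 * (r ^ 2 / (32 * Δ)) := by
      field_simp
      norm_num
    have h2 : |L| + 1 ≤ r ^ 2 / (32 * Δ) := by
      rw [le_div_iff₀ (by positivity)]
      linarith
    linarith [le_abs_self L]
  refine ⟨_, mul_pos hB (Real.exp_pos (-(r ^ 2 / (16 * Δ)))), _, sub_pos.2 hlt, ?_, ?_⟩
  · intro q θ hq hθ hθ2
    refine (gau_anti hθ hq).trans ((gau_le hr2 hθ).trans ?_)
    have h1 : r ^ 2 / (16 * Δ) ≤ r ^ 2 / (8 * θ) :=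
      div_le_div_of_nonneg_left hr2.le (by positivity) (by linarith)
    gcongr
  · intro q θ hq hθ1 hθ2
    have hθ : 0 < θ := by linarith
    rw [add_sub_cancel, gau, Real.exp_le_exp]
    have h1 : Real.log θ ≤ 0 := Real.log_nonpos hθ.le (by linarith)
    have h2 : 0 ≤ -(n / 2 : ℝ) * Real.log θ := by
      have : (0 : ℝ) ≤ n / 2 := by positivity
      nlinarith
    have h3 : q / (4 * θ) ≤ r ^ 2 / 16 / (4 * (Δ / 2)) := by gcongr
    have h4 : r ^ 2 / 16 / (4 * (Δ / 2)) = r ^ 2 / (32 * Δ) := by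
      field_simp
      norm_num
    linarith

lemma integral_scaled_density {s₂ ρ₂ : ℝ} (hρ : 0 < ρ₂) :
    ∫ s, density ((s - s₂) / ρ₂) / ρ₂ = 1 := by
  rw [integral_div, integral_sub_right_eq_self (fun s => density (s / ρ₂)),
    Measure.integral_comp_div, integral_density, abs_of_pos hρ]
  simp [hρ.ne']

lemma integrable_scaled_density {s₂ ρ₂ : ℝ} (hρ : 0 < ρ₂) :
    Integrable fun s => density ((s - s₂) / ρ₂) / ρ₂ := by
  by_contra h
  have := integral_undef h
  rw [integral_scaled_density hρ] at this
  norm_num at this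

lemma scaled_density_nonneg {s₂ ρ₂ s : ℝ} (hρ : 0 < ρ₂) : 0 ≤ density ((s - s₂) / ρ₂) / ρ₂ :=
  div_nonneg (density_nonneg _) hρ.le

lemma continuous_scaled_density {s₂ ρ₂ : ℝ} :
    Continuous fun s => density ((s - s₂) / ρ₂) / ρ₂ :=
  (continuous_density.comp ((continuous_id.sub continuous_const).div_const _)).div_const _

lemma continuousOn_radial {f : ℝ × ℝ → ℝ} (hf : ContinuousOn f {z | 0 < z.2}) (x₀ : Euc n)
    {T₁ : ℝ} {C : Set (Euc n × ℝ)} (hC : ∀ p ∈ C, p.2 < T₁) :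
    ContinuousOn (fun p : Euc n × ℝ => f (‖p.1 - x₀‖ ^ 2, T₁ - p.2)) C := by
  refine hf.comp (f := fun p : Euc n × ℝ => (‖p.1 - x₀‖ ^ 2, T₁ - p.2))
    (Continuous.continuousOn (by fun_prop)) fun p hp => ?_
  have := hC p hp
  show 0 < T₁ - p.2
  linarith

/-- Mollified in time, the Gaussian has total mass at most that of one time slice. -/
lemma integral_density_mul_gau_le (x₀ : Euc n) {r l b T₁ s₂ ρ₂ : ℝ} (hb : b < T₁) (hρ : 0 < ρ₂) :
    ∫ p in Metric.closedBall x₀ r ×ˢ Set.Icc l b,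
      density ((p.2 - s₂) / ρ₂) / ρ₂ * gau n (‖p.1 - x₀‖ ^ 2) (T₁ - p.2)
        ≤ (4 * π) ^ (n / 2 : ℝ) := by
  have hCc : IsCompact (Metric.closedBall x₀ r ×ˢ Set.Icc l b) :=
    (isCompact_closedBall _ _).prod isCompact_Icc
  have hcont : ContinuousOn (fun p : Euc n × ℝ =>
      density ((p.2 - s₂) / ρ₂) / ρ₂ * gau n (‖p.1 - x₀‖ ^ 2) (T₁ - p.2))
      (Metric.closedBall x₀ r ×ˢ Set.Icc l b) :=
    (continuous_scaled_density.comp continuous_snd).continuousOn.mul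
      (continuousOn_radial continuousOn_gau x₀ fun p hp => lt_of_le_of_lt hp.2.2 hb)
  have hint := hcont.integrableOn_compact (μ := volume) hCc
  rw [Measure.volume_eq_prod] at hint ⊢
  have hswap : IntegrableOn (fun z : ℝ × Euc n =>
      density ((z.1 - s₂) / ρ₂) / ρ₂ * gau n (‖z.2 - x₀‖ ^ 2) (T₁ - z.1))
      (Set.Icc l b ×ˢ Metric.closedBall x₀ r) (volume.prod volume) := hint.swap
  rw [← setIntegral_prod_swap]
  simp only [Prod.snd_swap, Prod.fst_swap]
  rw [setIntegral_prod _ hswap]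
  calc ∫ s in Set.Icc l b, ∫ y in Metric.closedBall x₀ r,
        density ((s - s₂) / ρ₂) / ρ₂ * gau n (‖y - x₀‖ ^ 2) (T₁ - s)
      ≤ ∫ s in Set.Icc l b, density ((s - s₂) / ρ₂) / ρ₂ * (4 * π) ^ (n / 2 : ℝ) := by
        refine integral_mono_of_nonneg (.of_forall fun s => ?_) ?_ ?_
        · exact integral_nonneg fun y => mul_nonneg (scaled_density_nonneg hρ) gau_pos.le
        · exact ((integrable_scaled_density hρ).mul_const _).integrableOn
        · refine (ae_restrict_iff' measurableSet_Icc).2 (.of_forall fun s hs => ?_)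
          have hθ : 0 < T₁ - s := by linarith [hs.2]
          simp only
          rw [integral_const_mul, ← integral_gau hθ x₀]
          exact mul_le_mul_of_nonneg_left (setIntegral_le_integral (integrable_gau hθ x₀)
            (.of_forall fun y => gau_pos.le)) (scaled_density_nonneg hρ)
    _ = (∫ s in Set.Icc l b, density ((s - s₂) / ρ₂) / ρ₂) * (4 * π) ^ (n / 2 : ℝ) :=
        integral_mul_const _ _
    _ ≤ 1 * (4 * π) ^ (n / 2 : ℝ) := by
        gcongr
        rw [← integral_scaled_density (s₂ := s₂) hρ]
        exact setIntegral_le_integral (integrable_scaled_density hρ)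
          (.of_forall fun y => scaled_density_nonneg hρ)
    _ = _ := one_mul _

end Gau

/-- A nonnegative supersolution at `(x₀, t₀)` controls its own integral at earlier times. -/
lemma IsSubcal.integral_le_of_neg {n : ℕ} {Q : Set (Euc n × ℝ)} {S : Euc n × ℝ → ℝ}
    (hS : IsSubcal n Q fun p => -S p) (hQ : MeasurableSet Q) (hSc : ContinuousOn S Q)
    (hS0 : ∀ p ∈ Q, 0 ≤ S p) {x₀ : Euc n} {t₀ r r₁ s₁ ρ Θ c h b : ℝ} (hr : 0 < r) (hr₁ : r₁ ≤ r)
    (hρ : 0 < ρ) (hs : s₁ + ρ < t₀) (hΘ : t₀ - (s₁ - ρ) < Θ) (hc0 : 0 < c)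
    (hc : ∀ q θ, r ^ 2 ≤ q → 0 < θ → θ ≤ Θ → gau n q θ ≤ c)
    (hm : ∀ q θ, q ≤ r₁ ^ 2 → t₀ - (s₁ + ρ / 2) ≤ θ → θ ≤ Θ → c + h ≤ gau n q θ)
    (hsub : Metric.closedBall x₀ r ×ˢ Set.Icc (s₁ - ρ) t₀ ⊆ Q)
    (hb : ∀ z, |z| ≤ 1 / 2 → b ≤ density z) :
    b / ρ * ramp h * ∫ p in Metric.closedBall x₀ r₁ ×ˢ Set.Icc (s₁ - ρ / 2) (s₁ + ρ / 2), S p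
      ≤ S (x₀, t₀) * (4 * π) ^ (n / 2 : ℝ) := by
  set C : Set (Euc n × ℝ) := Metric.closedBall x₀ r ×ˢ Set.Icc (s₁ - ρ) t₀ with hC
  have hCc : IsCompact C := (isCompact_closedBall _ _).prod isCompact_Icc
  have hp₀ : (x₀, t₀) ∈ C := ⟨Metric.mem_closedBall_self hr.le, by constructor <;> linarith⟩
  have hG : 0 < (4 * π) ^ (n / 2 : ℝ) := Real.rpow_pos_of_pos (by positivity) _
  suffices H : ∀ e > 0, b / ρ * ramp h *
      ∫ p in Metric.closedBall x₀ r₁ ×ˢ Set.Icc (s₁ - ρ / 2) (s₁ + ρ / 2), S p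
      ≤ (S (x₀, t₀) + e) * (4 * π) ^ (n / 2 : ℝ) by
    refine le_of_forall_pos_le_add fun e he => (H (e / (4 * π) ^ (n / 2 : ℝ)) (by positivity)).trans
      (le_of_eq ?_)
    rw [add_mul, div_mul_cancel₀ _ hG.ne']
  intro e he
  obtain ⟨d, hd0, hd⟩ := Metric.continuousOn_iff.1 (hSc.mono hsub) _ hp₀ e he
  set d' := min (d / 2) r with hd'
  have hd'0 : 0 < d' := by positivity
  obtain ⟨σ₀, hσ₀, hsmall⟩ := exists_gau_le_of_small (n := n) (q := d' ^ 2) (by positivity) hc0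
  obtain ⟨σ, hσ0, hσ⟩ : ∃ σ > 0, σ ≤ σ₀ / 2 ∧ σ ≤ d / 2 ∧ σ ≤ t₀ - (s₁ + ρ)
      ∧ σ ≤ Θ - (t₀ - (s₁ - ρ)) :=
    ⟨min (min (σ₀ / 2) (d / 2)) (min (t₀ - (s₁ + ρ)) (Θ - (t₀ - (s₁ - ρ)))),
      lt_min (by positivity) (lt_min (by linarith) (by linarith)),
      (min_le_left _ _).trans (min_le_left _ _), (min_le_left _ _).trans (min_le_right _ _),
      (min_le_right _ _).trans (min_le_left _ _), (min_le_right _ _).trans (min_le_right _ _)⟩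
  obtain ⟨hσ1, hσ2, hσ3, hσ4⟩ := hσ
  have e0 : t₀ - σ / 2 + σ / 2 = t₀ := by ring
  have key := hS.kernel_test hQ (x₀ := x₀) (T₁ := t₀ + σ) (s₁ := s₁) (ρ₁ := ρ)
    (s₂ := t₀ - σ / 2) (ρ₂ := σ / 2) (r := r) (k := fun q θ => ramp (gau n q θ - c))
    (kq := fun q θ => Real.smoothTransition (gau n q θ - c) * (-gau n q θ / (4 * θ)))
    (kqq := fun q θ => deriv Real.smoothTransition (gau n q θ - c) * (-gau n q θ / (4 * θ)) *
        (-gau n q θ / (4 * θ)) + Real.smoothTransition (gau n q θ - c) *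
          (-(-gau n q θ / (4 * θ)) / (4 * θ)))
    (kt := fun q θ => Real.smoothTransition (gau n q θ - c) *
      (gau n q θ * (q / (4 * θ ^ 2) - n / (2 * θ))))
    (fun q θ hθ => (contDiff_ramp.contDiffAt (x := gau n q θ - c)).comp
      (f := fun z : ℝ × ℝ => gau n z.1 z.2 - c) (q, θ) ((contDiffAt_gau hθ).sub contDiffAt_const))
    (fun q θ _ => ramp_nonneg _)
    (fun q θ hθ => (hasDerivAt_ramp _).comp q (hasDerivAt_gau_fst.sub_const c))
    (fun q θ hθ => ((hasDerivAt_smoothTransition _).comp q (hasDerivAt_gau_fst.sub_const c)).mul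
      ((hasDerivAt_gau_fst.neg).div_const _))
    (fun q θ hθ => (hasDerivAt_ramp _).comp θ ((hasDerivAt_gau_snd hθ).sub_const c))
    hρ (by positivity) (by linarith) (by linarith) hr.le (by rwa [e0])
    (fun q θ hq h1 h2 => ramp_eq_zero (by
      have := hc q θ hq (by linarith) (by linarith)
      linarith))
  rw [e0, ← hC] at key
  have hCT : ∀ p ∈ C, p.2 < t₀ + σ := fun p hp => by linarith [hp.2.2]
  have hSC : ContinuousOn S C := hSc.mono hsub
  have hgC := continuousOn_radial (continuousOn_gau (n := n)) x₀ hCT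
  set G : Euc n × ℝ → ℝ := fun p => gau n (‖p.1 - x₀‖ ^ 2) (t₀ + σ - p.2) with hGdef
  set β : Euc n × ℝ → ℝ := fun p => density ((p.2 - (t₀ - σ / 2)) / (σ / 2)) / (σ / 2) with hβ
  set α : Euc n × ℝ → ℝ := fun p => density ((p.2 - s₁) / ρ) / ρ with hα
  have hβc : ContinuousOn β C :=
    (continuous_scaled_density.comp continuous_snd).continuousOn
  have hαc : ContinuousOn α C :=
    (continuous_scaled_density.comp continuous_snd).continuousOn
  have hkc : ContinuousOn (fun p => ramp (G p - c)) C :=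
    contDiff_ramp.continuous.comp_continuousOn (hgC.sub continuousOn_const)
  have hβ0 : ∀ p, 0 ≤ β p := fun p => scaled_density_nonneg (by positivity)
  have hα0 : ∀ p, 0 ≤ α p := fun p => scaled_density_nonneg hρ
  have hdiff : ∫ p in C, (S p * (α p * ramp (G p - c)) - S p * (β p * ramp (G p - c))) ≤ 0 := by
    refine le_trans (setIntegral_mono_on ?_ ?_ hCc.measurableSet fun p hp => ?_) key
    · exact ((hSC.mul (hαc.mul hkc)).sub (hSC.mul (hβc.mul hkc))).integrableOn_compact hCc
    · refine ContinuousOn.integrableOn_compact hCc ?_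
      have hθc : ContinuousOn (fun p : Euc n × ℝ => t₀ + σ - p.2) C :=
        Continuous.continuousOn (by fun_prop)
      have hqc : ContinuousOn (fun p : Euc n × ℝ => ‖p.1 - x₀‖ ^ 2) C :=
        Continuous.continuousOn (by fun_prop)
      have hθ0 : ∀ p ∈ C, t₀ + σ - p.2 ≠ 0 := fun p hp => by
        have := hCT p hp
        intro h
        linarith
      have hG1 : ContinuousOn (fun p => -G p / (4 * (t₀ + σ - p.2))) C :=
        hgC.neg.div (continuousOn_const.mul hθc) fun p hp =>
          mul_ne_zero (by norm_num) (hθ0 p hp)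
      have hG2 : ContinuousOn (fun p => -(-G p / (4 * (t₀ + σ - p.2))) / (4 * (t₀ + σ - p.2))) C :=
        hG1.neg.div (continuousOn_const.mul hθc) fun p hp =>
          mul_ne_zero (by norm_num) (hθ0 p hp)
      have hst : ContinuousOn (fun p => Real.smoothTransition (G p - c)) C :=
        Real.smoothTransition.continuous.comp_continuousOn (hgC.sub continuousOn_const)
      have hdst : ContinuousOn (fun p => deriv Real.smoothTransition (G p - c)) C :=
        continuous_deriv_smoothTransition.comp_continuousOn (hgC.sub continuousOn_const)
      have hGt : ContinuousOn (fun p => G p * (‖p.1 - x₀‖ ^ 2 / (4 * (t₀ + σ - p.2) ^ 2)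
          - n / (2 * (t₀ + σ - p.2)))) C := by
        refine hgC.mul ((hqc.div (continuousOn_const.mul (hθc.pow 2)) fun p hp => ?_).sub
          (continuousOn_const.div (continuousOn_const.mul hθc) fun p hp => ?_))
        · exact mul_ne_zero (by norm_num) (pow_ne_zero _ (hθ0 p hp))
        · exact mul_ne_zero (by norm_num) (hθ0 p hp)
      have hwc : ContinuousOn (fun p : Euc n × ℝ => window s₁ ρ (t₀ - σ / 2) (σ / 2) p.2) C :=
        (contDiff_window.continuous.comp continuous_snd).continuousOn
      exact hSC.neg.mul (((hβc.sub hαc).mul hkc).sub (hwc.mul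
        ((((continuousOn_const.mul hqc).mul ((hdst.mul hG1).mul hG1 |>.add (hst.mul hG2))).add
          (continuousOn_const.mul (hst.mul hG1))).sub (hst.mul hGt))))
    · have hθ : 0 < t₀ + σ - p.2 := by linarith [hCT p hp]
      have hw := (window_mem hρ (by positivity : 0 < σ / 2)
        (by linarith : s₁ + ρ ≤ t₀ - σ / 2 - σ / 2) p.2).1
      have hst : 0 ≤ deriv Real.smoothTransition (G p - c) :=
        Real.smoothTransition.monotone.deriv_nonneg
      have hL : (4 * ‖p.1 - x₀‖ ^ 2 * (deriv Real.smoothTransition (G p - c)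
          * (-G p / (4 * (t₀ + σ - p.2))) * (-G p / (4 * (t₀ + σ - p.2)))
          + Real.smoothTransition (G p - c) *
            (-(-G p / (4 * (t₀ + σ - p.2))) / (4 * (t₀ + σ - p.2))))
          + 2 * n * (Real.smoothTransition (G p - c) * (-G p / (4 * (t₀ + σ - p.2))))
          - Real.smoothTransition (G p - c) * (G p * (‖p.1 - x₀‖ ^ 2 / (4 * (t₀ + σ - p.2) ^ 2)
            - n / (2 * (t₀ + σ - p.2)))))
          = 4 * ‖p.1 - x₀‖ ^ 2 * (deriv Real.smoothTransition (G p - c)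
            * (G p / (4 * (t₀ + σ - p.2))) ^ 2) := by
        field_simp
        ring
      have hL0 : 0 ≤ S p * (window s₁ ρ (t₀ - σ / 2) (σ / 2) p.2 *
          (4 * ‖p.1 - x₀‖ ^ 2 * (deriv Real.smoothTransition (G p - c)
            * (G p / (4 * (t₀ + σ - p.2))) ^ 2))) :=
        mul_nonneg (hS0 p (hsub hp)) (mul_nonneg hw (by positivity))
      have e1 : ∀ X Y W : ℝ, Y = W → 0 ≤ S p * (window s₁ ρ (t₀ - σ / 2) (σ / 2) p.2 * W) →
          S p * (α p * X) - S p * (β p * X) ≤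
          -S p * ((β p - α p) * X - window s₁ ρ (t₀ - σ / 2) (σ / 2) p.2 * Y) := by
        rintro X Y W rfl h
        linarith
      exact e1 _ _ _ hL hL0
  have hIα : IntegrableOn (fun p => S p * (α p * ramp (G p - c))) C :=
    (hSC.mul (hαc.mul hkc)).integrableOn_compact hCc
  have hIβ : IntegrableOn (fun p => S p * (β p * ramp (G p - c))) C :=
    (hSC.mul (hβc.mul hkc)).integrableOn_compact hCc
  rw [integral_sub hIα hIβ] at hdiff
  have hlow : b / ρ * ramp h *
      ∫ p in Metric.closedBall x₀ r₁ ×ˢ Set.Icc (s₁ - ρ / 2) (s₁ + ρ / 2), S p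
      ≤ ∫ p in C, S p * (α p * ramp (G p - c)) := by
    have hDC : Metric.closedBall x₀ r₁ ×ˢ Set.Icc (s₁ - ρ / 2) (s₁ + ρ / 2) ⊆ C :=
      Set.prod_mono (Metric.closedBall_subset_closedBall hr₁)
        (Set.Icc_subset_Icc (by linarith) (by linarith))
    have hDc : IsCompact (Metric.closedBall x₀ r₁ ×ˢ Set.Icc (s₁ - ρ / 2) (s₁ + ρ / 2)) :=
      (isCompact_closedBall _ _).prod isCompact_Icc
    rw [← integral_const_mul]
    refine le_trans (setIntegral_mono_on ?_ (hIα.mono_set hDC) hDc.measurableSet fun p hp => ?_)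
      (setIntegral_mono_set hIα ((ae_restrict_iff' hCc.measurableSet).2 (.of_forall fun p hp => ?_))
        hDC.eventuallyLE)
    · exact (((hSC.mono hDC).integrableOn_compact hDc).const_mul _)
    · have h1 : b / ρ ≤ α p := by
        refine div_le_div_of_nonneg_right (hb _ ?_) hρ.le
        rw [abs_div, abs_of_pos hρ, div_le_iff₀ hρ, abs_le]
        constructor <;> linarith [hp.2.1, hp.2.2]
      have h2 : ramp h ≤ ramp (G p - c) := by
        refine ramp_mono ?_
        have hn : ‖p.1 - x₀‖ ≤ r₁ := by
          rw [← dist_eq_norm]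
          exact hp.1
        have := hm (‖p.1 - x₀‖ ^ 2) (t₀ + σ - p.2) (by gcongr) (by linarith [hp.2.2])
          (by linarith [hp.2.1])
        simp only [hGdef]
        linarith
      have h3 : b / ρ * ramp h ≤ α p * ramp (G p - c) :=
        mul_le_mul h1 h2 (ramp_nonneg _) (hα0 p)
      have := mul_le_mul_of_nonneg_left h3 (hS0 p (hsub (hDC hp)))
      linarith
    · exact mul_nonneg (hS0 p (hsub hp)) (mul_nonneg (hα0 p) (ramp_nonneg _))
  have hup : ∫ p in C, S p * (β p * ramp (G p - c)) ≤ (S (x₀, t₀) + e) * (4 * π) ^ (n / 2 : ℝ) := by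
    have hSe : 0 ≤ S (x₀, t₀) + e := by linarith [hS0 _ (hsub hp₀)]
    calc ∫ p in C, S p * (β p * ramp (G p - c))
        ≤ ∫ p in C, (S (x₀, t₀) + e) * (β p * G p) := by
          refine setIntegral_mono_on hIβ
            ((continuousOn_const.mul (hβc.mul hgC)).integrableOn_compact hCc) hCc.measurableSet
            fun p hp => ?_
          have hRHS : 0 ≤ (S (x₀, t₀) + e) * (β p * G p) :=
            mul_nonneg hSe (mul_nonneg (hβ0 p) gau_pos.le)
          rcases eq_or_lt_of_le (hβ0 p) with h0 | h0
          · rw [← h0]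
            simp
          rcases le_or_gt (G p) c with h1 | h1
          · rw [ramp_eq_zero (sub_nonpos.2 h1)]
            simpa using hRHS
          · have hs1 : t₀ - σ ≤ p.2 := by
              by_contra hcon
              refine h0.ne' ?_
              simp only [hβ]
              rw [density_eq_zero, zero_div]
              rw [abs_of_nonpos (div_nonpos_of_nonpos_of_nonneg (by linarith) (by positivity)),
                le_neg, div_le_iff₀ (by positivity)]
              linarith
            have hn : ‖p.1 - x₀‖ < d' := by
              by_contra hcon
              refine not_le.2 h1 ?_
              have hθ : 0 < t₀ + σ - p.2 := by linarith [hCT p hp]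
              exact (gau_anti hθ (by gcongr; exact not_lt.1 hcon)).trans
                (hsmall _ hθ (by linarith))
            have hdist : dist p (x₀, t₀) < d := by
              rw [Prod.dist_eq, max_lt_iff, dist_eq_norm, Real.dist_eq, abs_lt]
              refine ⟨hn.trans_le ((min_le_left _ _).trans (by linarith)), ?_, ?_⟩
              · simp only
                linarith
              · simp only
                linarith [hp.2.2]
            have hSp := (abs_lt.1 (hd p hp hdist)).2
            refine mul_le_mul (by linarith) (mul_le_mul_of_nonneg_left ?_ (hβ0 p))
              (mul_nonneg (hβ0 p) (ramp_nonneg _)) hSe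
            exact (ramp_le (by linarith)).trans (by linarith)
      _ = (S (x₀, t₀) + e) * ∫ p in C, β p * G p := integral_const_mul _ _
      _ ≤ _ := mul_le_mul_of_nonneg_left
          (integral_density_mul_gau_le x₀ (by linarith) (by positivity)) hSe
  linarith

local notation "τ₀" => Real.smoothTransition
local notation "τ₁" => deriv Real.smoothTransition
local notation "τ₂" => deriv (deriv Real.smoothTransition)

lemma hasDerivAt_deriv_smoothTransition (z : ℝ) : HasDerivAt τ₁ (τ₂ z) z := by
  have h := (contDiff_infty_iff_deriv.1 (Real.smoothTransition.contDiff (n := ⊤))).2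
  exact (h.differentiable (by simp) z).hasDerivAt

lemma continuous_deriv_deriv_smoothTransition : Continuous τ₂ := by
  have h := (contDiff_infty_iff_deriv.1 (Real.smoothTransition.contDiff (n := ⊤))).2
  exact (contDiff_infty_iff_deriv.1 h).2.continuous

lemma deriv_smoothTransition_eq_zero {z : ℝ} (hz : z < 0 ∨ 1 < z) : τ₁ z = 0 ∧ τ₂ z = 0 := by
  have h : ∃ c : ℝ, τ₀ =ᶠ[𝓝 z] fun _ => c := by
    rcases hz with hz | hz
    · refine ⟨0, ?_⟩
      filter_upwards [gt_mem_nhds hz] with y hy using Real.smoothTransition.zero_of_nonpos hy.le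
    · refine ⟨1, ?_⟩
      filter_upwards [lt_mem_nhds hz] with y hy using Real.smoothTransition.one_of_one_le hy.le
  obtain ⟨c, hc⟩ := h
  have h1 := hc.deriv
  have h2 := h1.deriv
  refine ⟨?_, ?_⟩
  · simpa using h1.eq_of_nhds
  · simpa using h2.eq_of_nhds

lemma exists_deriv_smoothTransition_le : ∃ B > 0, ∀ z, |τ₁ z| ≤ B ∧ |τ₂ z| ≤ B := by
  obtain ⟨B₁, hB₁⟩ := (isCompact_Icc (a := (0 : ℝ)) (b := 1)).exists_bound_of_continuousOn
    continuous_deriv_smoothTransition.continuousOn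
  obtain ⟨B₂, hB₂⟩ := (isCompact_Icc (a := (0 : ℝ)) (b := 1)).exists_bound_of_continuousOn
    continuous_deriv_deriv_smoothTransition.continuousOn
  refine ⟨max (max B₁ B₂) 1, by positivity, fun z => ?_⟩
  by_cases hz : z < 0 ∨ 1 < z
  · rw [(deriv_smoothTransition_eq_zero hz).1, (deriv_smoothTransition_eq_zero hz).2, abs_zero]
    exact ⟨by positivity, by positivity⟩
  · have hz' : z ∈ Set.Icc (0 : ℝ) 1 := ⟨by by_contra h; exact hz (.inl (not_le.1 h)),
      by by_contra h; exact hz (.inr (not_le.1 h))⟩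
    exact ⟨(hB₁ z hz').trans ((le_max_left _ _).trans (le_max_left _ _)),
      (hB₂ z hz').trans ((le_max_right _ _).trans (le_max_left _ _))⟩

/-- The backward heat operator on the cut-off Gaussian, with `χ(q) = τ₀ (2 - a q)`. -/
lemma exists_cutoff_gau_le (n : ℕ) {a : ℝ} (ha : 0 < a) : ∃ B > 0, ∀ q θ, 0 < θ → 0 ≤ q →
    |4 * q * (a ^ 2 * τ₂ (2 - a * q) * gau n q θ) + 2 * q * (a * τ₁ (2 - a * q) * (gau n q θ / θ))
      - 2 * n * (a * τ₁ (2 - a * q) * gau n q θ)| ≤ B := by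
  obtain ⟨B, hB0, hB⟩ := exists_deriv_smoothTransition_le
  have hB1 := gauBound_pos (n := n) (q := 1 / a)
  have hB2 := gauBound_pos (n := n + 2) (q := 1 / a)
  set B₁ := gauBound n (1 / a)
  set B₂ := gauBound (n + 2) (1 / a)
  refine ⟨4 * (2 / a) * (a ^ 2 * B * B₁) + 2 * (2 / a) * (a * B * B₂) + 2 * n * (a * B * B₁),
    by positivity, fun q θ hθ hq => ?_⟩
  by_cases hz : 2 - a * q < 0 ∨ 1 < 2 - a * q
  · rw [(deriv_smoothTransition_eq_zero hz).1, (deriv_smoothTransition_eq_zero hz).2]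
    simp only [mul_zero, zero_mul, add_zero, sub_zero, abs_zero]
    positivity
  · have h1 : q ≤ 2 / a := by
      rw [le_div_iff₀ ha]
      by_contra h
      exact hz (.inl (by linarith))
    have h2 : 1 / a ≤ q := by
      rw [div_le_iff₀ ha]
      by_contra h
      exact hz (.inr (by linarith))
    have h3 : gau n q θ ≤ B₁ := (gau_anti hθ h2).trans (gau_le_gauBound (by positivity) hθ)
    have h4 : gau n q θ / θ ≤ B₂ := by
      rw [gau_div hθ]
      exact (gau_anti hθ h2).trans (gau_le_gauBound (by positivity) hθ)
    have g0 := gau_pos (n := n) (q := q) (θ := θ)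
    have hτ1 := (hB (2 - a * q)).1
    have hτ2 := (hB (2 - a * q)).2
    refine (abs_sub _ _).trans (add_le_add ((abs_add_le _ _).trans (add_le_add ?_ ?_)) ?_)
    · simp only [abs_mul, abs_of_pos g0, abs_of_nonneg hq, abs_pow, abs_of_pos ha]
      rw [abs_of_pos (by norm_num : (0 : ℝ) < 4)]
      gcongr
    · rw [abs_mul, abs_mul, abs_mul, abs_mul, abs_of_pos (div_pos g0 hθ), abs_of_nonneg hq,
        abs_of_pos ha, abs_of_pos (by norm_num : (0 : ℝ) < 2)]
      gcongr
    · simp only [abs_mul, abs_of_pos g0, abs_of_pos ha]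
      rw [abs_of_pos (by norm_num : (0 : ℝ) < 2), Nat.abs_cast]
      gcongr

lemma gau_le_of_le {n : ℕ} {q θ θ₁ : ℝ} (hq : 0 ≤ q) (hθ₁ : 0 < θ₁) (hθ : θ₁ ≤ θ) :
    gau n q θ ≤ Real.exp (-(n / 2) * Real.log θ₁) := by
  rw [gau, Real.exp_le_exp]
  have h1 : Real.log θ₁ ≤ Real.log θ := Real.log_le_log hθ₁ hθ
  have h2 : 0 ≤ q / (4 * θ) := by
    have := hθ₁.trans_le hθ
    positivity
  have h3 : (n / 2 : ℝ) * Real.log θ₁ ≤ (n / 2) * Real.log θ := by gcongr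
  linarith

lemma setIntegral_scaled_density {s₂ ρ₂ : ℝ} (hρ : 0 < ρ₂) :
    ∫ s in Set.Icc (s₂ - ρ₂) (s₂ + ρ₂), density ((s - s₂) / ρ₂) / ρ₂ = 1 := by
  rw [setIntegral_eq_integral_of_forall_compl_eq_zero, integral_scaled_density hρ]
  intro s hs
  rw [density_eq_zero, zero_div]
  by_contra hcon
  rw [not_le, abs_div, abs_of_pos hρ, div_lt_one hρ, abs_lt] at hcon
  exact hs ⟨by linarith, by linarith⟩

/-- Local boundedness of nonnegative subsolutions by their space-time integral. -/
lemma exists_le_integral_of_isSubcal (n : ℕ) {r θ₀ : ℝ} (hr : 0 < r) (hθ₀ : 0 < θ₀) :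
    ∃ C > 0, ∀ (Q : Set (Euc n × ℝ)) (Z : Euc n × ℝ → ℝ) (x₁ : Euc n) (t₁ : ℝ),
      IsSubcal n Q Z → MeasurableSet Q → ContinuousOn Z Q → (∀ p ∈ Q, 0 ≤ Z p) →
      Metric.closedBall x₁ r ×ˢ Set.Icc (t₁ - θ₀) t₁ ⊆ Q →
      Z (x₁, t₁) ≤ C * ∫ p in Metric.closedBall x₁ r ×ˢ Set.Icc (t₁ - θ₀) t₁, Z p := by
  set a : ℝ := 4 / r ^ 2 with ha
  have ha0 : 0 < a := by positivity
  have har : a * r ^ 2 = 4 := by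
    rw [ha]
    field_simp
  obtain ⟨BL, hBL0, hBL⟩ := exists_cutoff_gau_le n ha0
  obtain ⟨Bd, hBd0, hBd⟩ := exists_density_le
  set B₃ : ℝ := Real.exp (-(n / 2) * Real.log (θ₀ / 2)) with hB₃
  set C₁ : ℝ := Bd / (θ₀ / 4) * B₃ + BL with hC₁
  have hC₁0 : 0 < C₁ := by positivity
  set v : ℝ := volume.real (Metric.ball (0 : Euc n) 1) with hv
  have hv0 : 0 < v := ENNReal.toReal_pos (Metric.measure_ball_pos _ _ one_pos).ne'
    measure_ball_lt_top.ne
  set c₀ : ℝ := Real.exp (-(n / 2) * Real.log 2 - 1 / 4) * v with hc₀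
  have hc₀0 : 0 < c₀ := by positivity
  refine ⟨C₁ / c₀, by positivity, fun Q Z x₁ t₁ hZ hQ hZc hZ0 hsub => ?_⟩
  set C : Set (Euc n × ℝ) := Metric.closedBall x₁ r ×ˢ Set.Icc (t₁ - θ₀) t₁ with hC
  have hCc : IsCompact C := (isCompact_closedBall _ _).prod isCompact_Icc
  have hp₁ : (x₁, t₁) ∈ C := ⟨Metric.mem_closedBall_self hr.le, by constructor <;> linarith⟩
  have hZC : ContinuousOn Z C := hZc.mono hsub
  have hI0 : 0 ≤ ∫ p in C, Z p := setIntegral_nonneg hCc.measurableSet fun p hp => hZ0 p (hsub hp)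
  refine le_of_forall_pos_le_add fun e he => ?_
  rcases le_or_gt (Z (x₁, t₁)) e with hle | hgt
  · have : 0 ≤ C₁ / c₀ * ∫ p in C, Z p := by positivity
    linarith
  obtain ⟨d, hd0, hd⟩ := Metric.continuousOn_iff.1 hZC _ hp₁ e he
  obtain ⟨σ, hσ0, hσ1, hσ2, hσ3, hσ4⟩ : ∃ σ > 0, σ ≤ d / 2 ∧ σ ≤ θ₀ / 2 ∧ √σ ≤ d / 2 ∧
      σ ≤ r ^ 2 / 4 := by
    refine ⟨min (min (d / 2) (θ₀ / 2)) (min ((d / 2) ^ 2) (r ^ 2 / 4)), by positivity,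
      (min_le_left _ _).trans (min_le_left _ _), (min_le_left _ _).trans (min_le_right _ _), ?_,
      (min_le_right _ _).trans (min_le_right _ _)⟩
    rw [Real.sqrt_le_left (by positivity)]
    exact (min_le_right _ _).trans (min_le_left _ _)
  have e0 : t₁ - σ / 2 + σ / 2 = t₁ := by ring
  have e0' : t₁ - 3 * θ₀ / 4 - θ₀ / 4 = t₁ - θ₀ := by ring
  have hchi : ∀ q : ℝ, HasDerivAt (fun q => τ₀ (2 - a * q)) (τ₁ (2 - a * q) * (-a)) q := fun q =>
    (hasDerivAt_smoothTransition _).comp q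
      ((((hasDerivAt_id q).const_mul a).const_sub 2).congr_deriv (by ring))
  have hchi' : ∀ q : ℝ, HasDerivAt (fun q => τ₁ (2 - a * q)) (τ₂ (2 - a * q) * (-a)) q := fun q =>
    (hasDerivAt_deriv_smoothTransition _).comp q
      ((((hasDerivAt_id q).const_mul a).const_sub 2).congr_deriv (by ring))
  have key := hZ.kernel_test hQ (x₀ := x₁) (T₁ := t₁ + σ) (s₁ := t₁ - 3 * θ₀ / 4) (ρ₁ := θ₀ / 4)
    (s₂ := t₁ - σ / 2) (ρ₂ := σ / 2) (r := r) (k := fun q θ => τ₀ (2 - a * q) * gau n q θ)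
    (kq := fun q θ => τ₁ (2 - a * q) * (-a) * gau n q θ +
      τ₀ (2 - a * q) * (-gau n q θ / (4 * θ)))
    (kqq := fun q θ => (τ₂ (2 - a * q) * (-a) * (-a) * gau n q θ +
        τ₁ (2 - a * q) * (-a) * (-gau n q θ / (4 * θ))) +
      (τ₁ (2 - a * q) * (-a) * (-gau n q θ / (4 * θ)) +
        τ₀ (2 - a * q) * (-(-gau n q θ / (4 * θ)) / (4 * θ))))
    (kt := fun q θ => τ₀ (2 - a * q) * (gau n q θ * (q / (4 * θ ^ 2) - n / (2 * θ))))
    (fun q θ hθ => (Real.smoothTransition.contDiff.comp (contDiff_const.sub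
      (contDiff_const.mul contDiff_fst))).contDiffAt.mul (contDiffAt_gau hθ))
    (fun q θ _ => mul_nonneg (Real.smoothTransition.nonneg _) gau_pos.le)
    (fun q θ hθ => (hchi q).mul hasDerivAt_gau_fst)
    (fun q θ hθ => (((hchi' q).mul_const (-a)).mul hasDerivAt_gau_fst).add
      ((hchi q).mul ((hasDerivAt_gau_fst.neg).div_const _)))
    (fun q θ hθ => (hasDerivAt_gau_snd hθ).const_mul _)
    (by positivity) (by positivity) (by linarith) (by linarith) hr.le (by rwa [e0, e0'])
    (fun q θ hq h1 h2 => by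
      rw [Real.smoothTransition.zero_of_nonpos, zero_mul]
      nlinarith)
  rw [e0, e0', ← hC] at key
  have hCT : ∀ p ∈ C, p.2 < t₁ + σ := fun p hp => by linarith [hp.2.2]
  have hgC := continuousOn_radial (continuousOn_gau (n := n)) x₁ hCT
  set G : Euc n × ℝ → ℝ := fun p => gau n (‖p.1 - x₁‖ ^ 2) (t₁ + σ - p.2) with hGdef
  set β : Euc n × ℝ → ℝ := fun p => density ((p.2 - (t₁ - σ / 2)) / (σ / 2)) / (σ / 2) with hβ
  set α : Euc n × ℝ → ℝ := fun p => density ((p.2 - (t₁ - 3 * θ₀ / 4)) / (θ₀ / 4)) / (θ₀ / 4)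
    with hα
  set w : Euc n × ℝ → ℝ := fun p =>
    window (t₁ - 3 * θ₀ / 4) (θ₀ / 4) (t₁ - σ / 2) (σ / 2) p.2 with hw
  set X : Euc n × ℝ → ℝ := fun p => τ₀ (2 - a * ‖p.1 - x₁‖ ^ 2) with hX
  have hβc : ContinuousOn β C :=
    (continuous_scaled_density.comp continuous_snd).continuousOn
  have hαc : ContinuousOn α C :=
    (continuous_scaled_density.comp continuous_snd).continuousOn
  have hwc : ContinuousOn w C := (contDiff_window.continuous.comp continuous_snd).continuousOn
  have hZi : IntegrableOn Z C := hZC.integrableOn_compact hCc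
  have hqc : ContinuousOn (fun p : Euc n × ℝ => ‖p.1 - x₁‖ ^ 2) C :=
    Continuous.continuousOn (by fun_prop)
  have hzc : ContinuousOn (fun p : Euc n × ℝ => 2 - a * ‖p.1 - x₁‖ ^ 2) C :=
    Continuous.continuousOn (by fun_prop)
  have hXc : ContinuousOn X C := Real.smoothTransition.continuous.comp_continuousOn hzc
  have hIβ : IntegrableOn (fun p => Z p * (β p * (X p * G p))) C :=
    (hZC.mul (hβc.mul (hXc.mul hgC))).integrableOn_compact hCc
  have hβ0 : ∀ p, 0 ≤ β p := fun p => scaled_density_nonneg (by positivity)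
  have hα0 : ∀ p, 0 ≤ α p := fun p => scaled_density_nonneg (by positivity)
  have hdiff : ∫ p in C, (Z p * (β p * (X p * G p)) - C₁ * Z p) ≤ 0 := by
    refine le_trans (setIntegral_mono_on (hIβ.sub (hZi.const_mul C₁)) ?_ hCc.measurableSet
      fun p hp => ?_) key
    · refine ContinuousOn.integrableOn_compact hCc ?_
      have hθc : ContinuousOn (fun p : Euc n × ℝ => t₁ + σ - p.2) C :=
        Continuous.continuousOn (by fun_prop)
      have hθ0 : ∀ p ∈ C, t₁ + σ - p.2 ≠ 0 := fun p hp => by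
        have := hCT p hp
        intro h
        linarith
      have hG1 : ContinuousOn (fun p => -G p / (4 * (t₁ + σ - p.2))) C :=
        hgC.neg.div (continuousOn_const.mul hθc) fun p hp =>
          mul_ne_zero (by norm_num) (hθ0 p hp)
      have hG2 : ContinuousOn (fun p => -(-G p / (4 * (t₁ + σ - p.2))) / (4 * (t₁ + σ - p.2))) C :=
        hG1.neg.div (continuousOn_const.mul hθc) fun p hp =>
          mul_ne_zero (by norm_num) (hθ0 p hp)
      have hX1 : ContinuousOn (fun p : Euc n × ℝ => τ₁ (2 - a * ‖p.1 - x₁‖ ^ 2) * (-a)) C :=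
        (continuous_deriv_smoothTransition.comp_continuousOn hzc).mul continuousOn_const
      have hX2 : ContinuousOn
          (fun p : Euc n × ℝ => τ₂ (2 - a * ‖p.1 - x₁‖ ^ 2) * (-a) * (-a)) C :=
        ((continuous_deriv_deriv_smoothTransition.comp_continuousOn hzc).mul
          continuousOn_const).mul continuousOn_const
      have hGt : ContinuousOn (fun p => G p * (‖p.1 - x₁‖ ^ 2 / (4 * (t₁ + σ - p.2) ^ 2)
          - n / (2 * (t₁ + σ - p.2)))) C := by
        refine hgC.mul ((hqc.div (continuousOn_const.mul (hθc.pow 2)) fun p hp => ?_).sub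
          (continuousOn_const.div (continuousOn_const.mul hθc) fun p hp => ?_))
        · exact mul_ne_zero (by norm_num) (pow_ne_zero _ (hθ0 p hp))
        · exact mul_ne_zero (by norm_num) (hθ0 p hp)
      exact hZC.mul (((hβc.sub hαc).mul (hXc.mul hgC)).sub (hwc.mul
        ((((continuousOn_const.mul hqc).mul (((hX2.mul hgC).add (hX1.mul hG1)).add
          ((hX1.mul hG1).add (hXc.mul hG2)))).add
          (continuousOn_const.mul ((hX1.mul hgC).add (hXc.mul hG1)))).sub (hXc.mul hGt))))
    · have hθ : 0 < t₁ + σ - p.2 := by linarith [hCT p hp]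
      have hw01 := window_mem (by positivity : 0 < θ₀ / 4) (by positivity : 0 < σ / 2)
        (by linarith : t₁ - 3 * θ₀ / 4 + θ₀ / 4 ≤ t₁ - σ / 2 - σ / 2) p.2
      have hL0 := hBL (‖p.1 - x₁‖ ^ 2) (t₁ + σ - p.2) hθ (by positivity)
      have hXG : X p * G p ≤ gau n (‖p.1 - x₁‖ ^ 2) (t₁ + σ - p.2) := by
        have := Real.smoothTransition.le_one (2 - a * ‖p.1 - x₁‖ ^ 2)
        exact mul_le_of_le_one_left gau_pos.le this
      have hαk : α p * (X p * G p) ≤ Bd / (θ₀ / 4) * B₃ := by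
        rcases eq_or_lt_of_le (hα0 p) with h0 | h0
        · rw [← h0, zero_mul]
          positivity
        · have hs1 : p.2 ≤ t₁ - θ₀ / 2 := by
            by_contra hcon
            refine h0.ne' ?_
            simp only [hα]
            rw [density_eq_zero, zero_div]
            rw [abs_of_nonneg (div_nonneg (by linarith) (by positivity)),
              le_div_iff₀ (by positivity)]
            linarith
          have h1 : X p * G p ≤ B₃ :=
            hXG.trans (gau_le_of_le (by positivity) (by positivity) (by linarith))
          have h2 : α p ≤ Bd / (θ₀ / 4) := div_le_div_of_nonneg_right (hBd _) (by positivity)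
          exact mul_le_mul h2 h1
            (mul_nonneg (Real.smoothTransition.nonneg _) gau_pos.le) (by positivity)
      have e1 : ∀ L L' : ℝ, L = L' → |L'| ≤ BL →
          Z p * (β p * (X p * G p)) - C₁ * Z p ≤
            Z p * ((β p - α p) * (X p * G p) - w p * L) := by
        rintro L _ rfl h
        have h3 : w p * L ≤ BL := by
          have h4 : |w p * L| ≤ 1 * BL := by
            rw [abs_mul]
            exact mul_le_mul (abs_le.2 ⟨by linarith [hw01.1], hw01.2⟩) h (abs_nonneg _) zero_le_one
          linarith [le_abs_self (w p * L)]
        have h5 : α p * (X p * G p) + w p * L ≤ C₁ := add_le_add hαk h3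
        have := mul_le_mul_of_nonneg_left h5 (hZ0 p (hsub hp))
        linarith
      refine e1 _ _ ?_ hL0
      field_simp
      ring
  rw [integral_sub hIβ (hZi.const_mul C₁), integral_const_mul] at hdiff
  have hlow : (Z (x₁, t₁) - e) * c₀ ≤ ∫ p in C, Z p * (β p * (X p * G p)) := by
    set D : Set (Euc n × ℝ) := Metric.closedBall x₁ √σ ×ˢ Set.Icc (t₁ - σ) t₁ with hD
    have hσr : √σ ≤ r := by
      rw [Real.sqrt_le_left hr.le]
      nlinarith
    have hDC : D ⊆ C := Set.prod_mono (Metric.closedBall_subset_closedBall hσr)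
      (Set.Icc_subset_Icc (by linarith) le_rfl)
    have hDc : IsCompact D := (isCompact_closedBall _ _).prod isCompact_Icc
    set g₀ : ℝ := Real.exp (-(n / 2) * Real.log (2 * σ) - 1 / 4) with hg₀
    have hDβ : ∫ p in D, β p = volume.real (Metric.closedBall x₁ √σ) := by
      have h := setIntegral_prod_mul (μ := volume) (ν := volume) (fun _ : Euc n => (1 : ℝ))
        (fun s : ℝ => density ((s - (t₁ - σ / 2)) / (σ / 2)) / (σ / 2))
        (Metric.closedBall x₁ √σ) (Set.Icc (t₁ - σ / 2 - σ / 2) (t₁ - σ / 2 + σ / 2))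
      rw [setIntegral_scaled_density (by positivity), ← Measure.volume_eq_prod, e0,
        show t₁ - σ / 2 - σ / 2 = t₁ - σ by ring] at h
      simpa using h
    have hvol : volume.real (Metric.closedBall x₁ √σ) = √σ ^ n * v := by
      rw [Measure.addHaar_real_closedBall _ _ (Real.sqrt_nonneg _), finrank_euclideanSpace,
        Fintype.card_fin]
    have hc : g₀ * (√σ ^ n * v) = c₀ := by
      have h1 : √σ ^ n = Real.exp ((n / 2) * Real.log σ) := by
        rw [← Real.exp_log (Real.sqrt_pos.2 hσ0), ← Real.exp_nat_mul, Real.log_sqrt hσ0.le]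
        congr 1
        ring
      rw [h1, ← mul_assoc, hg₀, ← Real.exp_add, hc₀, Real.log_mul two_ne_zero hσ0.ne']
      congr 2
      ring
    have hge : ∀ p ∈ D, (Z (x₁, t₁) - e) * (g₀ * β p) ≤ Z p * (β p * (X p * G p)) := by
      intro p hp
      have hn : ‖p.1 - x₁‖ ≤ √σ := by
        rw [← dist_eq_norm]
        exact hp.1
      have hq : ‖p.1 - x₁‖ ^ 2 ≤ σ := by
        calc ‖p.1 - x₁‖ ^ 2 ≤ √σ ^ 2 := by gcongr
          _ = σ := Real.sq_sqrt hσ0.le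
      have hdist : dist p (x₁, t₁) < d := by
        rw [Prod.dist_eq, max_lt_iff, dist_eq_norm, Real.dist_eq, abs_lt]
        refine ⟨by simp only; linarith, by simp only; linarith [hp.2.1],
          by simp only; linarith [hp.2.2]⟩
      have hZp := (abs_lt.1 (hd p (hDC hp) hdist)).1
      have hX1 : X p = 1 := Real.smoothTransition.one_of_one_le (by nlinarith)
      have hGp : g₀ ≤ G p := by
        have hθ : 0 < t₁ + σ - p.2 := by linarith [hp.2.2]
        rw [hg₀, hGdef]
        simp only
        rw [gau, Real.exp_le_exp]
        have h1 : Real.log (t₁ + σ - p.2) ≤ Real.log (2 * σ) :=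
          Real.log_le_log hθ (by linarith [hp.2.1])
        have h2 : (n / 2 : ℝ) * Real.log (t₁ + σ - p.2) ≤ (n / 2) * Real.log (2 * σ) := by gcongr
        have h3 : ‖p.1 - x₁‖ ^ 2 / (4 * (t₁ + σ - p.2)) ≤ 1 / 4 := by
          rw [div_le_div_iff₀ (by positivity) (by norm_num)]
          linarith [hp.2.2]
        linarith
      rw [hX1, one_mul]
      have h4 : g₀ * β p ≤ β p * G p := by
        rw [mul_comm]
        exact mul_le_mul_of_nonneg_left hGp (hβ0 p)
      exact mul_le_mul (by linarith) h4 (mul_nonneg (Real.exp_pos _).le (hβ0 p))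
        (hZ0 p (hsub (hDC hp)))
    calc (Z (x₁, t₁) - e) * c₀ = ∫ p in D, (Z (x₁, t₁) - e) * (g₀ * β p) := by
          rw [integral_const_mul, integral_const_mul, hDβ, hvol, hc]
      _ ≤ ∫ p in D, Z p * (β p * (X p * G p)) :=
          setIntegral_mono_on ((((hβc.mono hDC).integrableOn_compact hDc).const_mul _).const_mul _)
            (hIβ.mono_set hDC) hDc.measurableSet hge
      _ ≤ _ := setIntegral_mono_set hIβ ((ae_restrict_iff' hCc.measurableSet).2
          (.of_forall fun p hp => mul_nonneg (hZ0 p (hsub hp)) (mul_nonneg (hβ0 p)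
            (mul_nonneg (Real.smoothTransition.nonneg _) gau_pos.le)))) hDC.eventuallyLE
  have h6 : (Z (x₁, t₁) - e) * c₀ ≤ C₁ * ∫ p in C, Z p := by linarith
  rw [← le_div_iff₀ hc₀0] at h6
  rw [div_mul_eq_mul_div]
  linarith

/-- Nonnegative continuous supersolutions of the heat equation, in the sense of distributions. -/
structure IsSuper (n : ℕ) (Q : Set (Euc n × ℝ)) (S : Euc n × ℝ → ℝ) : Prop where
  cont : ContinuousOn S Q
  nonneg : ∀ p ∈ Q, 0 ≤ S p
  super : IsSubcal n Q fun p => -S p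

/-- Values of nonnegative supersolutions near `p` control their integral over `E`. -/
def Controls (n : ℕ) (Q : Set (Euc n × ℝ)) (p : Euc n × ℝ) (E : Set (Euc n × ℝ)) : Prop :=
  ∃ ρ > 0, ∃ C ≥ 0, ∀ S, IsSuper n Q S → ∀ p' ∈ Q, dist p' p < ρ →
    ∫⁻ z in E, ENNReal.ofReal (S z) ≤ ENNReal.ofReal (C * S p')

section Chain
variable {n : ℕ} {Q E E' : Set (Euc n × ℝ)} {p q w : Euc n × ℝ}

lemma Controls.mono (h : Controls n Q p E') (hE : E ⊆ E') : Controls n Q p E := by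
  obtain ⟨ρ, hρ, C, hC, H⟩ := h
  exact ⟨ρ, hρ, C, hC, fun S hS p' hp' hd => (lintegral_mono_set hE).trans (H S hS p' hp' hd)⟩

lemma Controls.union (h : Controls n Q p E) (h' : Controls n Q p E') :
    Controls n Q p (E ∪ E') := by
  obtain ⟨ρ, hρ, C, hC, H⟩ := h
  obtain ⟨ρ', hρ', C', hC', H'⟩ := h'
  refine ⟨min ρ ρ', lt_min hρ hρ', C + C', add_nonneg hC hC', fun S hS p' hp' hd => ?_⟩
  have h0 := hS.nonneg p' hp'
  rw [add_mul, ENNReal.ofReal_add (mul_nonneg hC h0) (mul_nonneg hC' h0)]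
  exact (lintegral_union_le _ _ _).trans (add_le_add
    (H S hS p' hp' (hd.trans_le (min_le_left _ _)))
    (H' S hS p' hp' (hd.trans_le (min_le_right _ _))))

lemma Controls.trans (hQ : IsOpen Q) (hq : q ∈ Q) (h : Controls n Q p E) (hE : E ∈ 𝓝 q)
    (h' : Controls n Q q E') : Controls n Q p E' := by
  obtain ⟨ρ, hρ, C, hC, H⟩ := h
  obtain ⟨ρ', hρ', C', hC', H'⟩ := h'
  obtain ⟨r, hr, hball⟩ := Metric.mem_nhds_iff.1 (inter_mem hE (hQ.mem_nhds hq))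
  set B := Metric.ball q (min r ρ') with hB
  have hBsub : B ⊆ E ∩ Q := (Metric.ball_subset_ball (min_le_left _ _)).trans hball
  have hB0 : volume B ≠ 0 := (Metric.measure_ball_pos _ _ (lt_min hr hρ')).ne'
  have hBt : volume B ≠ ⊤ := measure_ball_lt_top.ne
  set m := (volume B).toReal with hm
  have hm0 : 0 < m := ENNReal.toReal_pos hB0 hBt
  refine ⟨ρ, hρ, C' * C / m, by positivity, fun S hS p' hp' hd => ?_⟩
  have h0 := hS.nonneg p' hp'
  have key : volume B * ∫⁻ z in E', ENNReal.ofReal (S z) ≤ ENNReal.ofReal (C' * (C * S p')) := by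
    calc volume B * ∫⁻ z in E', ENNReal.ofReal (S z)
        = ∫⁻ _ in B, (∫⁻ z in E', ENNReal.ofReal (S z)) := by
          rw [setLIntegral_const, mul_comm]
      _ ≤ ∫⁻ q' in B, ENNReal.ofReal C' * ENNReal.ofReal (S q') := by
          refine setLIntegral_mono' Metric.isOpen_ball.measurableSet fun q' hq' => ?_
          rw [← ENNReal.ofReal_mul hC']
          exact H' S hS q' (hBsub hq').2 (lt_of_lt_of_le hq' (min_le_right _ _))
      _ = ENNReal.ofReal C' * ∫⁻ q' in B, ENNReal.ofReal (S q') :=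
          lintegral_const_mul' _ _ ENNReal.ofReal_ne_top
      _ ≤ ENNReal.ofReal C' * ENNReal.ofReal (C * S p') := by
          gcongr
          exact (lintegral_mono_set fun z hz => (hBsub hz).1).trans (H S hS p' hp' hd)
      _ = _ := (ENNReal.ofReal_mul hC').symm
  rw [show C' * C / m * S p' = C' * (C * S p') / m by ring, ENNReal.ofReal_div_of_pos hm0,
    ENNReal.ofReal_toReal hBt, ENNReal.le_div_iff_mul_le (.inl hB0) (.inl hBt), mul_comm]
  exact key

/-- One step of the Harnack chain. -/
lemma controls_step {Ω : Set (Euc n)} {T : ℝ} (hΩ : IsOpen Ω) {x : Euc n} {r : ℝ} (hr : 0 < r)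
    (hball : Metric.ball x (2 * r) ⊆ Ω) : ∃ Δ₀ > 0, ∀ y ∈ Metric.ball x (r / 16),
      ∀ z ∈ Metric.ball x (r / 16), ∀ s t, 0 < s → s < t → t ≤ T → t - s ≤ Δ₀ →
      ∃ E ∈ 𝓝 (z, s), Controls n (Ω ×ˢ Set.Ioo 0 T) (y, t) E := by
  obtain ⟨Δ₀, hΔ₀, HΔ⟩ := exists_lag (n := n) hr
  obtain ⟨b, hb0, hb⟩ := exists_density_ge
  refine ⟨Δ₀, hΔ₀, fun y hy z hz s t hs hst htT hle => ?_⟩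
  set Δ := t - s with hΔ
  have hΔ0 : 0 < Δ := by linarith
  obtain ⟨c, hc0, h, hh, hc, hm⟩ := HΔ Δ hΔ0 hle
  set ρ := min (Δ / 8) (min (r / 16) (s / 4)) with hρ
  have hρ0 : 0 < ρ := by positivity
  have hρ1 : ρ ≤ Δ / 8 := min_le_left _ _
  have hρ2 : ρ ≤ r / 16 := (min_le_right _ _).trans (min_le_left _ _)
  have hρ3 : ρ ≤ s / 4 := (min_le_right _ _).trans (min_le_right _ _)
  have hG : 0 < (4 * π) ^ (n / 2 : ℝ) := Real.rpow_pos_of_pos (by positivity) _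
  have hm0 : 0 < b / (2 * ρ) * ramp h := mul_pos (by positivity) (ramp_pos hh)
  refine ⟨Metric.closedBall (z, s) ρ, Metric.closedBall_mem_nhds _ hρ0, ρ, hρ0,
    (4 * π) ^ (n / 2 : ℝ) / (b / (2 * ρ) * ramp h), by positivity, fun S hS p' hp' hd => ?_⟩
  obtain ⟨x₀, t₀⟩ := p'
  rw [Prod.dist_eq, max_lt_iff, Real.dist_eq, abs_lt] at hd
  simp only at hd
  obtain ⟨hd1, hd2, hd3⟩ := hd
  rw [Metric.mem_ball] at hy hz
  have hxx : dist x₀ x < r / 8 := by linarith [dist_triangle x₀ y x]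
  have hsubΩ : Metric.closedBall x₀ r ⊆ Ω := fun v hv => hball (by
    rw [Metric.mem_closedBall] at hv
    rw [Metric.mem_ball]
    linarith [dist_triangle v x₀ x])
  have hsub : Metric.closedBall x₀ r ×ˢ Set.Icc (s - 2 * ρ) t₀ ⊆ Ω ×ˢ Set.Ioo 0 T :=
    Set.prod_mono hsubΩ fun v hv => ⟨by linarith [hv.1], lt_of_le_of_lt hv.2 hp'.2.2⟩
  have key := hS.super.integral_le_of_neg (hΩ.prod isOpen_Ioo).measurableSet hS.cont hS.nonneg
    (x₀ := x₀) (t₀ := t₀) (r := r) (r₁ := r / 4) (s₁ := s) (ρ := 2 * ρ) (Θ := 2 * Δ) (c := c)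
    (h := h) (b := b) hr (by linarith) (by positivity) (by linarith) (by linarith) hc0 hc
    (fun q θ hq h1 h2 => hm q θ (by linarith) (by linarith) h2) hsub hb
  rw [show 2 * ρ / 2 = ρ by ring] at key
  set D : Set (Euc n × ℝ) := Metric.closedBall x₀ (r / 4) ×ˢ Set.Icc (s - ρ) (s + ρ) with hD
  have hDc : IsCompact D := (isCompact_closedBall _ _).prod isCompact_Icc
  have hDQ : D ⊆ Ω ×ˢ Set.Ioo 0 T := (Set.prod_mono (Metric.closedBall_subset_closedBall
    (by linarith)) (Set.Icc_subset_Icc (by linarith) (by linarith))).trans hsub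
  have hsubD : Metric.closedBall (z, s) ρ ⊆ D := by
    rw [← closedBall_prod_same, Real.closedBall_eq_Icc]
    refine Set.prod_mono (Metric.closedBall_subset_closedBall' ?_) subset_rfl
    have := dist_triangle z x x₀
    rw [dist_comm x x₀] at this
    linarith
  have hint : IntegrableOn S D := (hS.cont.mono hDQ).integrableOn_compact hDc
  calc ∫⁻ v in Metric.closedBall (z, s) ρ, ENNReal.ofReal (S v)
      ≤ ∫⁻ v in D, ENNReal.ofReal (S v) := lintegral_mono_set hsubD
    _ = ENNReal.ofReal (∫ v in D, S v) := (ofReal_integral_eq_lintegral_ofReal hint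
        ((ae_restrict_iff' hDc.measurableSet).2 (.of_forall fun v hv =>
          hS.nonneg v (hDQ hv)))).symm
    _ ≤ _ := ENNReal.ofReal_le_ofReal (by
        rw [div_mul_eq_mul_div, le_div_iff₀ hm0]
        linarith)

/-- All supersolution values at a point control those at all earlier times. -/
def Precedes (n : ℕ) (Ω : Set (Euc n)) (T : ℝ) (y z : Euc n) : Prop :=
  ∀ s t, 0 < s → s < t → t ≤ T → ∃ E ∈ 𝓝 (z, s), Controls n (Ω ×ˢ Set.Ioo 0 T) (y, t) E

lemma Precedes.trans {Ω : Set (Euc n)} {T : ℝ} (hΩ : IsOpen Ω) {x y z : Euc n} (hy : y ∈ Ω)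
    (h : Precedes n Ω T x y) (h' : Precedes n Ω T y z) : Precedes n Ω T x z := by
  intro s t hs hst htT
  obtain ⟨E, hE, HE⟩ := h ((s + t) / 2) t (by linarith) (by linarith) htT
  obtain ⟨E', hE', HE'⟩ := h' s ((s + t) / 2) hs (by linarith) (by linarith)
  exact ⟨E', hE', HE.trans (hΩ.prod isOpen_Ioo) ⟨hy, by constructor <;> linarith⟩ hE HE'⟩

lemma precedes_of_near {Ω : Set (Euc n)} {T : ℝ} (hΩ : IsOpen Ω) {x : Euc n} {r : ℝ} (hr : 0 < r)
    (hball : Metric.ball x (2 * r) ⊆ Ω) {y z : Euc n} (hy : y ∈ Metric.ball x (r / 16))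
    (hz : z ∈ Metric.ball x (r / 16)) : Precedes n Ω T y z := by
  obtain ⟨Δ₀, hΔ₀, H⟩ := controls_step (T := T) hΩ hr hball
  have hyΩ : y ∈ Ω := hball (Metric.ball_subset_ball (by linarith) hy)
  have step : ∀ N : ℕ, ∀ s t, 0 < s → s < t → t ≤ T → t - s ≤ (N + 1) * Δ₀ →
      ∃ E ∈ 𝓝 (z, s), Controls n (Ω ×ˢ Set.Ioo 0 T) (y, t) E := by
    intro N
    induction N with
    | zero =>
      intro s t hs hst htT hle
      exact H y hy z hz s t hs hst htT (by simpa using hle)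
    | succ N ih =>
      intro s t hs hst htT hle
      push_cast at hle
      set t' := t - (t - s) / (N + 2) with ht'
      have hN : (0 : ℝ) < N + 2 := by positivity
      have h1 : 0 < (t - s) / (N + 2) := div_pos (by linarith) hN
      have h2 : (t - s) / (N + 2) < t - s := by
        rw [div_lt_iff₀ hN]
        have : (0 : ℝ) ≤ N := by positivity
        nlinarith
      have h3 : (t - s) / (N + 2) ≤ Δ₀ := by
        rw [div_le_iff₀ hN]
        linarith
      have h4 : t' - s ≤ (N + 1) * Δ₀ := by
        have : t - s = (N + 2) * ((t - s) / (N + 2)) := by field_simp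
        nlinarith
      obtain ⟨E, hE, HE⟩ := H y hy y hy t' t (by linarith) (by linarith) htT (by linarith)
      obtain ⟨E', hE', HE'⟩ := ih s t' hs (by linarith) (by linarith) h4
      exact ⟨E', hE', HE.trans (hΩ.prod isOpen_Ioo) ⟨hyΩ, by constructor <;> linarith⟩ hE HE'⟩
  intro s t hs hst htT
  obtain ⟨N, hN⟩ := exists_nat_ge ((t - s) / Δ₀)
  rw [div_le_iff₀ hΔ₀] at hN
  exact step N s t hs hst htT (by nlinarith)

lemma precedes {Ω : Set (Euc n)} {T : ℝ} (hΩ : IsOpen Ω) (hconn : IsPreconnected Ω)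
    {y z : Euc n} (hy : y ∈ Ω) (hz : z ∈ Ω) : Precedes n Ω T y z := by
  refine hconn.induction₂' (Precedes n Ω T) (fun x hx => ?_)
    (fun x y z hx hy hz h h' => h.trans hΩ hy h') hy hz
  obtain ⟨r, hr, hball⟩ := Metric.isOpen_iff.1 hΩ x hx
  have hb : Metric.ball x (2 * (r / 2)) ⊆ Ω := by rwa [mul_div_cancel₀ _ two_ne_zero]
  have hxr : x ∈ Metric.ball x (r / 2 / 16) := Metric.mem_ball_self (by positivity)
  filter_upwards [mem_nhdsWithin_of_mem_nhds (Metric.ball_mem_nhds x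
    (by positivity : 0 < r / 2 / 16))] with v hv
  exact ⟨precedes_of_near hΩ (by positivity) hb hxr hv,
    precedes_of_near hΩ (by positivity) hb hv hxr⟩

/-- Weak Harnack inequality from the top of the cylinder. -/
lemma exists_integral_le_top {Ω K : Set (Euc n)} {T : ℝ} (hΩ : IsOpen Ω)
    (hconn : IsPreconnected Ω) (hT : 0 < T) (hK : IsCompact K) (hKΩ : K ⊆ Ω) (hE : IsCompact E)
    (hEQ : E ⊆ Ω ×ˢ Set.Ioo 0 T) : ∃ C ≥ 0, ∀ S, IsSuper n (Ω ×ˢ Set.Ioo 0 T) S →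
      ContinuousOn S (Ω ×ˢ Set.Ioc 0 T) → ∀ x ∈ K, ∫ z in E, S z ≤ C * S (x, T) := by
  have h1 : ∀ x ∈ Ω, Controls n (Ω ×ˢ Set.Ioo 0 T) (x, T) E := by
    intro x hx
    refine hE.induction_on (p := Controls n (Ω ×ˢ Set.Ioo 0 T) (x, T))
      ⟨1, one_pos, 0, le_rfl, fun S _ p' _ _ => by simp⟩ (fun s t hst h => h.mono hst)
      (fun s t h h' => h.union h') fun q hq => ?_
    obtain ⟨E', hE', H⟩ := precedes hΩ hconn hx (hEQ hq).1 q.2 T (hEQ hq).2.1 (hEQ hq).2.2 le_rfl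
    exact ⟨E', mem_nhdsWithin_of_mem_nhds hE', H⟩
  have h2 : ∃ C ≥ 0, ∀ S, IsSuper n (Ω ×ˢ Set.Ioo 0 T) S → ∀ x ∈ K,
      ∀ᶠ p' in 𝓝[Ω ×ˢ Set.Ioo 0 T] (x, T),
        ∫⁻ z in E, ENNReal.ofReal (S z) ≤ ENNReal.ofReal (C * S p') := by
    refine hK.induction_on (p := fun A => ∃ C ≥ 0, ∀ S, IsSuper n (Ω ×ˢ Set.Ioo 0 T) S → ∀ x ∈ A,
      ∀ᶠ p' in 𝓝[Ω ×ˢ Set.Ioo 0 T] (x, T),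
        ∫⁻ z in E, ENNReal.ofReal (S z) ≤ ENNReal.ofReal (C * S p')) ⟨0, le_rfl, by simp⟩ ?_ ?_ ?_
    · rintro s t hst ⟨C, hC, H⟩
      exact ⟨C, hC, fun S hS x hx => H S hS x (hst hx)⟩
    · rintro s t ⟨C, hC, H⟩ ⟨C', hC', H'⟩
      refine ⟨C + C', add_nonneg hC hC', fun S hS x hx => ?_⟩
      rcases hx with hx | hx
      · filter_upwards [H S hS x hx, self_mem_nhdsWithin] with p' hp' hQ'
        refine hp'.trans (ENNReal.ofReal_le_ofReal ?_)
        nlinarith [mul_nonneg hC' (hS.nonneg p' hQ')]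
      · filter_upwards [H' S hS x hx, self_mem_nhdsWithin] with p' hp' hQ'
        refine hp'.trans (ENNReal.ofReal_le_ofReal ?_)
        nlinarith [mul_nonneg hC (hS.nonneg p' hQ')]
    · intro x hx
      obtain ⟨ρ, hρ, C, hC, H⟩ := h1 x (hKΩ hx)
      refine ⟨Metric.ball x ρ, mem_nhdsWithin_of_mem_nhds (Metric.ball_mem_nhds x hρ), C, hC,
        fun S hS y hy => ?_⟩
      have hyT : (y, T) ∈ Metric.ball (x, T) ρ := by
        rw [Metric.mem_ball, Prod.dist_eq, dist_self, max_lt_iff]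
        exact ⟨hy, hρ⟩
      filter_upwards [mem_nhdsWithin_of_mem_nhds (Metric.isOpen_ball.mem_nhds hyT),
        self_mem_nhdsWithin] with p' hp' hQ' using H S hS p' hQ' hp'
  obtain ⟨C, hC, H⟩ := h2
  refine ⟨C, hC, fun S hS hSc x hx => ?_⟩
  have hne : (𝓝[Ω ×ˢ Set.Ioo 0 T] (x, T)).NeBot := by
    rw [← mem_closure_iff_nhdsWithin_neBot, closure_prod_eq, closure_Ioo hT.ne]
    exact ⟨subset_closure (hKΩ hx), hT.le, le_rfl⟩
  have hlim : Tendsto S (𝓝[Ω ×ˢ Set.Ioo 0 T] (x, T)) (𝓝 (S (x, T))) :=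
    (hSc (x, T) ⟨hKΩ hx, hT, le_rfl⟩).mono (Set.prod_mono subset_rfl Set.Ioo_subset_Ioc_self)
  have hS0 : 0 ≤ S (x, T) := ge_of_tendsto hlim
    (by filter_upwards [self_mem_nhdsWithin] with p' hp' using hS.nonneg p' hp')
  have h3 : ∫⁻ z in E, ENNReal.ofReal (S z) ≤ ENNReal.ofReal (C * S (x, T)) :=
    ge_of_tendsto ((ENNReal.continuous_ofReal.tendsto _).comp (hlim.const_mul C)) (H S hS x hx)
  rw [← ofReal_integral_eq_lintegral_ofReal ((hS.cont.mono hEQ).integrableOn_compact hE)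
    ((ae_restrict_iff' hE.measurableSet).2 (.of_forall fun v hv => hS.nonneg v (hEQ hv))),
    ENNReal.ofReal_le_ofReal_iff (mul_nonneg hC hS0)] at h3
  exact h3

end Chain

section Stability

lemma sq_le_six_mul_sqrt {v : ℝ} (h0 : 0 ≤ v) (h3 : v ≤ 3) : v ^ 2 ≤ 6 * √v := by
  have hw := Real.sqrt_nonneg v
  have hv := Real.sq_sqrt h0
  have h2 : √v ≤ 2 := by
    rw [Real.sqrt_le_left (by norm_num)]
    linarith
  have : v ^ 2 = v * √v * √v := by rw [mul_assoc, Real.mul_self_sqrt h0, sq]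
  rw [this]
  nlinarith [mul_nonneg h0 hw, mul_le_mul h3 h2 hw (by norm_num : (0:ℝ) ≤ 3)]

/-- An integral over a piece of the cylinder is split into a part at positive distance from the
top, controlled by `S`, and a thin layer below the top. -/
lemma setIntegral_le_of_top_layer {n : ℕ} {L : Set (Euc n)} {B : Set (Euc n × ℝ)} {T τ s c k : ℝ}
    {Z S : Euc n × ℝ → ℝ} (hL : IsCompact L) (hB : IsCompact B) (hs : 0 ≤ s) (hk : 0 ≤ k)
    (hc : 0 ≤ c) (hBL : B ⊆ L ×ˢ Set.Icc τ T) (hZ : ContinuousOn Z B)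
    (hS : ContinuousOn S (L ×ˢ Set.Icc τ (T - s))) (hS0 : ∀ p ∈ L ×ˢ Set.Icc τ (T - s), 0 ≤ S p)
    (hZ0 : ∀ p ∈ B, 0 ≤ Z p) (hZk : ∀ p ∈ B, Z p ≤ k) (hZS : ∀ p ∈ B, Z p ≤ c * S p) :
    ∫ p in B, Z p ≤ c * (∫ p in L ×ˢ Set.Icc τ (T - s), S p) + k * (volume.real L * s) := by
  have hE : IsCompact (L ×ˢ Set.Icc τ (T - s)) := hL.prod isCompact_Icc
  set E := L ×ˢ Set.Icc τ (T - s)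
  have hSE : IntegrableOn S E := hS.integrableOn_compact hE
  have hcS : IntegrableOn (fun p => c * S p) E := hSE.const_mul c
  have hZB : IntegrableOn Z B := hZ.integrableOn_compact hB
  rw [← integral_inter_add_sdiff hE.measurableSet hZB]
  have h1 : ∫ p in B ∩ E, Z p ≤ c * ∫ p in E, S p := by
    rw [← integral_const_mul]
    refine (setIntegral_mono_on (hZB.mono_set Set.inter_subset_left)
      (hcS.mono_set Set.inter_subset_right)
      (hB.measurableSet.inter hE.measurableSet) fun p hp => hZS p hp.1).trans ?_
    exact setIntegral_mono_set hcS ((ae_restrict_iff' hE.measurableSet).2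
      (.of_forall fun p hp => mul_nonneg hc (hS0 p hp))) Set.inter_subset_right.eventuallyLE
  have hF : IsCompact (L ×ˢ Set.Icc (T - s) T) := hL.prod isCompact_Icc
  have hsub : B \ E ⊆ L ×ˢ Set.Icc (T - s) T := by
    rintro ⟨x, t⟩ ⟨hp, hpE⟩
    obtain ⟨hx, ht⟩ := hBL hp
    refine ⟨hx, ?_, ht.2⟩
    by_contra! h
    exact hpE ⟨hx, ht.1, h.le⟩
  have h2 : ∫ p in B \ E, Z p ≤ k * (volume.real L * s) := by
    have hfin : volume (B \ E) < ⊤ :=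
      (measure_mono Set.sdiff_subset).trans_lt hB.measure_lt_top
    have h := norm_setIntegral_le_of_norm_le_const (f := Z) (C := k) hfin fun p hp => by
      rw [Real.norm_of_nonneg (hZ0 p hp.1)]
      exact hZk p hp.1
    refine (le_abs_self _).trans (h.trans (mul_le_mul_of_nonneg_left ?_ hk))
    refine (measureReal_mono hsub hF.measure_lt_top.ne).trans_eq ?_
    rw [Measure.volume_eq_prod, measureReal_prod_prod, Real.volume_real_Icc_of_le (by linarith)]
    ring
  exact add_le_add h1 h2

end Stability

/-- Stability of the strong maximum principle (Lemma 2.1): for a bounded domain Ω ⊂ ℝⁿ,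
a compact K ⊆ Ω, an open Ω' with closure in Ω, τ ∈ (0,T), a bound A on the drift and
ε > 0, there is δ = δ(Ω,Ω',K,T,A,τ,ε) > 0 such that any bounded solution u of
u_t + a∇u - Δu = 0 on Ω × (0,T) with sup |u| = M and sup_K u(·,T) ≥ M(1-δ)
satisfies u ≥ M(1-ε) on Ω' × (τ,T). -/
theorem strong_maximum_principle_stability
    (n : ℕ) (Ω Ω' K : Set (Euc n)) (T τ A ε : ℝ)
    (hΩopen : IsOpen Ω) (hΩconn : IsConnected Ω) (hΩbdd : Bornology.IsBounded Ω)
    (hK : IsCompact K) (hKΩ : K ⊆ Ω)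
    (hΩ'open : IsOpen Ω') (hΩ'sub : closure Ω' ⊆ Ω)
    (hT : 0 < T) (hτ : τ ∈ Set.Ioo 0 T) (hA : 0 < A) (hε : 0 < ε) :
    ∃ δ > (0:ℝ), ∀ (a g : Euc n → ℝ → Euc n) (u : Euc n → ℝ → ℝ) (M : ℝ),
      Measurable (fun p : Euc n × ℝ => a p.1 p.2) →
      Measurable (fun p : Euc n × ℝ => u p.1 p.2) →
      Measurable (fun p : Euc n × ℝ => g p.1 p.2) →
      -- |a| ≤ A almost everywhere on Ω × (0,T)
      (∀ᵐ p ∂(volume.restrict (Ω ×ˢ Set.Ioo 0 T : Set (Euc n × ℝ))), ‖a p.1 p.2‖ ≤ A) →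
      -- u and its distributional spatial gradient g are locally square-integrable
      MeasureTheory.LocallyIntegrableOn (fun p : Euc n × ℝ => (u p.1 p.2) ^ 2)
        (Ω ×ˢ Set.Ioo 0 T) →
      MeasureTheory.LocallyIntegrableOn (fun p : Euc n × ℝ => ‖g p.1 p.2‖ ^ 2)
        (Ω ×ˢ Set.Ioo 0 T) →
      -- g is the distributional spatial gradient of u on Ω × (0,T)
      (∀ ψ : Euc n × ℝ → ℝ, ContDiff ℝ (⊤ : ℕ∞) ψ → HasCompactSupport ψ →
        tsupport ψ ⊆ Ω ×ˢ Set.Ioo 0 T → ∀ i : Fin n,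
        (∫ p in (Ω ×ˢ Set.Ioo 0 T : Set (Euc n × ℝ)), u p.1 p.2 * pdx n i ψ p)
          = -∫ p in (Ω ×ˢ Set.Ioo 0 T : Set (Euc n × ℝ)), g p.1 p.2 i * ψ p) →
      -- u_t + a·∇u - Δu = 0 in the sense of distributions on Ω × (0,T)
      (∀ ψ : Euc n × ℝ → ℝ, ContDiff ℝ (⊤ : ℕ∞) ψ → HasCompactSupport ψ →
        tsupport ψ ⊆ Ω ×ˢ Set.Ioo 0 T →
        (∫ p in (Ω ×ˢ Set.Ioo 0 T : Set (Euc n × ℝ)),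
          (-(u p.1 p.2 * pdt n ψ p)
            + (∑ i : Fin n, a p.1 p.2 i * g p.1 p.2 i) * ψ p
            + ∑ i : Fin n, g p.1 p.2 i * pdx n i ψ p)) = 0) →
      -- u is continuous in the parabolic interior (by parabolic regularity)
      ContinuousOn (fun p : Euc n × ℝ => u p.1 p.2) (Ω ×ˢ Set.Ioc 0 T) →
      -- sup over Ω × (0,T) of |u| equals M
      IsLUB ((fun p : Euc n × ℝ => |u p.1 p.2|) '' (Ω ×ˢ Set.Ioo 0 T)) M →
      -- sup over K of u(·,T) is at least M(1-δ)
      M * (1 - δ) ≤ sSup ((fun x => u x T) '' K) →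
      ∀ x ∈ Ω', ∀ t ∈ Set.Ioo τ T, M * (1 - ε) ≤ u x t := by
  obtain ⟨hτ0, hτT⟩ := hτ
  have hΩ'c : IsCompact (closure Ω') :=
    Metric.isCompact_of_isClosed_isBounded isClosed_closure (hΩbdd.subset hΩ'sub)
  obtain ⟨r, hr, hrΩ⟩ := hΩ'c.exists_cthickening_subset_open hΩopen hΩ'sub
  have hL : IsCompact (Metric.cthickening r (closure Ω')) := hΩ'c.cthickening
  set L := Metric.cthickening r (closure Ω') with hLdef
  obtain ⟨C, hC, HC⟩ := exists_le_integral_of_isSubcal n hr (half_pos hτ0)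
  set e₁ := Real.exp (A ^ 2 / 2 * T)
  set e₂ := Real.exp (A ^ 2 / 4 * T)
  have he₁ : 0 < e₁ := Real.exp_pos _
  have he₂ : 0 < e₂ := Real.exp_pos _
  have hV : 0 ≤ volume.real L := measureReal_nonneg
  -- the height of the layer below the top
  obtain ⟨s, hs, hsε⟩ : ∃ s > 0, e₁ * C * (9 * (volume.real L * s)) ≤ ε ^ 2 / 2 := by
    refine ⟨ε ^ 2 / 2 / (e₁ * C * 9 * volume.real L + 1), by positivity, ?_⟩
    calc e₁ * C * (9 * (volume.real L * (ε ^ 2 / 2 / (e₁ * C * 9 * volume.real L + 1))))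
        = (e₁ * C * 9 * volume.real L) / (e₁ * C * 9 * volume.real L + 1) * (ε ^ 2 / 2) := by ring
      _ ≤ 1 * (ε ^ 2 / 2) := by
          gcongr
          exact (div_le_one (by positivity)).2 (by linarith)
      _ = ε ^ 2 / 2 := one_mul _
  have hEQ : L ×ˢ Set.Icc (τ / 2) (T - s) ⊆ Ω ×ˢ Set.Ioo 0 T :=
    Set.prod_mono hrΩ fun t ht => ⟨by linarith [ht.1], by linarith [ht.2]⟩
  obtain ⟨D, hD, HD⟩ := exists_integral_le_top hΩopen hΩconn.isPreconnected hT hK hKΩ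
    (hL.prod isCompact_Icc) hEQ
  obtain ⟨δ, hδ0, hδ1, hδε⟩ : ∃ δ > 0, δ < 1 ∧
      e₁ * C * (6 * (D * (e₂ * √(3 * δ)))) ≤ ε ^ 2 / 2 := by
    have hlim : Tendsto (fun δ : ℝ => e₁ * C * (6 * (D * (e₂ * √(3 * δ))))) (𝓝[>] 0) (𝓝 0) := by
      have : Continuous fun δ : ℝ => e₁ * C * (6 * (D * (e₂ * √(3 * δ)))) := by fun_prop
      simpa using (this.tendsto 0).mono_left nhdsWithin_le_nhds
    obtain ⟨δ, h1, h2, h3⟩ := ((hlim.eventually_le_const (by positivity : 0 < ε ^ 2 / 2)).and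
      ((eventually_mem_of_tendsto_nhdsWithin tendsto_id).and
        (nhdsWithin_le_nhds (Iio_mem_nhds one_pos)))).exists
    exact ⟨δ, h2, h3, h1⟩
  refine ⟨δ, hδ0, fun a g u M ha hu hg haA _ hg2 hgrad heq huc hlub hsup x hx t ht => ?_⟩
  set Q : Set (Euc n × ℝ) := Ω ×ˢ Set.Ioo 0 T
  have hQ : IsOpen Q := hΩopen.prod isOpen_Ioo
  have hQsub : Q ⊆ Ω ×ˢ Set.Ioc 0 T := Set.prod_mono subset_rfl Set.Ioo_subset_Ioc_self
  have hM : ∀ p ∈ Q, |u p.1 p.2| ≤ M := fun p hp => hlub.1 ⟨p, hp, rfl⟩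
  have hxt : (x, t) ∈ Q := ⟨hΩ'sub (subset_closure hx), hτ0.trans ht.1, ht.2⟩
  rcases (abs_nonneg _ |>.trans (hM _ hxt)).eq_or_lt with hM0 | hM0
  · have := hM _ hxt
    rw [← hM0] at this ⊢
    simp [abs_nonpos_iff.1 this]
  have hKne : K.Nonempty := by
    by_contra! h
    rw [h, Set.image_empty, Real.sSup_empty] at hsup
    nlinarith [mul_pos hM0 (sub_pos.2 hδ1)]
  obtain ⟨_, ⟨x₀, hx₀, rfl⟩, hux₀⟩ : ∃ b ∈ (fun x => u x T) '' K, M * (1 - 2 * δ) < b :=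
    exists_lt_of_lt_csSup (hKne.image _) (lt_of_lt_of_le (by nlinarith [mul_pos hM0 hδ0]) hsup)
  simp only at hux₀
  obtain ⟨h1, h2⟩ := isSubcal_of_solution (u := fun p => u p.1 p.2) (a := fun p => a p.1 p.2)
    (g := fun p => g p.1 p.2) hA.le hQ hM0 hδ0 hu ha hg hM (huc.mono hQsub) haA hg2 hgrad heq
  set v : Euc n × ℝ → ℝ := fun p => 1 + δ - u p.1 p.2 / M with hvdef
  have hv : ∀ p ∈ Q, 0 ≤ v p ∧ v p ≤ 3 := fun p hp => by
    have h := abs_le.1 (hM p hp)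
    have h3 : u p.1 p.2 / M ≤ 1 := (div_le_one hM0).2 h.2
    have h4 : -1 ≤ u p.1 p.2 / M := by
      rw [le_div_iff₀ hM0]
      linarith
    exact ⟨by simp only [hvdef]; linarith, by simp only [hvdef]; linarith⟩
  have hvc : ContinuousOn v (Ω ×ˢ Set.Ioc 0 T) := continuousOn_const.sub (huc.div_const M)
  set S : Euc n × ℝ → ℝ := fun p => Real.exp (A ^ 2 / 4 * p.2) * √(v p) with hSdef
  set Z : Euc n × ℝ → ℝ := fun p => Real.exp (-(A ^ 2 / 2) * p.2) * v p ^ 2 with hZdef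
  have hSc : ContinuousOn S (Ω ×ˢ Set.Ioc 0 T) := by
    refine ContinuousOn.mul (Continuous.continuousOn (by fun_prop)) hvc.sqrt
  have hS0 : ∀ p, 0 ≤ S p := fun p => by positivity
  have hZc : ContinuousOn Z Q :=
    ContinuousOn.mul (Continuous.continuousOn (by fun_prop)) ((hvc.mono hQsub).pow 2)
  have hZ0 : ∀ p, 0 ≤ Z p := fun p => by positivity
  have hZv : ∀ p ∈ Q, Z p ≤ v p ^ 2 := fun p hp => by
    refine mul_le_of_le_one_left (sq_nonneg _) (Real.exp_le_one_iff.2 ?_)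
    have := hp.2.1.le
    nlinarith [mul_nonneg (sq_nonneg A) this]
  have hvS : ∀ p ∈ Q, √(v p) ≤ S p := fun p hp => by
    refine le_mul_of_one_le_left (Real.sqrt_nonneg _) (Real.one_le_exp ?_)
    have := hp.2.1.le
    positivity
  have hsuper : IsSuper n Q S := by
    refine ⟨hSc.mono hQsub, fun p _ => hS0 p, ?_⟩
    simpa only [hSdef, mul_neg] using h1
  have hSx₀ : S (x₀, T) ≤ e₂ * √(3 * δ) := by
    refine mul_le_mul_of_nonneg_left (Real.sqrt_le_sqrt ?_) he₂.le
    have : 1 - 2 * δ ≤ u x₀ T / M := by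
      rw [le_div_iff₀ hM0]
      linarith
    simp only [hvdef]
    linarith
  have hball : Metric.closedBall x r ⊆ L :=
    Metric.closedBall_subset_cthickening (subset_closure hx) r
  have hBQ : Metric.closedBall x r ×ˢ Set.Icc (t - τ / 2) t ⊆ Q :=
    Set.prod_mono (hball.trans hrΩ) fun t' ht' => ⟨by linarith [ht.1, ht'.1], ht'.2.trans_lt ht.2⟩
  have hmain := HC Q Z x t h2 hQ.measurableSet hZc (fun p _ => hZ0 p) hBQ
  have hint := setIntegral_le_of_top_layer (τ := τ / 2) (c := 6) (k := 9) (Z := Z) (S := S) hL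
    ((isCompact_closedBall x r).prod isCompact_Icc) hs.le (by norm_num) (by norm_num)
    (Set.prod_mono hball (Set.Icc_subset_Icc (by linarith [ht.1]) ht.2.le)) (hZc.mono hBQ)
    (hSc.mono (hEQ.trans hQsub)) (fun p _ => hS0 p) (fun p _ => hZ0 p)
    (fun p hp => (hZv p (hBQ hp)).trans (by nlinarith [hv p (hBQ hp)]))
    (fun p hp => (hZv p (hBQ hp)).trans ((sq_le_six_mul_sqrt (hv p (hBQ hp)).1
      (hv p (hBQ hp)).2).trans (by linarith [hvS p (hBQ hp)])))
  have htop := (HD S hsuper hSc x₀ hx₀).trans (mul_le_mul_of_nonneg_left hSx₀ hD)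
  have hvZ : v (x, t) ^ 2 ≤ e₁ * Z (x, t) := by
    rw [hZdef]
    simp only [e₁]
    rw [← mul_assoc, ← Real.exp_add]
    refine le_mul_of_one_le_left (sq_nonneg _) (Real.one_le_exp ?_)
    nlinarith [mul_nonneg (sq_nonneg A) (sub_nonneg.2 ht.2.le)]
  have hvε : v (x, t) ^ 2 ≤ ε ^ 2 := by
    calc v (x, t) ^ 2 ≤ e₁ * Z (x, t) := hvZ
      _ ≤ e₁ * (C * (6 * (D * (e₂ * √(3 * δ))) + 9 * (volume.real L * s))) := by
          gcongr
          exact hmain.trans (mul_le_mul_of_nonneg_left (by linarith) hC.le)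
      _ ≤ ε ^ 2 := by linarith
  have h := abs_le_of_sq_le_sq' hvε hε.le |>.2
  have h5 : 1 - ε ≤ u x t / M := by
    simp only [hvdef] at h
    linarith
  rw [le_div_iff₀ hM0] at h5
  linarith

end
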